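/- Assume ω ∈ ℝ^n satisfies (H1), f : T^n → ℝ is smooth, and the Poincaré–Melnikov primitive Γ(A) = ∫_ℝ (1 − cos(q_0(t)))·f(ωt + A) dt possesses a non-degenerate minimum (a critical point with positive definite Hessian). Then there exist μ_0 > 0 and C > 0 such that for every 0 < μ < μ_0 and all I_0, I_0' ∈ ℝ^n with ω·I_0 = ω·I_0', there exists a heteroclinic solution of the equations of motion connecting T_{I_0} and T_{I_0'}, and for every sufficiently small η > 0 there is an orbit going from the η-neighbourhood of T_{I_0} to the η-neighbourhood of T_{I_0'} within a diffusion time T_d ≤ C·(1/μ)·log(1/μ) + C·|ln η|. -/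

import Mathlib

open Real Filter MeasureTheory

/-- The unperturbed pendulum separatrix `q₀(t) = 4 arctan(eᵗ)`. -/
noncomputable def q0 (t : ℝ) : ℝ := 4 * Real.arctan (Real.exp t)

/-- `(φ, I, q, p)` is a solution of the equations of motion of the Hamiltonian
`ℋ_μ = ω·I + p²/2 + (cos q - 1) + μ (1 - cos q) f(φ)`. -/
def IsSolution (n : ℕ) (ω : Fin n → ℝ) (f : (Fin n → ℝ) → ℝ) (μ : ℝ)
    (φ I : ℝ → Fin n → ℝ) (q p : ℝ → ℝ) : Prop :=
  ∀ t : ℝ,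
    HasDerivAt φ ω t ∧
    HasDerivAt I
      ((-(μ * (1 - Real.cos (q t)))) • fun i => fderiv ℝ f (φ t) (Pi.single i 1)) t ∧
    HasDerivAt q (p t) t ∧
    HasDerivAt p (Real.sin (q t) - μ * Real.sin (q t) * f (φ t)) t

/-- The invariant torus `T_{I₀} = {I = I₀, q = p = 0}` in the covering space. -/
def TorusSet (n : ℕ) (I0 : Fin n → ℝ) : Set ((Fin n → ℝ) × (Fin n → ℝ) × ℝ × ℝ) :=
  {x | ∃ (ψ : Fin n → ℝ) (m : ℤ), x = (ψ, I0, 2 * Real.pi * (m : ℝ), 0)}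

/-- The Poincaré–Melnikov primitive `Γ(A) = ∫_ℝ (1 - cos q₀(t)) f(ωt + A) dt`. -/
noncomputable def Melnikov (n : ℕ) (ω : Fin n → ℝ) (f : (Fin n → ℝ) → ℝ)
    (A : Fin n → ℝ) : ℝ :=
  ∫ t : ℝ, (1 - Real.cos (q0 t)) * f (fun i => ω i * t + A i)

section DmPart1
open Set Topology

/-- interior local max contradiction -/
lemma dm_mpcore (d d' : ℝ → ℝ) (x y a : ℝ) (hx : a < x)
    (hd : ∀ t ∈ Icc a x, HasDerivAt d (d' t) t) (hd2 : HasDerivAt d' y a)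
    (h0 : d' a = 0) (hy : 0 < y) (hmax : ∀ t ∈ Icc a x, d t ≤ d a) : False := by
  have h1 := hd2.tendsto_slope
  have h2 : ∀ᶠ t in 𝓝[≠] a, 0 < slope d' a t := h1.eventually (lt_mem_nhds hy)
  have h3 : ∀ᶠ t in 𝓝[>] a, 0 < slope d' a t :=
    h2.filter_mono (nhdsWithin_mono _ (fun t (ht : a < t) => ne_of_gt ht))
  have h4 : ∀ᶠ t in 𝓝[>] a, 0 < d' t := by
    filter_upwards [h3, self_mem_nhdsWithin] with t ht hta
    rw [slope_def_field, h0, sub_zero] at ht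
    have : (0:ℝ) < t - a := sub_pos.2 hta
    by_contra hcon
    exact absurd ht (not_lt.2 (div_nonpos_of_nonpos_of_nonneg (not_lt.1 hcon) this.le))
  obtain ⟨u, hu, hu2⟩ := (mem_nhdsGT_iff_exists_Ioo_subset).1 h4
  have hua : a < u := hu
  set b := min x ((a+u)/2) with hb
  have hab : a < b := lt_min hx (by linarith)
  have hbx : b ≤ x := min_le_left _ _
  have hbu : b < u := lt_of_le_of_lt (min_le_right _ _) (by linarith)
  obtain ⟨c, hc, hc2⟩ := exists_hasDerivAt_eq_slope d d' hab
    (fun t ht => (hd t ⟨ht.1, ht.2.trans hbx⟩).continuousAt.continuousWithinAt)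
    (fun t ht => hd t ⟨ht.1.le, ht.2.le.trans hbx⟩)
  have h5 : 0 < d' c := hu2 ⟨hc.1, hc.2.trans hbu⟩
  rw [hc2] at h5
  have h6 := hmax b ⟨hab.le, hbx⟩
  exact absurd h5 (not_lt.2 (div_nonpos_of_nonpos_of_nonneg (by linarith) (by linarith)))

lemma dm_mpIcc (L : ℝ) (d d' d'' : ℝ → ℝ) (h1 : ∀ t ∈ Icc 0 L, HasDerivAt d (d' t) t)
    (h2 : ∀ t ∈ Icc 0 L, HasDerivAt d' (d'' t) t) (h0 : d 0 ≤ 0) (hL : d L ≤ 0)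
    (h3 : ∀ t ∈ Icc 0 L, d t ≤ d'' t) : ∀ t ∈ Icc 0 L, d t ≤ 0 := by
  intro t ht
  by_contra hcon
  push Not at hcon
  obtain ⟨s, hs, hsm⟩ := isCompact_Icc.exists_isMaxOn (⟨t, ht⟩ : (Icc (0:ℝ) L).Nonempty)
    (f := d) (fun t ht => (h1 t ht).continuousAt.continuousWithinAt)
  have hsp : 0 < d s := lt_of_lt_of_le hcon (hsm ht)
  have hs0 : 0 < s := lt_of_le_of_ne hs.1 (by rintro rfl; linarith)
  have hsL : s < L := lt_of_le_of_ne hs.2 (by rintro rfl; linarith)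
  have hloc : IsLocalMax d s := hsm.isLocalMax (Icc_mem_nhds hs0 hsL)
  exact dm_mpcore d d' L (d'' s) s hsL (fun t ht => h1 t ⟨hs0.le.trans ht.1, ht.2⟩) (h2 s hs)
    (hloc.hasDerivAt_eq_zero (h1 s hs)) (hsp.trans_le (h3 s hs))
    (fun t ht => hsm ⟨hs0.le.trans ht.1, ht.2⟩)

/-- abstract domain -/
structure Dom (I bd : Set ℝ) : Prop where
  mp : ∀ d d' d'' : ℝ → ℝ, (∀ t ∈ I, HasDerivAt d (d' t) t) → (∀ t ∈ I, HasDerivAt d' (d'' t) t) →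
    (∀ t ∈ bd, d t ≤ 0) → (∃ B, ∀ t ∈ I, d t ≤ B) → (∀ t ∈ I, d t ≤ d'' t) → ∀ t ∈ I, d t ≤ 0
  solve : ∀ h : ℝ → ℝ, Continuous h → (∃ B, ∀ t, |h t| ≤ B) → ∃ u p : ℝ → ℝ,
    (∀ t, HasDerivAt u (p t) t) ∧ (∀ t, HasDerivAt p (u t - h t) t) ∧ (∀ t ∈ bd, u t = 0) ∧
    ∃ B, ∀ t ∈ I, |u t| ≤ B
  clamp : ∃ cl : ℝ → ℝ, Continuous cl ∧ (∀ t, cl t ∈ I) ∧ ∀ t ∈ I, cl t = t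
  nbr : ∀ t ∈ I, Icc t (t+1) ⊆ I ∨ Icc (t-1) t ⊆ I
  meas : MeasurableSet I
  bdI : bd ⊆ I
  ftc : ∀ g g' : ℝ → ℝ, (∀ t ∈ I, HasDerivAt g (g' t) t) → IntegrableOn g' I → IntegrableOn g I →
    (∀ t ∈ bd, g t = 0) → ∫ t in I, g' t = 0

lemma dm_volterra (h : ℝ → ℝ) (hc : Continuous h) : ∃ u p : ℝ → ℝ,
    (∀ t, HasDerivAt u (p t) t) ∧ (∀ t, HasDerivAt p (u t - h t) t) ∧ u 0 = 0 ∧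
    ∀ t, u t = Real.cosh t * (∫ s in (0:ℝ)..t, Real.sinh s * h s)
      - Real.sinh t * (∫ s in (0:ℝ)..t, Real.cosh s * h s) := by
  have hS : ∀ t, HasDerivAt (fun t => ∫ s in (0:ℝ)..t, Real.sinh s * h s) (Real.sinh t * h t) t :=
    fun t => intervalIntegral.integral_hasDerivAt_right
      ((Real.continuous_sinh.mul hc).intervalIntegrable _ _)
      ((Real.continuous_sinh.mul hc).stronglyMeasurableAtFilter _ _)
      (Real.continuous_sinh.mul hc).continuousAt
  have hC : ∀ t, HasDerivAt (fun t => ∫ s in (0:ℝ)..t, Real.cosh s * h s) (Real.cosh t * h t) t :=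
    fun t => intervalIntegral.integral_hasDerivAt_right
      ((Real.continuous_cosh.mul hc).intervalIntegrable _ _)
      ((Real.continuous_cosh.mul hc).stronglyMeasurableAtFilter _ _)
      (Real.continuous_cosh.mul hc).continuousAt
  refine ⟨fun t => Real.cosh t * (∫ s in (0:ℝ)..t, Real.sinh s * h s)
      - Real.sinh t * (∫ s in (0:ℝ)..t, Real.cosh s * h s),
    fun t => Real.sinh t * (∫ s in (0:ℝ)..t, Real.sinh s * h s)
      - Real.cosh t * (∫ s in (0:ℝ)..t, Real.cosh s * h s), ?_, ?_, ?_, fun t => rfl⟩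
  · intro t
    have := ((Real.hasDerivAt_cosh t).mul (hS t)).sub ((Real.hasDerivAt_sinh t).mul (hC t))
    exact this.congr_deriv (by ring)
  · intro t
    have := ((Real.hasDerivAt_sinh t).mul (hS t)).sub ((Real.hasDerivAt_cosh t).mul (hC t))
    refine this.congr_deriv ?_
    have := Real.cosh_sq t
    linear_combination (-h t) * this
  · simp

lemma dm_domIcc (L : ℝ) (hL : 2 ≤ L) : Dom (Icc 0 L) {0, L} where
  mp d d' d'' h1 h2 h3 _ h4 := dm_mpIcc L d d' d'' h1 h2 (h3 0 (by simp)) (h3 L (by simp)) h4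
  solve h hc _ := by
    obtain ⟨u, p, h1, h2, h0, -⟩ := dm_volterra h hc
    have hs : Real.sinh L ≠ 0 := by
      have := Real.sinh_pos_iff.2 (by linarith : 0 < L); exact this.ne'
    refine ⟨fun t => u t - (u L / Real.sinh L) * Real.sinh t,
      fun t => p t - (u L / Real.sinh L) * Real.cosh t, ?_, ?_, ?_, ?_⟩
    · intro t
      exact (h1 t).sub ((Real.hasDerivAt_sinh t).const_mul _)
    · intro t
      exact ((h2 t).sub ((Real.hasDerivAt_cosh t).const_mul (u L / Real.sinh L))).congr_deriv
        (by ring)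
    · intro t ht
      rcases ht with rfl | ht
      · simp [h0]
      · rw [mem_singleton_iff] at ht; subst ht; field_simp; simp
    · have hcont : ContinuousOn (fun t => u t - (u L / Real.sinh L) * Real.sinh t) (Icc 0 L) := by
        refine ContinuousOn.sub (fun t _ => (h1 t).continuousAt.continuousWithinAt) ?_
        exact (continuous_const.mul Real.continuous_sinh).continuousOn
      obtain ⟨B, hB⟩ := isCompact_Icc.exists_bound_of_continuousOn hcont
      exact ⟨B, fun t ht => hB t ht⟩
  clamp := by
    refine ⟨fun t => max 0 (min t L), by fun_prop, fun t => ⟨le_max_left _ _, max_le (by linarith) (min_le_right _ _)⟩, ?_⟩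
    intro t ht
    simp [min_eq_left ht.2, max_eq_right ht.1]
  nbr t ht := by
    by_cases h : t + 1 ≤ L
    · left; intro s hs; exact ⟨ht.1.trans hs.1, hs.2.trans h⟩
    · by_cases h' : 0 ≤ t - 1
      · right; intro s hs; exact ⟨h'.trans hs.1, hs.2.trans ht.2⟩
      · push Not at h h'; exfalso
        linarith
  meas := measurableSet_Icc
  bdI := by
    intro t ht
    rcases ht with rfl | ht
    · exact ⟨le_rfl, by linarith⟩
    · rw [mem_singleton_iff] at ht; subst ht; exact ⟨by linarith, le_rfl⟩
  ftc g g' h1 h2 _ h3 := by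
    rw [integral_Icc_eq_integral_Ioc, ← intervalIntegral.integral_of_le (by linarith)]
    have := intervalIntegral.integral_eq_sub_of_hasDerivAt (f := g) (f' := g') (a := 0) (b := L)
      (fun t ht => by rw [uIcc_of_le (by linarith)] at ht; exact h1 t ht)
      (by rw [intervalIntegrable_iff_integrableOn_Icc_of_le (by linarith)]; exact h2)
    rw [this, h3 L (by simp), h3 0 (by simp), sub_zero]

lemma dm_mpIci (d d' d'' : ℝ → ℝ) (h1 : ∀ t ∈ Ici (0:ℝ), HasDerivAt d (d' t) t)
    (h2 : ∀ t ∈ Ici (0:ℝ), HasDerivAt d' (d'' t) t) (h0 : d 0 ≤ 0) (B : ℝ)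
    (hB : ∀ t ∈ Ici (0:ℝ), d t ≤ B)
    (h3 : ∀ t ∈ Ici (0:ℝ), d t ≤ d'' t) : ∀ t ∈ Ici (0:ℝ), d t ≤ 0 := by
  intro t ht
  have key : ∀ ε > 0, d t ≤ ε * Real.cosh (t/2) := by
    intro ε hε
    obtain ⟨N, hN⟩ := exists_nat_gt (max t (4 * B / ε))
    have hNt : t < N := (le_max_left _ _).trans_lt hN
    have hNB : B < ε * (N/4) := by
      have := (le_max_right _ _).trans_lt hN
      rw [div_lt_iff₀ hε] at this; linarith
    have hc : ∀ s, HasDerivAt (fun s => Real.cosh (s/2)) (Real.sinh (s/2) / 2) s := fun s => by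
      have := (Real.hasDerivAt_cosh (s/2)).comp s ((hasDerivAt_id s).div_const 2)
      exact this.congr_deriv (by ring)
    have hs : ∀ s, HasDerivAt (fun s => Real.sinh (s/2) / 2) (Real.cosh (s/2) / 4) s := fun s => by
      have := ((Real.hasDerivAt_sinh (s/2)).comp s ((hasDerivAt_id s).div_const 2)).div_const 2
      exact this.congr_deriv (by ring)
    have hcN : (N:ℝ)/4 ≤ Real.cosh ((N:ℝ)/2) := by
      rw [Real.cosh_eq]
      have := Real.add_one_le_exp ((N:ℝ)/2)
      have := Real.exp_pos (-((N:ℝ)/2))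
      linarith
    have := dm_mpIcc N (fun s => d s - ε * Real.cosh (s/2)) (fun s => d' s - ε * (Real.sinh (s/2)/2))
      (fun s => d'' s - ε * (Real.cosh (s/2) / 4))
      (fun s hs' => (h1 s hs'.1).sub ((hc s).const_mul ε))
      (fun s hs' => (h2 s hs'.1).sub ((hs s).const_mul ε))
      (by simp; linarith)
      (by
        have h5 := hB N (mem_Ici.2 (Nat.cast_nonneg N))
        have h6 := mul_le_mul_of_nonneg_left hcN hε.le
        linarith)
      (fun s hs' => by
        have h5 := h3 s hs'.1
        have h6 := mul_pos hε (Real.cosh_pos (s/2))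
        linarith) t ⟨ht, hNt.le⟩
    linarith
  refine le_of_forall_pos_le_add (fun ε hε => ?_)
  have := key (ε / Real.cosh (t/2)) (div_pos hε (Real.cosh_pos _))
  rw [div_mul_cancel₀ _ (Real.cosh_pos _).ne'] at this
  linarith

lemma dm_domIci : Dom (Ici 0) {0} where
  mp d d' d'' h1 h2 h3 hB h4 := by
    obtain ⟨B, hB⟩ := hB
    exact dm_mpIci d d' d'' h1 h2 (h3 0 (by simp)) B hB h4
  solve h hc hB := by
    obtain ⟨B, hB⟩ := hB
    have hB0 : 0 ≤ B := (abs_nonneg _).trans (hB 0)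
    obtain ⟨u, p, h1, h2, h0, huf⟩ := dm_volterra h hc
    set k := ∫ s in Ioi (0:ℝ), Real.exp (-s) * h s
    have hexp : ∀ c : ℝ, IntegrableOn (fun s => Real.exp (-s)) (Ioi c) := fun c =>
      integrableOn_exp_neg_Ioi c
    have hIntg : ∀ c : ℝ, IntegrableOn (fun s => Real.exp (-s) * h s) (Ioi c) := fun c => by
      refine ((hexp c).mul_const B).mono' (by fun_prop) ?_
      refine ae_of_all _ (fun s => ?_)
      rw [norm_mul, Real.norm_eq_abs, abs_of_pos (Real.exp_pos _)]
      exact mul_le_mul_of_nonneg_left (hB s) (Real.exp_pos _).le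
    have hk : ∀ t, |k - ∫ s in (0:ℝ)..t, Real.exp (-s) * h s| ≤ Real.exp (-t) * B := by
      intro t
      have := intervalIntegral.integral_interval_add_Ioi (hIntg 0) (hIntg t)
      have e : k - ∫ s in (0:ℝ)..t, Real.exp (-s) * h s = ∫ s in Ioi t, Real.exp (-s) * h s := by
        linarith
      rw [e, ← Real.norm_eq_abs]
      refine (norm_integral_le_of_norm_le ((hexp t).mul_const B) ?_).trans ?_
      · refine ae_of_all _ (fun s => ?_)
        rw [norm_mul, Real.norm_eq_abs, abs_of_pos (Real.exp_pos _)]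
        exact mul_le_mul_of_nonneg_left (hB s) (Real.exp_pos _).le
      · rw [integral_mul_const, integral_exp_neg_Ioi]
    refine ⟨fun t => u t + k * Real.sinh t, fun t => p t + k * Real.cosh t, ?_, ?_, ?_, ?_⟩
    · intro t; exact (h1 t).add ((Real.hasDerivAt_sinh t).const_mul _)
    · intro t
      exact ((h2 t).add ((Real.hasDerivAt_cosh t).const_mul k)).congr_deriv (by ring)
    · intro t ht; rw [mem_singleton_iff] at ht; subst ht; simp [h0]
    · refine ⟨2 * B, fun t ht => ?_⟩
      have ht0 : (0:ℝ) ≤ t := ht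
      have e1 : Real.cosh t - Real.sinh t = Real.exp (-t) := Real.cosh_sub_sinh t
      have e2 : (∫ s in (0:ℝ)..t, Real.exp (-s) * h s) =
          (∫ s in (0:ℝ)..t, Real.cosh s * h s) - ∫ s in (0:ℝ)..t, Real.sinh s * h s := by
        have h7 := intervalIntegral.integral_sub (μ := volume)
          (f := fun s => Real.cosh s * h s) (g := fun s => Real.sinh s * h s) (a := 0) (b := t)
          ((Real.continuous_cosh.mul hc).intervalIntegrable _ _)
          ((Real.continuous_sinh.mul hc).intervalIntegrable _ _)
        rw [← h7]
        refine intervalIntegral.integral_congr (fun s _ => ?_)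
        simp only [← Real.cosh_sub_sinh]; ring
      have e3 : u t + k * Real.sinh t = Real.sinh t * (k - ∫ s in (0:ℝ)..t, Real.exp (-s) * h s)
          + Real.exp (-t) * ∫ s in (0:ℝ)..t, Real.sinh s * h s := by
        rw [huf, e2, ← e1]; ring
      have hsn : 0 ≤ Real.sinh t := Real.sinh_nonneg_iff.2 ht0
      have e4 : |∫ s in (0:ℝ)..t, Real.sinh s * h s| ≤ B * (Real.cosh t - 1) := by
        rw [← Real.norm_eq_abs]
        have hd : (∫ s in (0:ℝ)..t, B * Real.sinh s) = B * (Real.cosh t - 1) := by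
          rw [intervalIntegral.integral_eq_sub_of_hasDerivAt (f := fun s => B * Real.cosh s)
            (fun s _ => (Real.hasDerivAt_cosh s).const_mul B)
            ((continuous_const.mul Real.continuous_sinh).intervalIntegrable _ _)]
          simp; ring
        rw [← hd]
        refine intervalIntegral.norm_integral_le_of_norm_le ht0 (ae_of_all _ (fun s hs => ?_))
          ((continuous_const.mul Real.continuous_sinh).intervalIntegrable _ _)
        rw [norm_mul, Real.norm_eq_abs, abs_of_nonneg (Real.sinh_nonneg_iff.2 hs.1.le), mul_comm]
        exact mul_le_mul_of_nonneg_right (hB s) (Real.sinh_nonneg_iff.2 hs.1.le)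
      have e5 : Real.exp (-t) * Real.sinh t ≤ 1 := by
        rw [Real.sinh_eq, Real.exp_neg]
        have := Real.exp_pos t
        have h7 : 0 < (Real.exp t)⁻¹ := by positivity
        have h8 : (Real.exp t)⁻¹ * Real.exp t = 1 := inv_mul_cancel₀ this.ne'
        nlinarith
      have e6 : Real.exp (-t) * (Real.cosh t - 1) ≤ 1 := by
        rw [Real.cosh_eq, Real.exp_neg]
        have := Real.exp_pos t
        have h7 : 0 < (Real.exp t)⁻¹ := by positivity
        have h8 : (Real.exp t)⁻¹ * Real.exp t = 1 := inv_mul_cancel₀ this.ne'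
        have h9 : (Real.exp t)⁻¹ ≤ 1 := inv_le_one_of_one_le₀ (Real.one_le_exp ht0)
        nlinarith
      show |u t + k * Real.sinh t| ≤ _
      rw [e3]
      refine (abs_add_le _ _).trans ?_
      rw [abs_mul, abs_mul, abs_of_nonneg hsn, abs_of_pos (Real.exp_pos _)]
      have g1 := mul_le_mul_of_nonneg_left (hk t) hsn
      have g2 := mul_le_mul_of_nonneg_left e4 (Real.exp_pos (-t)).le
      have g3 := mul_le_mul_of_nonneg_right e5 hB0
      have g4 := mul_le_mul_of_nonneg_right e6 hB0
      nlinarith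
  clamp := ⟨fun t => max 0 t, by fun_prop, fun t => mem_Ici.2 (le_max_left _ _), fun t ht => max_eq_right (mem_Ici.1 ht)⟩
  nbr t ht := by left; intro s hs; exact le_trans (show (0:ℝ) ≤ t from ht) hs.1
  meas := measurableSet_Ici
  bdI := by intro t ht; rw [mem_singleton_iff] at ht; subst ht; exact mem_Ici.2 le_rfl
  ftc g g' h1 h2 hg h3 := by
    have h2' := h2.mono_set Ioi_subset_Ici_self
    have hg' := hg.mono_set Ioi_subset_Ici_self
    have ht := tendsto_zero_of_hasDerivAt_of_integrableOn_Ioi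
      (fun t (ht : t ∈ Ioi (0:ℝ)) => h1 t (Ioi_subset_Ici_self ht)) h2' hg'
    have := integral_Ioi_of_hasDerivAt_of_tendsto
      (h1 0 (by simp)).continuousAt.continuousWithinAt
      (fun t (ht : t ∈ Ioi (0:ℝ)) => h1 t (Ioi_subset_Ici_self ht)) h2' ht
    rw [integral_Ici_eq_integral_Ioi, this, h3 0 (by simp), sub_zero]
end DmPart1

section DmPart2
open Set Topology

/-- weights and approximate solution on a domain -/
structure Wt (I : Set ℝ) (Q Q1 Q2 ψ ψ1 ψ2 : ℝ → ℝ) (c0 K ε : ℝ) : Prop where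
  dQ : ∀ t, HasDerivAt Q (Q1 t) t
  dQ1 : ∀ t, HasDerivAt Q1 (Q2 t) t
  cQ2 : Continuous Q2
  dψ : ∀ t, HasDerivAt ψ (ψ1 t) t
  dψ1 : ∀ t, HasDerivAt ψ1 (ψ2 t) t
  pos : ∀ t ∈ I, 0 < ψ t
  le : ∀ t ∈ I, ψ t ≤ K
  har : ∀ s ∈ I, ∀ t ∈ I, |s - t| ≤ 1 → ψ s ≤ K * ψ t
  sup : ∀ t ∈ I, (1 - Real.cos (Q t) + c0) * ψ t ≤ ψ t - ψ2 t
  err : ∀ t ∈ I, |Q2 t - Real.sin (Q t)| ≤ ε * ψ t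
  sinQ : ∀ t ∈ I, |Real.sin (Q t)| ≤ K * ψ t
  Q1le : ∀ t ∈ I, |Q1 t| ≤ K * ψ t
  cosQ : ∀ t ∈ I, 1 - Real.cos (Q t) ≤ K * ψ t
  int : IntegrableOn ψ I
  intle : ∫ t in I, ψ t ≤ K
  c0pos : 0 < c0
  c0le : c0 ≤ 1
  K1 : 1 ≤ K
  ε0 : 0 ≤ ε

section
variable {I bd : Set ℝ} {Q Q1 Q2 ψ ψ1 ψ2 : ℝ → ℝ} {c0 K ε : ℝ}

lemma Wt.supc (W : Wt I Q Q1 Q2 ψ ψ1 ψ2 c0 K ε) {t : ℝ} (ht : t ∈ I) :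
    c0 * ψ t ≤ ψ t - ψ2 t := by
  have h1 := W.sup t ht
  have h2 := mul_nonneg (sub_nonneg.2 (Real.cos_le_one (Q t))) (W.pos t ht).le
  linarith

lemma dm_est (D : Dom I bd) (W : Wt I Q Q1 Q2 ψ ψ1 ψ2 c0 K ε) (e e1 e2 : ℝ → ℝ) (R : ℝ)
    (hR : 0 ≤ R)
    (h1 : ∀ t ∈ I, HasDerivAt e (e1 t) t) (h2 : ∀ t ∈ I, HasDerivAt e1 (e2 t) t)
    (h0 : ∀ t ∈ bd, e t = 0) (hB : ∃ B, ∀ t ∈ I, |e t| ≤ B)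
    (h3 : ∀ t ∈ I, |e t - e2 t| ≤ R * (ψ t - ψ2 t)) : ∀ t ∈ I, |e t| ≤ R * ψ t := by
  obtain ⟨B, hB⟩ := hB
  intro t ht
  have hpos : ∀ t ∈ I, 0 ≤ R * ψ t := fun t ht => mul_nonneg hR (W.pos t ht).le
  have a1 := D.mp (fun t => e t - R * ψ t) (fun t => e1 t - R * ψ1 t) (fun t => e2 t - R * ψ2 t)
    (fun t ht => (h1 t ht).sub ((W.dψ t).const_mul R))
    (fun t ht => (h2 t ht).sub ((W.dψ1 t).const_mul R))
    (fun t ht => by have := hpos t (D.bdI ht); have := h0 t ht; linarith)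
    ⟨B, fun t ht => by have := hpos t ht; have := (abs_le.1 (hB t ht)).2; linarith⟩
    (fun t ht => by have := (abs_le.1 (h3 t ht)).2; linarith) t ht
  have a2 := D.mp (fun t => -e t - R * ψ t) (fun t => -e1 t - R * ψ1 t) (fun t => -e2 t - R * ψ2 t)
    (fun t ht => (h1 t ht).neg.sub ((W.dψ t).const_mul R))
    (fun t ht => (h2 t ht).neg.sub ((W.dψ1 t).const_mul R))
    (fun t ht => by have := hpos t (D.bdI ht); have := h0 t ht; linarith)
    ⟨B, fun t ht => by have := hpos t ht; have := (abs_le.1 (hB t ht)).1; linarith⟩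
    (fun t ht => by have := (abs_le.1 (h3 t ht)).1; linarith) t ht
  exact abs_le.2 ⟨by linarith, by linarith⟩

lemma dm_pest (D : Dom I bd) (W : Wt I Q Q1 Q2 ψ ψ1 ψ2 c0 K ε) (e e1 e2 : ℝ → ℝ) (a b : ℝ)
    (ha : 0 ≤ a) (hb : 0 ≤ b)
    (h1 : ∀ t ∈ I, HasDerivAt e (e1 t) t) (h2 : ∀ t ∈ I, HasDerivAt e1 (e2 t) t)
    (hea : ∀ t ∈ I, |e t| ≤ a * ψ t) (heb : ∀ t ∈ I, |e2 t| ≤ b * ψ t) :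
    ∀ t ∈ I, |e1 t| ≤ K * (2 * a + b) * ψ t := by
  intro t ht
  -- general step on an interval
  have key : ∀ x y, x < y → y - x = 1 → Icc x y ⊆ I → t ∈ Icc x y →
      |e1 t| ≤ K * (2 * a + b) * ψ t := by
    intro x y hxy hy hsub htxy
    obtain ⟨c, hc, hc2⟩ := exists_hasDerivAt_eq_slope e e1 hxy
      (fun s hs => (h1 s (hsub hs)).continuousAt.continuousWithinAt)
      (fun s hs => h1 s (hsub ⟨hs.1.le, hs.2.le⟩))
    have hpsi : ∀ s ∈ Icc x y, ψ s ≤ K * ψ t := fun s hs => W.har s (hsub hs) t ht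
      (abs_le.2 ⟨by linarith [hs.1, htxy.2], by linarith [hs.2, htxy.1]⟩)
    have g1 : |e1 c| ≤ 2 * a * (K * ψ t) := by
      rw [hc2, hy, div_one]
      have i1 := hea y (hsub ⟨hxy.le, le_rfl⟩)
      have i2 := hea x (hsub ⟨le_rfl, hxy.le⟩)
      have i3 := mul_le_mul_of_nonneg_left (hpsi y ⟨hxy.le, le_rfl⟩) ha
      have i4 := mul_le_mul_of_nonneg_left (hpsi x ⟨le_rfl, hxy.le⟩) ha
      have i5 := abs_sub (e y) (e x)
      linarith
    have g2 : |e1 t - e1 c| ≤ b * (K * ψ t) := by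
      have hb' : ∀ s ∈ Icc x y, ‖e2 s‖ ≤ b * (K * ψ t) := fun s hs =>
        (heb s (hsub hs)).trans (mul_le_mul_of_nonneg_left (hpsi s hs) hb)
      have := (convex_Icc x y).norm_image_sub_le_of_norm_hasDerivWithin_le
        (fun s hs => (h2 s (hsub hs)).hasDerivWithinAt) hb' (⟨hc.1.le, hc.2.le⟩ : c ∈ Icc x y) htxy
      rw [Real.norm_eq_abs, Real.norm_eq_abs] at this
      refine this.trans ?_
      have h5 : |t - c| ≤ 1 := abs_le.2 ⟨by linarith [hc.2, htxy.1], by linarith [hc.1, htxy.2]⟩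
      have h6 : 0 ≤ b * (K * ψ t) := mul_nonneg hb
        (mul_nonneg (by linarith [W.K1]) (W.pos t ht).le)
      nlinarith
    have : |e1 t| ≤ |e1 c| + |e1 t - e1 c| := by
      have := abs_add_le (e1 c) (e1 t - e1 c)
      simpa using this
    nlinarith
  rcases D.nbr t ht with h | h
  · exact key t (t+1) (by linarith) (by ring) h ⟨le_rfl, by linarith⟩
  · exact key (t-1) t (by linarith) (by ring) h ⟨by linarith, le_rfl⟩

/-- pointwise nonlinear estimate -/
lemma dm_pw (q x y c c0 r δ : ℝ) (hx : |x| ≤ r) (hy : |y| ≤ r) (hc : |c - 1| ≤ δ)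
    (hs : r + δ ≤ c0 / 2) :
    |(x - y) - c * (Real.sin (q + x) - Real.sin (q + y))| ≤ (1 - Real.cos q + c0/2) * |x - y| := by
  -- function g s = s - c sin(q+s), derivative 1 - c cos(q+s)
  have hd : ∀ s ∈ Icc (-r) r, HasDerivWithinAt (fun s => s - c * Real.sin (q + s))
      (1 - c * Real.cos (q + s)) (Icc (-r) r) s := fun s _ => by
    have h := ((hasDerivAt_id s).const_add q).sin
    exact ((hasDerivAt_id s).sub (h.const_mul c)).congr_deriv (by simp) |>.hasDerivWithinAt
  have hb : ∀ s ∈ Icc (-r) r, ‖1 - c * Real.cos (q + s)‖ ≤ 1 - Real.cos q + c0/2 := by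
    intro s hs'
    have h1 : |Real.cos q - Real.cos (q + s)| ≤ r := by
      have h2 : |Real.cos q - Real.cos (q+s)| ≤ |q - (q+s)| := Real.abs_cos_sub_cos_le q (q+s)
      have h3 : |q - (q+s)| ≤ r := by
        rw [show q - (q+s) = -s by ring, abs_neg]; exact abs_le.2 hs'
      exact h2.trans h3
    have h4 : |(1 - c) * Real.cos (q+s)| ≤ δ := by
      rw [abs_mul, abs_sub_comm]
      have := Real.abs_cos_le_one (q+s)
      have := abs_nonneg (c-1)
      nlinarith
    have h5 : 0 ≤ 1 - Real.cos q := sub_nonneg.2 (Real.cos_le_one q)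
    rw [Real.norm_eq_abs, abs_le]
    obtain ⟨a1, a2⟩ := abs_le.1 h1
    obtain ⟨b1, b2⟩ := abs_le.1 h4
    constructor <;> nlinarith
  have := (convex_Icc (-r) r).norm_image_sub_le_of_norm_hasDerivWithin_le hd hb
    (abs_le.1 hy) (abs_le.1 hx)
  rw [Real.norm_eq_abs, Real.norm_eq_abs] at this
  convert this using 2
  ring

/-- contraction factor -/
lemma dm_theta (W : Wt I Q Q1 Q2 ψ ψ1 ψ2 c0 K ε) {t : ℝ} (ht : t ∈ I) :
    (1 - Real.cos (Q t) + c0/2) * ψ t ≤ (1 - c0/6) * (ψ t - ψ2 t) := by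
  have h1 := W.sup t ht
  have h2 := W.c0pos
  have h3 := W.c0le
  have h4 := W.pos t ht
  have h5 := Real.cos_le_one (Q t)
  have h6 := Real.neg_one_le_cos (Q t)
  have h7 : (1 - c0/6) * ((1 - Real.cos (Q t) + c0) * ψ t) ≤ (1 - c0/6) * (ψ t - ψ2 t) :=
    mul_le_mul_of_nonneg_left h1 (by linarith)
  refine le_trans ?_ h7
  rw [← mul_assoc]
  refine mul_le_mul_of_nonneg_right ?_ h4.le
  nlinarith
end
end DmPart2

section DmPart3
open Set Topology

structure Sol (I bd : Set ℝ) (Q ψ c q p : ℝ → ℝ) (r : ℝ) : Prop where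
  dq : ∀ t ∈ I, HasDerivAt q (p t) t
  dp : ∀ t ∈ I, HasDerivAt p (c t * Real.sin (q t)) t
  bc : ∀ t ∈ bd, q t = Q t
  near : ∀ t ∈ I, |q t - Q t| ≤ r * ψ t

section
variable {I bd : Set ℝ} {Q Q1 Q2 ψ ψ1 ψ2 : ℝ → ℝ} {c0 K ε : ℝ}

lemma dm_clip (r x y : ℝ) (hr : 0 ≤ r) : |max (-r) (min x r) - max (-r) (min y r)| ≤ |x - y| ∧
    |max (-r) (min x r)| ≤ r ∧ (|x| ≤ r → max (-r) (min x r) = x) ∧ |max (-r) (min x r)| ≤ |x| := by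
  refine ⟨?_, ?_, ?_, ?_⟩
  · rw [max_comm (-r), max_comm (-r)]
    refine (abs_max_sub_max_le_abs _ _ _).trans ?_
    have := abs_min_sub_min_le_max x r y r
    simpa using this
  · exact abs_le.2 ⟨le_max_left _ _, max_le (by linarith) (min_le_right _ _)⟩
  · intro h; obtain ⟨h1, h2⟩ := abs_le.1 h; rw [min_eq_left h2, max_eq_right h1]
  · rcases le_total x r with h | h <;> rcases le_total (-r) x with h' | h'
    · rw [min_eq_left h, max_eq_right h']
    · rw [min_eq_left h, max_eq_left h', abs_neg, abs_of_nonneg hr, abs_of_nonpos (by linarith)]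
      linarith
    · rw [min_eq_right h, max_eq_right (by linarith), abs_of_nonneg hr, abs_of_nonneg (by linarith)]
      exact h
    · have : r = 0 := by linarith
      subst this; simp

lemma dm_exists (D : Dom I bd) (W : Wt I Q Q1 Q2 ψ ψ1 ψ2 c0 K ε) (c : ℝ → ℝ) (hcc : Continuous c)
    (δ : ℝ) (hδ : 0 ≤ δ) (hc : ∀ t ∈ I, |c t - 1| ≤ δ) (hδ1 : δ ≤ c0/4)
    (hsmall : 6 * (ε + δ * K) / c0^2 ≤ c0 / (4 * K)) :
    ∃ q p, Sol I bd Q ψ c q p (6 * (ε + δ * K) / c0^2) := by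
  have hK : 0 < K := by linarith [W.K1]
  have hc0 := W.c0pos
  have hε := W.ε0
  set r := c0 / (4*K) with hr
  have hr0 : 0 < r := by positivity
  have hrK : r * K = c0/4 := by rw [hr]; field_simp
  obtain ⟨cl, hcl, hclI, hcle⟩ := D.clamp
  let X := BoundedContinuousFunction ℝ ℝ
  have hQc : Continuous Q := continuous_iff_continuousAt.2 (fun t => (W.dQ t).continuousAt)
  have hψc : Continuous ψ := continuous_iff_continuousAt.2 (fun t => (W.dψ t).continuousAt)
  have hQ2c := W.cQ2
  let w : X → ℝ → ℝ := fun z t => ψ (cl t) * max (-r) (min (z t) r)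
  have hwc : ∀ z, Continuous (w z) := fun z => by
    have := z.continuous
    show Continuous (fun t => ψ (cl t) * max (-r) (min (z t) r))
    fun_prop
  have hψp : ∀ t, 0 < ψ (cl t) := fun t => W.pos _ (hclI t)
  have hwr : ∀ z t, |w z t| ≤ r * K := fun z t => by
    show |ψ (cl t) * max (-r) (min (z t) r)| ≤ _
    rw [abs_mul, abs_of_pos (hψp t), mul_comm]
    exact mul_le_mul (dm_clip r (z t) 0 hr0.le).2.1 (W.le _ (hclI t)) (hψp t).le hr0.le
  let h : X → ℝ → ℝ := fun z t => w z t + Q2 (cl t) - c (cl t) * Real.sin (Q (cl t) + w z t)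
  have hhc : ∀ z, Continuous (h z) := fun z => by
    have := hwc z
    show Continuous (fun t => w z t + Q2 (cl t) - c (cl t) * Real.sin (Q (cl t) + w z t))
    fun_prop
  -- difference bound
  have hdiff : ∀ z z' t, |h z t - h z' t| ≤
      (1 - c0/6) * (ψ (cl t) - ψ2 (cl t)) * |max (-r) (min (z t) r) - max (-r) (min (z' t) r)| := by
    intro z z' t
    have a1 := dm_pw (Q (cl t)) (w z t) (w z' t) (c (cl t)) c0 (r*K) δ (hwr z t) (hwr z' t)
      (hc _ (hclI t)) (by rw [hrK]; linarith)
    have a2 : h z t - h z' t = (w z t - w z' t) - c (cl t) * (Real.sin (Q (cl t) + w z t) -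
        Real.sin (Q (cl t) + w z' t)) := by simp only [h]; ring
    rw [a2]
    refine a1.trans ?_
    have a3 : |w z t - w z' t| = ψ (cl t) * |max (-r) (min (z t) r) - max (-r) (min (z' t) r)| := by
      simp only [w]; rw [← mul_sub, abs_mul, abs_of_pos (hψp t)]
    rw [a3, ← mul_assoc]
    exact mul_le_mul_of_nonneg_right (dm_theta W (hclI t)) (abs_nonneg _)
  have hzero : ∀ t, |h 0 t| ≤ (ε + δ * K) / c0 * (ψ (cl t) - ψ2 (cl t)) := by
    intro t
    have z0 : (0:X) t = 0 := rfl
    have w0 : w 0 t = 0 := by simp only [w, z0]; simp [hr0.le]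
    have e1 : h 0 t = (Q2 (cl t) - Real.sin (Q (cl t))) - (c (cl t) - 1) * Real.sin (Q (cl t)) := by
      simp only [h, w0]; ring_nf
    have b1 := W.err _ (hclI t)
    have b2 := W.sinQ _ (hclI t)
    have b3 := hc _ (hclI t)
    have b4 : |(c (cl t) - 1) * Real.sin (Q (cl t))| ≤ δ * (K * ψ (cl t)) := by
      rw [abs_mul]; exact mul_le_mul b3 b2 (abs_nonneg _) hδ
    have b5 := W.supc (hclI t)
    rw [e1]
    refine (abs_sub _ _).trans ?_
    have b6 : (ε + δ*K) / c0 * (c0 * ψ (cl t)) ≤ (ε + δ * K) / c0 * (ψ (cl t) - ψ2 (cl t)) :=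
      mul_le_mul_of_nonneg_left b5 (by positivity)
    have b7 : (ε + δ*K) / c0 * (c0 * ψ (cl t)) = (ε + δ * K) * ψ (cl t) := by field_simp
    linarith
  have hθ : 0 ≤ 1 - c0/6 := by linarith [W.c0le]
  have hsup0 : ∀ t, 0 ≤ ψ (cl t) - ψ2 (cl t) := fun t =>
    (mul_nonneg hc0.le (hψp t).le).trans (W.supc (hclI t))
  have hall : ∀ z t, |h z t| ≤ ((ε + δ * K) / c0 + (1 - c0/6) * min r (‖z‖)) * (ψ (cl t) - ψ2 (cl t)) := by
    intro z t
    have a1 := hdiff z 0 t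
    have a2 := hzero t
    have a3 : max (-r) (min ((0:X) t) r) = 0 := by
      have z0 : (0:X) t = 0 := rfl
      rw [z0]; simp [hr0.le]
    rw [a3, sub_zero] at a1
    have a4 := abs_add_le (h z t - h 0 t) (h 0 t)
    rw [sub_add_cancel] at a4
    have a5 : |max (-r) (min (z t) r)| ≤ min r ‖z‖ := le_min (dm_clip r (z t) 0 hr0.le).2.1
      ((dm_clip r (z t) 0 hr0.le).2.2.2.trans (z.norm_coe_le_norm t))
    have a6 := mul_le_mul_of_nonneg_left a5 (mul_nonneg hθ (hsup0 t))
    linarith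
  have hhb : ∀ z, ∃ B, ∀ t, |h z t| ≤ B := by
    intro z
    refine ⟨r * K + (K * K + ε * K) + (1 + δ), fun t => ?_⟩
    have a1 := hwr z t
    have a2 : |Q2 (cl t)| ≤ K * K + ε * K := by
      have b1 := W.err _ (hclI t)
      have b2 := W.sinQ _ (hclI t)
      have b3 := abs_add_le (Q2 (cl t) - Real.sin (Q (cl t))) (Real.sin (Q (cl t)))
      rw [sub_add_cancel] at b3
      have b4 := mul_le_mul_of_nonneg_left (W.le _ (hclI t)) hε
      have b5 := mul_le_mul_of_nonneg_left (W.le _ (hclI t)) hK.le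
      linarith
    have a3 : |c (cl t) * Real.sin (Q (cl t) + w z t)| ≤ 1 + δ := by
      rw [abs_mul]
      have b1 := hc _ (hclI t)
      have b2 : |c (cl t)| ≤ 1 + δ := by
        have := abs_add_le (c (cl t) - 1) 1
        rw [sub_add_cancel, abs_one] at this; linarith
      have b3 := Real.abs_sin_le_one (Q (cl t) + w z t)
      calc _ ≤ (1 + δ) * 1 := mul_le_mul b2 b3 (abs_nonneg _) (by linarith)
        _ = _ := by ring
    have a4 := abs_sub (w z t + Q2 (cl t)) (c (cl t) * Real.sin (Q (cl t) + w z t))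
    have a5 := abs_add_le (w z t) (Q2 (cl t))
    show |w z t + Q2 (cl t) - c (cl t) * Real.sin (Q (cl t) + w z t)| ≤ _
    linarith
  choose u p hu hp hu0 hub using fun z => D.solve (h z) (hhc z) (hhb z)
  have hubd : ∀ z, ∀ t ∈ I, |u z t| ≤ ((ε + δ * K) / c0 + (1 - c0/6) * min r (‖z‖)) * ψ t := by
    intro z
    refine dm_est D W (u z) (p z) (fun t => u z t - h z t) _ (by positivity) (fun t _ => hu z t)
      (fun t _ => hp z t) (hu0 z) (hub z) (fun t ht => ?_)
    have := hall z t
    rw [hcle t ht] at this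
    rw [show u z t - (u z t - h z t) = h z t by ring]
    exact this
  have hudiff : ∀ z z' : X, ∀ t ∈ I, |u z t - u z' t| ≤ ((1 - c0/6) * dist z z') * ψ t := by
    intro z z'
    refine dm_est D W (fun t => u z t - u z' t) (fun t => p z t - p z' t)
      (fun t => (u z t - h z t) - (u z' t - h z' t)) _ (by positivity)
      (fun t _ => (hu z t).sub (hu z' t))
      (fun t _ => (hp z t).sub (hp z' t)) (fun t ht => by simp [hu0 z t ht, hu0 z' t ht]) ?_
      (fun t ht => ?_)
    · obtain ⟨B, hB⟩ := hub z
      obtain ⟨B', hB'⟩ := hub z'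
      exact ⟨B + B', fun t ht => (abs_sub _ _).trans (add_le_add (hB t ht) (hB' t ht))⟩
    · have := hdiff z z' t
      have h1 := hsup0 t
      rw [hcle t ht] at this h1
      rw [show u z t - u z' t - ((u z t - h z t) - (u z' t - h z' t)) = h z t - h z' t by ring]
      refine this.trans ?_
      have h2 : |max (-r) (min (z t) r) - max (-r) (min (z' t) r)| ≤ dist z z' :=
        (dm_clip r _ _ hr0.le).1.trans (by
          have := BoundedContinuousFunction.dist_coe_le_dist (f := z) (g := z') t
          rwa [Real.dist_eq] at this)
      have := mul_le_mul_of_nonneg_left h2 (mul_nonneg hθ h1)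
      linarith
  have huc : ∀ z, Continuous (u z) := fun z =>
    continuous_iff_continuousAt.2 (fun t => (hu z t).continuousAt)
  let T : X → X := fun z => BoundedContinuousFunction.ofNormedAddCommGroup
    (fun t => u z (cl t) / ψ (cl t))
    (((huc z).comp hcl).div (hψc.comp hcl) (fun t => (hψp t).ne'))
    ((ε + δ * K) / c0 + (1 - c0/6) * min r (‖z‖)) (fun t => by
      rw [Real.norm_eq_abs, abs_div, abs_of_pos (hψp t), div_le_iff₀ (hψp t)]
      exact hubd z _ (hclI t))
  have hTap : ∀ z t, T z t = u z (cl t) / ψ (cl t) := fun z t => rfl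
  have hT : ContractingWith (Real.toNNReal (1 - c0/6)) T := by
    refine ⟨?_, LipschitzWith.of_dist_le_mul (fun z z' => ?_)⟩
    · rw [Real.toNNReal_lt_one]; linarith
    · rw [Real.coe_toNNReal _ hθ, BoundedContinuousFunction.dist_le (by positivity)]
      intro t
      rw [hTap, hTap, Real.dist_eq, ← sub_div, abs_div, abs_of_pos (hψp t), div_le_iff₀ (hψp t)]
      exact hudiff z z' _ (hclI t)
  set z := ContractingWith.fixedPoint T hT
  have hz : T z = z := hT.fixedPoint_isFixedPt
  have hzu : ∀ t ∈ I, u z t = ψ t * z t := fun t ht => by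
    have h1 := hTap z t
    rw [hz, hcle t ht] at h1
    rw [h1]; have := (W.pos t ht).ne'; field_simp
  have hzn : ‖z‖ ≤ 6 * (ε + δ * K) / c0^2 := by
    have h1 : ‖z‖ ≤ (ε + δ * K) / c0 + (1 - c0/6) * min r (‖z‖) := by
      conv_lhs => rw [← hz]
      refine BoundedContinuousFunction.norm_ofNormedAddCommGroup_le _ (by positivity) _
    have h2 := mul_le_mul_of_nonneg_left (min_le_right r ‖z‖) hθ
    have h3 : c0/6 * ‖z‖ ≤ (ε + δ * K) / c0 := by linarith
    rw [le_div_iff₀ hc0] at h3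
    rw [le_div_iff₀ (by positivity)]
    linarith
  have hwz : ∀ t ∈ I, w z t = u z t := fun t ht => by
    rw [hzu t ht]
    simp only [w]
    rw [hcle t ht, (dm_clip r (z t) 0 hr0.le).2.2.1
      ((z.norm_coe_le_norm t).trans (hzn.trans hsmall))]
  refine ⟨fun t => Q t + u z t, fun t => Q1 t + p z t, ⟨fun t _ => (W.dQ t).add (hu z t), ?_, ?_, ?_⟩⟩
  · intro t ht
    refine ((W.dQ1 t).add (hp z t)).congr_deriv ?_
    simp only [h]
    rw [hwz t ht, hcle t ht]; ring
  · intro t ht; simp [hu0 z t ht]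
  · intro t ht
    rw [add_sub_cancel_left, hzu t ht, abs_mul, abs_of_pos (W.pos t ht), mul_comm]
    exact mul_le_mul_of_nonneg_right ((z.norm_coe_le_norm t).trans hzn) (W.pos t ht).le
end
end DmPart3

section DmPart4
open Set Topology

section
variable {I bd : Set ℝ} {Q Q1 Q2 ψ ψ1 ψ2 : ℝ → ℝ} {c0 K ε : ℝ}

lemma Sol.sinle (W : Wt I Q Q1 Q2 ψ ψ1 ψ2 c0 K ε) {c q p : ℝ → ℝ} {r : ℝ}
    (S : Sol I bd Q ψ c q p r) {t : ℝ} (ht : t ∈ I) : |Real.sin (q t)| ≤ (K + r) * ψ t := by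
  have h1 := W.sinQ t ht
  have h2 := S.near t ht
  have h3 := Real.abs_sin_sub_sin_le (q t) (Q t)
  have h4 := abs_add_le (Real.sin (q t) - Real.sin (Q t)) (Real.sin (Q t))
  rw [sub_add_cancel] at h4
  linarith

lemma Sol.cosle (W : Wt I Q Q1 Q2 ψ ψ1 ψ2 c0 K ε) {c q p : ℝ → ℝ} {r : ℝ}
    (S : Sol I bd Q ψ c q p r) {t : ℝ} (ht : t ∈ I) : |1 - Real.cos (q t)| ≤ (K + r) * ψ t := by
  have h1 := W.cosQ t ht
  have h2 := S.near t ht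
  have h3 := Real.abs_cos_sub_cos_le (q t) (Q t)
  rw [abs_of_nonneg (sub_nonneg.2 (Real.cos_le_one _))]
  have := (abs_le.1 h3).1
  linarith

lemma Sol.pnear (D : Dom I bd) (W : Wt I Q Q1 Q2 ψ ψ1 ψ2 c0 K ε) {c q p : ℝ → ℝ} {r δ : ℝ}
    (S : Sol I bd Q ψ c q p r) (hr : 0 ≤ r) (hδ : 0 ≤ δ) (hc : ∀ t ∈ I, |c t - 1| ≤ δ) :
    ∀ t ∈ I, |p t - Q1 t| ≤ K * (2 * r + (δ * (K + r) + r + ε)) * ψ t := by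
  have hK := W.K1
  have hε := W.ε0
  refine dm_pest D W (fun t => q t - Q t) (fun t => p t - Q1 t)
    (fun t => c t * Real.sin (q t) - Q2 t) r _ hr (by positivity)
    (fun t ht => (S.dq t ht).sub (W.dQ t)) (fun t ht => (S.dp t ht).sub (W.dQ1 t)) S.near ?_
  intro t ht
  have h1 := S.sinle W ht
  have h2 := W.err t ht
  have h3 := (Real.abs_sin_sub_sin_le (q t) (Q t)).trans (S.near t ht)
  have h4 : |(c t - 1) * Real.sin (q t)| ≤ δ * ((K + r) * ψ t) := by
    rw [abs_mul]; exact mul_le_mul (hc t ht) h1 (abs_nonneg _) hδ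
  have e : c t * Real.sin (q t) - Q2 t = (c t - 1) * Real.sin (q t) +
    ((Real.sin (q t) - Real.sin (Q t)) - (Q2 t - Real.sin (Q t))) := by ring
  rw [e]
  have h5 := abs_add_le ((c t - 1) * Real.sin (q t))
    ((Real.sin (q t) - Real.sin (Q t)) - (Q2 t - Real.sin (Q t)))
  have h6 := abs_sub (Real.sin (q t) - Real.sin (Q t)) (Q2 t - Real.sin (Q t))
  linarith

lemma dm_dep (D : Dom I bd) (W : Wt I Q Q1 Q2 ψ ψ1 ψ2 c0 K ε) {c q p c' q' p' : ℝ → ℝ}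
    {r δ N : ℝ} (S : Sol I bd Q ψ c q p r) (S' : Sol I bd Q ψ c' q' p' r) (hr : 0 ≤ r)
    (hr1 : r ≤ c0/(4*K)) (hδ1 : δ ≤ c0/4) (hc : ∀ t ∈ I, |c t - 1| ≤ δ) (hN : 0 ≤ N)
    (hcc : ∀ t ∈ I, |c t - c' t| ≤ N) :
    (∀ t ∈ I, |q t - q' t| ≤ 50 * K^2/c0^2 * N * ψ t) ∧
    (∀ t ∈ I, |p t - p' t| ≤ 50 * K^2/c0^2 * N * ψ t) := by
  have hK := W.K1
  have hK0 : 0 < K := by linarith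
  have hc0 := W.c0pos
  have hc1 := W.c0le
  have hrK : r * K ≤ c0/4 := by
    have := mul_le_mul_of_nonneg_right hr1 hK0.le
    have e : c0/(4*K) * K = c0/4 := by field_simp
    linarith
  have hrr : r ≤ K := by nlinarith
  have hθ : 0 ≤ 1 - c0/6 := by linarith
  have hsin : ∀ t ∈ I, |Real.sin (q' t)| ≤ 2 * K * ψ t := fun t ht => by
    have h1 := S'.sinle W ht
    have := mul_le_mul_of_nonneg_right (show K + r ≤ 2*K by linarith) (W.pos t ht).le
    linarith
  -- improvement
  have step : ∀ M, 0 ≤ M → (∀ t ∈ I, |q t - q' t| ≤ M * ψ t) →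
      ∀ t ∈ I, |q t - q' t| ≤ ((1 - c0/6) * M + 2 * K * N / c0) * ψ t := by
    intro M hM h
    refine dm_est D W (fun t => q t - q' t) (fun t => p t - p' t)
      (fun t => c t * Real.sin (q t) - c' t * Real.sin (q' t)) _ (by positivity)
      (fun t ht => (S.dq t ht).sub (S'.dq t ht)) (fun t ht => (S.dp t ht).sub (S'.dp t ht))
      (fun t ht => by simp [S.bc t ht, S'.bc t ht])
      ⟨M * K, fun t ht => (h t ht).trans (mul_le_mul_of_nonneg_left (W.le t ht) hM)⟩ ?_
    intro t ht
    have hp := W.pos t ht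
    have nb : ∀ x, |x| ≤ r * ψ t → |x| ≤ r * K := fun x hx =>
      hx.trans (mul_le_mul_of_nonneg_left (W.le t ht) hr)
    have a1 := dm_pw (Q t) (q t - Q t) (q' t - Q t) (c t) c0 (r * K) δ (nb _ (S.near t ht))
      (nb _ (S'.near t ht)) (hc t ht) (by linarith)
    rw [show q t - Q t - (q' t - Q t) = q t - q' t by ring, add_sub_cancel, add_sub_cancel] at a1
    have a2 : (1 - Real.cos (Q t) + c0/2) * |q t - q' t| ≤ (1 - c0/6) * M * (ψ t - ψ2 t) := by
      have b1 := mul_le_mul_of_nonneg_left (h t ht)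
        (show 0 ≤ 1 - Real.cos (Q t) + c0/2 by linarith [Real.cos_le_one (Q t)])
      have b2 := mul_le_mul_of_nonneg_left (dm_theta W ht) hM
      linarith
    have a3 : |(c t - c' t) * Real.sin (q' t)| ≤ 2 * K * N / c0 * (ψ t - ψ2 t) := by
      rw [abs_mul]
      have b1 := mul_le_mul (hcc t ht) (hsin t ht) (abs_nonneg _) hN
      have b2 := mul_le_mul_of_nonneg_left (W.supc ht) (show 0 ≤ 2 * K * N / c0 by positivity)
      have b3 : 2 * K * N / c0 * (c0 * ψ t) = N * (2 * K * ψ t) := by field_simp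
      linarith
    have e : q t - q' t - (c t * Real.sin (q t) - c' t * Real.sin (q' t)) =
      (q t - q' t - c t * (Real.sin (q t) - Real.sin (q' t))) - (c t - c' t) * Real.sin (q' t) := by
      ring
    rw [e]
    refine (abs_sub _ _).trans ?_
    linarith
  have hq : ∀ t ∈ I, |q t - q' t| ≤ 12 * K * N / c0^2 * ψ t := by
    intro t0 ht0
    have hb : ∀ t ∈ I, |q t - q' t| ≤ 2 * r * ψ t := fun t ht => by
      have h1 := S.near t ht
      have h2 := S'.near t ht
      have h3 := abs_sub_le (q t) (Q t) (q' t)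
      rw [abs_sub_comm (Q t)] at h3
      linarith
    set s : Set ℝ := (fun t => |q t - q' t| / ψ t) '' I
    have hbdd : BddAbove s := ⟨2 * r, by
      rintro _ ⟨t, ht, rfl⟩
      show |q t - q' t| / ψ t ≤ 2 * r
      rw [div_le_iff₀ (W.pos t ht)]; exact hb t ht⟩
    have hne : s.Nonempty := ⟨_, ⟨t0, ht0, rfl⟩⟩
    have hM : ∀ t ∈ I, |q t - q' t| ≤ sSup s * ψ t := fun t ht => by
      rw [← div_le_iff₀ (W.pos t ht)]
      exact le_csSup hbdd ⟨t, ht, rfl⟩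
    have hM0 : 0 ≤ sSup s := le_trans
      (div_nonneg (abs_nonneg _) (W.pos t0 ht0).le) (le_csSup hbdd ⟨t0, ht0, rfl⟩)
    have h1 : sSup s ≤ (1 - c0/6) * sSup s + 2 * K * N / c0 := by
      refine csSup_le hne ?_
      rintro _ ⟨t, ht, rfl⟩
      show |q t - q' t| / ψ t ≤ _
      rw [div_le_iff₀ (W.pos t ht)]
      exact step _ hM0 hM t ht
    have h2 : sSup s ≤ 12 * K * N / c0^2 := by
      rw [le_div_iff₀ (by positivity)]
      have h3 : c0/6 * sSup s ≤ 2 * K * N / c0 := by linarith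
      rw [le_div_iff₀ hc0] at h3
      linarith
    exact (hM t0 ht0).trans (mul_le_mul_of_nonneg_right h2 (W.pos t0 ht0).le)
  have hc2 : ∀ t ∈ I, |c t| ≤ 2 := fun t ht => by
    have := abs_add_le (c t - 1) 1
    rw [sub_add_cancel, abs_one] at this; linarith [hc t ht]
  have hKN : 0 ≤ K * N / c0^2 := by positivity
  have hKKN : K * N / c0^2 ≤ K^2 * N / c0^2 := by
    apply div_le_div_of_nonneg_right _ (by positivity)
    nlinarith [mul_nonneg hK0.le hN]
  have hp : ∀ t ∈ I, |p t - p' t| ≤ K * (2 * (12 * K * N / c0^2) + (2 * (12 * K * N / c0^2) + 2 * K * N)) * ψ t := by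
    refine dm_pest D W (fun t => q t - q' t) (fun t => p t - p' t)
      (fun t => c t * Real.sin (q t) - c' t * Real.sin (q' t)) _ _ (by positivity) (by positivity)
      (fun t ht => (S.dq t ht).sub (S'.dq t ht)) (fun t ht => (S.dp t ht).sub (S'.dp t ht)) hq ?_
    intro t ht
    have e : c t * Real.sin (q t) - c' t * Real.sin (q' t) =
      c t * (Real.sin (q t) - Real.sin (q' t)) + (c t - c' t) * Real.sin (q' t) := by ring
    rw [e]
    refine (abs_add_le _ _).trans ?_
    rw [abs_mul, abs_mul]
    have b1 := mul_le_mul (hcc t ht) (hsin t ht) (abs_nonneg _) hN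
    have b2 := mul_le_mul (hc2 t ht) ((Real.abs_sin_sub_sin_le (q t) (q' t)).trans (hq t ht))
      (abs_nonneg _) (by norm_num)
    linarith
  constructor
  · intro t ht
    refine (hq t ht).trans (mul_le_mul_of_nonneg_right ?_ (W.pos t ht).le)
    have e1 : 12 * K * N / c0^2 = 12 * (K * N / c0^2) := by ring
    have e2 : 50 * K^2/c0^2 * N = 50 * (K^2 * N / c0^2) := by ring
    rw [e1, e2]; linarith
  · intro t ht
    refine (hp t ht).trans (mul_le_mul_of_nonneg_right ?_ (W.pos t ht).le)
    have e1 : K * (2 * (12 * K * N / c0^2) + (2 * (12 * K * N / c0^2) + 2 * K * N)) =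
      48 * (K^2 * N / c0^2) + 2 * (K^2 * N) := by ring
    have e2 : 50 * K^2/c0^2 * N = 50 * (K^2 * N / c0^2) := by ring
    have e3 : K^2 * N ≤ K^2 * N / c0^2 := by
      rw [le_div_iff₀ (by positivity)]
      have : c0^2 ≤ 1 := by nlinarith
      have : 0 ≤ K^2 * N := by positivity
      nlinarith
    rw [e1, e2]; linarith

lemma dm_intg (D : Dom I bd) (W : Wt I Q Q1 Q2 ψ ψ1 ψ2 c0 K ε) (g : ℝ → ℝ) (B : ℝ)
    (hg : ContinuousOn g I) (hB : ∀ t ∈ I, |g t| ≤ B * ψ t) : IntegrableOn g I :=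
  (W.int.const_mul B).mono' (hg.aestronglyMeasurable D.meas)
    ((ae_restrict_iff' D.meas).2 (ae_of_all _ hB))

lemma dm_intb (D : Dom I bd) (W : Wt I Q Q1 Q2 ψ ψ1 ψ2 c0 K ε) (g : ℝ → ℝ) (B : ℝ) (hB0 : 0 ≤ B)
    (hB : ∀ t ∈ I, |g t| ≤ B * ψ t) : |∫ t in I, g t| ≤ B * K := by
  have := norm_integral_le_of_norm_le (f := g) (W.int.const_mul B)
    ((ae_restrict_iff' D.meas).2 (ae_of_all _ hB))
  rw [integral_const_mul] at this
  exact this.trans (mul_le_mul_of_nonneg_left W.intle hB0)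

lemma dm_cosT (x w : ℝ) : |Real.cos x - Real.cos (x + w) - Real.sin x * w| ≤ w^2 := by
  have hd : ∀ s ∈ Icc (-|w|) |w|, HasDerivWithinAt
      (fun s => Real.cos x - Real.cos (x + s) - Real.sin x * s)
      (Real.sin (x + s) - Real.sin x) (Icc (-|w|) |w|) s := fun s _ => by
    have h := ((hasDerivAt_id s).const_add x).cos
    exact ((h.const_sub (Real.cos x)).sub ((hasDerivAt_id s).const_mul (Real.sin x))).congr_deriv
      (by simp) |>.hasDerivWithinAt
  have hb : ∀ s ∈ Icc (-|w|) |w|, ‖Real.sin (x + s) - Real.sin x‖ ≤ |w| := fun s hs => by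
    refine (Real.abs_sin_sub_sin_le _ _).trans ?_
    rw [add_sub_cancel_left]; exact abs_le.2 hs
  have := (convex_Icc (-|w|) |w|).norm_image_sub_le_of_norm_hasDerivWithin_le hd hb
    (show (0:ℝ) ∈ Icc (-|w|) |w| from ⟨by simp, abs_nonneg _⟩)
    (show w ∈ Icc (-|w|) |w| from ⟨neg_abs_le w, le_abs_self w⟩)
  simp only [Real.norm_eq_abs] at this
  rw [← sq_abs w, pow_two]
  simpa using this

noncomputable def dmJ (I : Set ℝ) (c q p : ℝ → ℝ) : ℝ :=
  ∫ t in I, (p t ^ 2 / 2 + c t * (1 - Real.cos (q t)))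

lemma dm_taylor (D : Dom I bd) (W : Wt I Q Q1 Q2 ψ ψ1 ψ2 c0 K ε) {c q p q' p' : ℝ → ℝ}
    {r N P : ℝ} (S : Sol I bd Q ψ c q p r) (hr : 0 ≤ r) (hcont : Continuous c)
    (hc2 : ∀ t ∈ I, |c t| ≤ 2)
    (hP0 : 0 ≤ P) (hP : ∀ t ∈ I, |p t| ≤ P * ψ t) (hN : 0 ≤ N)
    (dq' : ∀ t ∈ I, HasDerivAt q' (p' t) t) (cp' : ContinuousOn p' I)
    (hbc : ∀ t ∈ bd, q' t = q t) (hq : ∀ t ∈ I, |q' t - q t| ≤ N * ψ t)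
    (hp : ∀ t ∈ I, |p' t - p t| ≤ N * ψ t) :
    |dmJ I c q' p' - dmJ I c q p| ≤ 3 * N^2 * K^2 := by
  have hK := W.K1
  have hK0 : 0 < K := by linarith
  have cq : ContinuousOn q I := fun t ht => (S.dq t ht).continuousAt.continuousWithinAt
  have cp : ContinuousOn p I := fun t ht => (S.dp t ht).continuousAt.continuousWithinAt
  have cq' : ContinuousOn q' I := fun t ht => (dq' t ht).continuousAt.continuousWithinAt
  have cc : ContinuousOn c I := hcont.continuousOn
  have sq : ∀ t ∈ I, ψ t * ψ t ≤ K * ψ t := fun t ht =>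
    mul_le_mul_of_nonneg_right (W.le t ht) (W.pos t ht).le
  -- the three pieces
  set F0 : ℝ → ℝ := fun t => p t ^ 2 / 2 + c t * (1 - Real.cos (q t)) with hF0
  set F1 : ℝ → ℝ := fun t => p t * (p' t - p t) + c t * Real.sin (q t) * (q' t - q t) with hF1
  set F2 : ℝ → ℝ := fun t => (p' t - p t)^2/2 +
    c t * (Real.cos (q t) - Real.cos (q' t) - Real.sin (q t) * (q' t - q t)) with hF2
  have mulb : ∀ x y X Y s : ℝ, 0 ≤ X → |x| ≤ X * s → |y| ≤ Y * s → |x * y| ≤ X * Y * (s * s) := by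
    intro x y X Y s hX hx hy
    rw [abs_mul]
    have := mul_le_mul hx hy (abs_nonneg _) ((abs_nonneg _).trans hx)
    linarith
  have i0 : IntegrableOn F0 I := by
    refine dm_intg D W F0 (P*P*K + 2 * (K + r)) (by fun_prop) (fun t ht => ?_)
    have h1 := mulb _ _ _ _ _ hP0 (hP t ht) (hP t ht)
    have h2 := S.cosle W ht
    have h3 := mul_le_mul_of_nonneg_left (sq t ht) (mul_nonneg hP0 hP0)
    have h4 : |c t * (1 - Real.cos (q t))| ≤ 2 * ((K + r) * ψ t) := by
      rw [abs_mul]; exact mul_le_mul (hc2 t ht) h2 (abs_nonneg _) (by norm_num)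
    have h5 : |p t ^ 2 / 2| ≤ |p t * p t| := by
      rw [← pow_two, abs_div]; simp; positivity
    refine (abs_add_le _ _).trans ?_
    nlinarith
  have b1 : ∀ t ∈ I, |F1 t| ≤ (P * N * K + 2 * N) * ψ t := by
    intro t ht
    have h1 := mulb _ _ _ _ _ hP0 (hP t ht) (hp t ht)
    have h3 := mul_le_mul_of_nonneg_left (sq t ht) (mul_nonneg hP0 hN)
    have h4 : |c t * Real.sin (q t) * (q' t - q t)| ≤ 2 * 1 * (N * ψ t) := by
      rw [abs_mul, abs_mul]
      exact mul_le_mul (mul_le_mul (hc2 t ht) (Real.abs_sin_le_one _) (abs_nonneg _) (by norm_num))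
        (hq t ht) (abs_nonneg _) (by norm_num)
    refine (abs_add_le _ _).trans ?_
    nlinarith
  have i1 : IntegrableOn F1 I := dm_intg D W F1 _ (by fun_prop) b1
  have b2 : ∀ t ∈ I, |F2 t| ≤ (3 * N^2 * K) * ψ t := by
    intro t ht
    have h1 := mulb _ _ _ _ _ hN (hp t ht) (hp t ht)
    have h2 := mulb _ _ _ _ _ hN (hq t ht) (hq t ht)
    have h3 := mul_le_mul_of_nonneg_left (sq t ht) (mul_nonneg hN hN)
    have h5 : |(p' t - p t) ^ 2 / 2| ≤ |(p' t - p t) * (p' t - p t)| := by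
      rw [← pow_two, abs_div]; simp; positivity
    have h6 := dm_cosT (q t) (q' t - q t)
    rw [add_sub_cancel, ← abs_of_nonneg (sq_nonneg (q' t - q t)), pow_two (q' t - q t)] at h6
    have h7 : |c t * (Real.cos (q t) - Real.cos (q' t) - Real.sin (q t) * (q' t - q t))| ≤
        2 * |(q' t - q t) * (q' t - q t)| := by
      rw [abs_mul]; exact mul_le_mul (hc2 t ht) h6 (abs_nonneg _) (by norm_num)
    refine (abs_add_le _ _).trans ?_
    nlinarith
  have i2 : IntegrableOn F2 I := dm_intg D W F2 _ (by fun_prop) b2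
  have z1 : ∫ t in I, F1 t = 0 := by
    refine D.ftc (fun t => p t * (q' t - q t)) F1 (fun t ht => ?_) i1 ?_ (fun t ht => ?_)
    · refine ((S.dp t ht).mul ((dq' t ht).sub (S.dq t ht))).congr_deriv ?_
      simp only [hF1]; simp; ring
    · refine dm_intg D W _ (P * N * K) (by fun_prop) (fun t ht => ?_)
      have h1 := mulb _ _ _ _ _ hP0 (hP t ht) (hq t ht)
      have h3 := mul_le_mul_of_nonneg_left (sq t ht) (mul_nonneg hP0 hN)
      nlinarith
    · simp [hbc t ht]
  have e : dmJ I c q' p' = ∫ t in I, (F0 t + F1 t + F2 t) := by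
    unfold dmJ
    congr 1; ext t; simp only [hF0, hF1, hF2]; ring
  have e2 : ∫ t in I, (F0 t + F1 t + F2 t) = (∫ t in I, F0 t) + ∫ t in I, F2 t := by
    have a1 := integral_add (i0.add i1) i2
    have a2 := integral_add i0 i1
    simp only [Pi.add_apply] at a1
    rw [a1, a2, z1, add_zero]
  rw [e, e2]
  have := dm_intb D W F2 _ (by positivity) b2
  rw [show dmJ I c q p = ∫ t in I, F0 t from rfl, add_sub_cancel_left]
  calc _ ≤ _ := this
    _ = _ := by ring

lemma Sol.pbd (D : Dom I bd) (W : Wt I Q Q1 Q2 ψ ψ1 ψ2 c0 K ε) {c q p : ℝ → ℝ} {r δ : ℝ}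
    (S : Sol I bd Q ψ c q p r) (hr : 0 ≤ r) (hδ : 0 ≤ δ) (hc : ∀ t ∈ I, |c t - 1| ≤ δ) :
    ∃ P, 0 ≤ P ∧ ∀ t ∈ I, |p t| ≤ P * ψ t := by
  have hK := W.K1
  have hε := W.ε0
  refine ⟨K * (2 * r + (δ * (K + r) + r + ε)) + K, by positivity, fun t ht => ?_⟩
  have h1 := S.pnear D W hr hδ hc t ht
  have h2 := W.Q1le t ht
  have h3 := abs_add_le (p t - Q1 t) (Q1 t)
  rw [sub_add_cancel] at h3
  linarith

lemma dm_c2 {c δ : ℝ} (hc : |c - 1| ≤ δ) (hδ : δ ≤ 1) : |c| ≤ 2 := by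
  have := abs_add_le (c - 1) 1
  rw [sub_add_cancel, abs_one] at this; linarith

lemma dm_sigma (D : Dom I bd) (W : Wt I Q Q1 Q2 ψ ψ1 ψ2 c0 K ε) {c q p c' q' p' : ℝ → ℝ}
    {r δ N : ℝ} (S : Sol I bd Q ψ c q p r) (S' : Sol I bd Q ψ c' q' p' r) (hr : 0 ≤ r)
    (hr1 : r ≤ c0/(4*K)) (hδ0 : 0 ≤ δ) (hδ1 : δ ≤ c0/4) (hc : ∀ t ∈ I, |c t - 1| ≤ δ)
    (hc' : ∀ t ∈ I, |c' t - 1| ≤ δ) (hcc : Continuous c) (hcc' : Continuous c') (hN : 0 ≤ N)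
    (hNc : ∀ t ∈ I, |c t - c' t| ≤ N) :
    |dmJ I c' q' p' - dmJ I c q p - ∫ t in I, (c' t - c t) * (1 - Real.cos (q t))| ≤
      3 * (50 * K^2/c0^2 * N)^2 * K^2 := by
  have hc01 := W.c0le
  have hK := W.K1
  obtain ⟨hq, hp⟩ := dm_dep D W S S' hr hr1 hδ1 hc hN hNc
  obtain ⟨P, hP0, hP⟩ := S'.pbd D W hr hδ0 hc'
  obtain ⟨P1, hP10, hP1⟩ := S.pbd D W hr hδ0 hc
  have T := dm_taylor D W S' hr hcc' (fun t ht => dm_c2 (hc' t ht) (by linarith)) hP0 hP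
    (show 0 ≤ 50 * K^2/c0^2 * N by positivity) S.dq
    (fun t ht => (S.dp t ht).continuousAt.continuousWithinAt)
    (fun t ht => by rw [S.bc t ht, S'.bc t ht]) hq hp
  have cq : ContinuousOn q I := fun t ht => (S.dq t ht).continuousAt.continuousWithinAt
  have cp : ContinuousOn p I := fun t ht => (S.dp t ht).continuousAt.continuousWithinAt
  have cc : ContinuousOn c I := hcc.continuousOn
  have cc' : ContinuousOn c' I := hcc'.continuousOn
  have gen : ∀ (d : ℝ → ℝ) (B : ℝ), ContinuousOn d I → 0 ≤ B → (∀ t ∈ I, |d t| ≤ B) →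
      IntegrableOn (fun t => d t * (1 - Real.cos (q t))) I := by
    intro d B hd hB hdB
    refine dm_intg D W _ (B * (K + r)) (by fun_prop) (fun t ht => ?_)
    rw [abs_mul, mul_assoc]
    exact mul_le_mul (hdB t ht) (S.cosle W ht) (abs_nonneg _) hB
  have i1 := gen c 2 cc (by norm_num) (fun t ht => dm_c2 (hc t ht) (by linarith))
  have i2 := gen (fun t => c' t - c t) N (cc'.sub cc) hN
    (fun t ht => by rw [abs_sub_comm]; exact hNc t ht)
  have i3 : IntegrableOn (fun t => p t ^ 2 / 2) I := by
    refine dm_intg D W _ (P1 * P1 * K) (by fun_prop) (fun t ht => ?_)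
    have h1 := hP1 t ht
    have h2 := W.le t ht
    have h3 := W.pos t ht
    rw [abs_of_nonneg (by positivity), ← sq_abs]
    have h4 : |p t|^2 ≤ (P1 * ψ t)^2 := pow_le_pow_left₀ (abs_nonneg _) h1 2
    have h5 : (P1 * ψ t)^2 ≤ P1 * P1 * K * ψ t := by
      have := mul_le_mul_of_nonneg_left h2 (show 0 ≤ P1 * P1 * ψ t by positivity)
      nlinarith
    nlinarith [sq_nonneg |p t|]
  have e : dmJ I c' q p = dmJ I c q p + ∫ t in I, (c' t - c t) * (1 - Real.cos (q t)) := by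
    unfold dmJ
    have a1 := integral_add (i3.add i1) i2
    simp only [Pi.add_apply] at a1
    rw [← a1]
    congr 1; ext t; ring
  rw [e] at T
  rw [abs_sub_comm] at T
  convert T using 2
  ring

lemma dm_val (D : Dom I bd) (W : Wt I Q Q1 Q2 ψ ψ1 ψ2 c0 K ε) {c q p : ℝ → ℝ}
    {δ : ℝ} (S : Sol I bd Q ψ c q p (6 * (ε + δ * K) / c0^2))
    (hr1 : 6 * (ε + δ * K) / c0^2 ≤ c0/(4*K)) (hδ0 : 0 ≤ δ) (hδ1 : δ ≤ c0/4)
    (hc : ∀ t ∈ I, |c t - 1| ≤ δ) (hcc : Continuous c) :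
    |dmJ I c q p - dmJ I c Q Q1| ≤ 1200 * K^6/c0^4 * (δ + ε)^2 := by
  have hc01 := W.c0le
  have hc0 := W.c0pos
  have hK := W.K1
  have hK0 : 0 < K := by linarith
  have hε := W.ε0
  set r := 6 * (ε + δ * K) / c0^2 with hrdef
  have hr : 0 ≤ r := by positivity
  have hrK : r ≤ K := by
    refine hr1.trans ?_
    rw [div_le_iff₀ (by positivity)]; nlinarith
  have hx : r ≤ 6 * K / c0^2 * (δ + ε) := by
    rw [hrdef, div_mul_eq_mul_div]
    apply div_le_div_of_nonneg_right _ (by positivity)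
    nlinarith
  have hKc : K ≤ K/c0^2 := by
    rw [le_div_iff₀ (by positivity)]
    have : c0^2 ≤ 1 := by nlinarith
    nlinarith
  have hN : K * (2 * r + (δ * (K + r) + r + ε)) ≤ 20 * K^2/c0^2 * (δ + ε) := by
    have h1 : δ * (K + r) ≤ 2 * K * δ := by nlinarith
    have h2 : 2 * r + (δ * (K + r) + r + ε) ≤ 20 * (K / c0^2) * (δ + ε) := by
      have e : 6 * K / c0^2 * (δ + ε) = 6 * (K/c0^2 * (δ + ε)) := by ring
      have h3 : K * (δ + ε) ≤ K/c0^2 * (δ + ε) := mul_le_mul_of_nonneg_right hKc (by positivity)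
      have h4 : ε ≤ K * ε := by nlinarith
      nlinarith
    have := mul_le_mul_of_nonneg_left h2 hK0.le
    refine this.trans (le_of_eq ?_)
    ring
  have hN2 : r ≤ 20 * K^2/c0^2 * (δ + ε) := by
    refine le_trans ?_ hN
    have : 0 ≤ δ * (K + r) + r + ε := by positivity
    nlinarith
  obtain ⟨P, hP0, hP⟩ := S.pbd D W hr hδ0 hc
  have T := dm_taylor D W S hr hcc (fun t ht => dm_c2 (hc t ht) (by linarith)) hP0 hP
    (show 0 ≤ 20 * K^2/c0^2 * (δ + ε) by positivity) (fun t _ => W.dQ t)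
    (fun t ht => (W.dQ1 t).continuousAt.continuousWithinAt)
    (fun t ht => (S.bc t ht).symm)
    (fun t ht => by
      rw [abs_sub_comm]
      exact (S.near t ht).trans (mul_le_mul_of_nonneg_right hN2 (W.pos t ht).le))
    (fun t ht => by
      rw [abs_sub_comm]
      exact (S.pnear D W hr hδ0 hc t ht).trans (mul_le_mul_of_nonneg_right hN (W.pos t ht).le))
  rw [abs_sub_comm]
  refine T.trans (le_of_eq ?_)
  field_simp
  ring
end
end DmPart4

section DmPart5
open Set Topology

noncomputable def dmA (t : ℝ) : ℝ := 4 * Real.arctan (Real.exp (-t))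
noncomputable def dmA1 (t : ℝ) : ℝ := -(4 * Real.exp (-t) / (1 + Real.exp (-t)^2))
noncomputable def dmP (t : ℝ) : ℝ := Real.exp (-t/2) - 1/2 * Real.exp (-(5*t/2))
noncomputable def dmP1 (t : ℝ) : ℝ := -1/2 * Real.exp (-t/2) + 5/4 * Real.exp (-(5*t/2))
noncomputable def dmP2 (t : ℝ) : ℝ := 1/4 * Real.exp (-t/2) - 25/8 * Real.exp (-(5*t/2))

lemma dm_trig (x : ℝ) : Real.sin (4 * Real.arctan x) = 4 * x * (1 - x^2) / (1 + x^2)^2 ∧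
    Real.cos (4 * Real.arctan x) = 1 - 8 * x^2 / (1 + x^2)^2 := by
  have hp : (0:ℝ) < 1 + x^2 := by positivity
  have hs : Real.sin (Real.arctan x) * Real.cos (Real.arctan x) = x / (1 + x^2) := by
    rw [Real.sin_arctan, Real.cos_arctan, div_mul_div_comm, mul_one, Real.mul_self_sqrt hp.le]
  have hc : Real.cos (Real.arctan x)^2 = 1 / (1 + x^2) := Real.cos_sq_arctan x
  have s2 : Real.sin (2 * Real.arctan x) = 2 * x / (1 + x^2) := by
    rw [Real.sin_two_mul, mul_assoc, hs]; ring
  have c2 : Real.cos (2 * Real.arctan x) = (1 - x^2) / (1 + x^2) := by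
    rw [Real.cos_two_mul, hc]; field_simp; ring
  have e : 4 * Real.arctan x = 2 * (2 * Real.arctan x) := by ring
  rw [e]
  constructor
  · rw [Real.sin_two_mul, s2, c2]; field_simp; ring
  · rw [Real.cos_two_mul, c2]; field_simp; ring

lemma dmA_deriv (t : ℝ) : HasDerivAt dmA (dmA1 t) t := by
  have h1 : HasDerivAt (fun t : ℝ => Real.exp (-t)) (-Real.exp (-t)) t := by
    exact ((hasDerivAt_id t).neg.exp).congr_deriv (by simp)
  have h2 := (h1.arctan).const_mul 4
  refine h2.congr_deriv ?_
  unfold dmA1; ring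

lemma dmA1_deriv (t : ℝ) : HasDerivAt dmA1 (Real.sin (dmA t)) t := by
  have h1 : HasDerivAt (fun t : ℝ => Real.exp (-t)) (-Real.exp (-t)) t := by
    exact ((hasDerivAt_id t).neg.exp).congr_deriv (by simp)
  have hp : (1 + Real.exp (-t)^2) ≠ 0 := by positivity
  have h2 := ((h1.const_mul 4).div ((h1.pow 2).const_add 1) hp).neg
  refine h2.congr_deriv ?_
  unfold dmA
  rw [(dm_trig _).1]
  simp only [Pi.pow_apply]
  field_simp
  push_cast
  ring

lemma dmA_cont : Continuous dmA := continuous_iff_continuousAt.2 (fun t => (dmA_deriv t).continuousAt)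

lemma dmP_deriv (t : ℝ) : HasDerivAt dmP (dmP1 t) t := by
  have h1 : HasDerivAt (fun t : ℝ => Real.exp (-t/2)) (-1/2 * Real.exp (-t/2)) t := by
    exact (((hasDerivAt_id t).neg.div_const 2).exp).congr_deriv (by simp; ring)
  have h2 : HasDerivAt (fun t : ℝ => Real.exp (-(5*t/2))) (-5/2 * Real.exp (-(5*t/2))) t := by
    exact ((((hasDerivAt_id t).const_mul 5).div_const 2).neg.exp).congr_deriv (by simp; ring)
  exact (h1.sub (h2.const_mul (1/2))).congr_deriv (by unfold dmP1; ring)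

lemma dmP1_deriv (t : ℝ) : HasDerivAt dmP1 (dmP2 t) t := by
  have h1 : HasDerivAt (fun t : ℝ => Real.exp (-t/2)) (-1/2 * Real.exp (-t/2)) t := by
    exact (((hasDerivAt_id t).neg.div_const 2).exp).congr_deriv (by simp; ring)
  have h2 : HasDerivAt (fun t : ℝ => Real.exp (-(5*t/2))) (-5/2 * Real.exp (-(5*t/2))) t := by
    exact ((((hasDerivAt_id t).const_mul 5).div_const 2).neg.exp).congr_deriv (by simp; ring)
  exact ((h1.const_mul (-1/2)).add (h2.const_mul (5/4))).congr_deriv (by unfold dmP2; ring)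

lemma dmP_bd (t : ℝ) (ht : 0 ≤ t) : 1/2 * Real.exp (-t/2) ≤ dmP t ∧ dmP t ≤ Real.exp (-t/2) := by
  have h1 : Real.exp (-(5*t/2)) ≤ Real.exp (-t/2) := Real.exp_le_exp.2 (by linarith)
  have h2 := Real.exp_pos (-(5*t/2))
  unfold dmP
  constructor <;> linarith

lemma dmA_facts (t : ℝ) (ht : 0 ≤ t) : 0 ≤ Real.sin (dmA t) ∧ Real.sin (dmA t) ≤ 4 * Real.exp (-t) ∧
    0 ≤ 1 - Real.cos (dmA t) ∧ 1 - Real.cos (dmA t) ≤ 8 * Real.exp (-t)^2 ∧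
    |dmA1 t| ≤ 4 * Real.exp (-t) ∧ 0 ≤ dmA t ∧ dmA t ≤ 4 * Real.exp (-t) ∧
    (1 - Real.cos (dmA t) + 1/4) * dmP t ≤ dmP t - dmP2 t := by
  set x := Real.exp (-t) with hx
  have hx0 : 0 < x := Real.exp_pos _
  have hx1 : x ≤ 1 := Real.exp_le_one_iff.2 (by linarith)
  have hx2 : x^2 ≤ 1 := by nlinarith
  have hp : (0:ℝ) < 1 + x^2 := by positivity
  have hp2 : (1:ℝ) ≤ (1 + x^2)^2 := by nlinarith
  have hs : Real.sin (dmA t) = 4 * x * (1 - x^2) / (1 + x^2)^2 := (dm_trig x).1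
  have hc : Real.cos (dmA t) = 1 - 8 * x^2 / (1 + x^2)^2 := (dm_trig x).2
  refine ⟨?_, ?_, ?_, ?_, ?_, ?_, ?_, ?_⟩
  · rw [hs]
    apply div_nonneg _ (by positivity)
    apply mul_nonneg (by positivity); linarith
  · rw [hs, div_le_iff₀ (by positivity)]
    have : 4 * x * (1 - x^2) ≤ 4 * x * 1 := mul_le_mul_of_nonneg_left (by nlinarith) (by positivity)
    have : 4 * x * 1 ≤ 4 * x * (1 + x^2)^2 := mul_le_mul_of_nonneg_left hp2 (by positivity)
    linarith
  · rw [hc]; have : 0 ≤ 8 * x^2 / (1 + x^2)^2 := by positivity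
    linarith
  · rw [hc]
    have : 8 * x^2 / (1 + x^2)^2 ≤ 8 * x^2 := div_le_self (by positivity) hp2
    linarith
  · unfold dmA1
    rw [abs_neg, abs_of_nonneg (by positivity)]
    exact div_le_self (by positivity) (by nlinarith)
  · exact mul_nonneg (by norm_num) (Real.arctan_nonneg.2 hx0.le)
  · have : Real.arctan x ≤ x := by
      have h := Real.le_tan (Real.arctan_nonneg.2 hx0.le) (Real.arctan_lt_pi_div_two x)
      rwa [Real.tan_arctan] at h
    unfold dmA; rw [← hx]; linarith
  · rw [hc]
    set z := Real.exp (-t/2)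
    have hz : 0 < z := Real.exp_pos _
    have e1 : Real.exp (-(5*t/2)) = z * x^2 := by
      rw [← Real.exp_nat_mul, ← Real.exp_add]; congr 1; push_cast; ring
    unfold dmP dmP2
    rw [e1]
    have key : (8 * x^2 / (1 + x^2)^2 + 1/4) * (1 - 1/2 * x^2) ≤ 3/4 + 21/8 * x^2 := by
      set y := x^2
      have hy : 0 < y := by positivity
      have : 8 * y / (1 + y)^2 * (1 - 1/2 * y) ≤ 1/2 + 11/4 * y := by
        rw [div_mul_eq_mul_div, div_le_iff₀ (by positivity)]
        nlinarith [sq_nonneg (y - 17/80), pow_pos hy 3]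
      nlinarith
    have := mul_le_mul_of_nonneg_left key hz.le
    nlinarith

lemma dm_expint : IntegrableOn (fun t : ℝ => Real.exp (-t/2)) (Ici 0) ∧
    ∫ t in Ici (0:ℝ), Real.exp (-t/2) = 2 := by
  have h1 := integrableOn_exp_mul_Ioi (a := -1/2) (by norm_num) 0
  have h2 := integral_exp_mul_Ioi (a := -1/2) (by norm_num) 0
  have e : ∀ t : ℝ, Real.exp (-1/2 * t) = Real.exp (-t/2) := fun t => by congr 1; ring
  simp only [e] at h1 h2
  refine ⟨(integrableOn_Ici_iff_integrableOn_Ioi).2 h1, ?_⟩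
  rw [integral_Ici_eq_integral_Ioi, h2]; norm_num

lemma dmP_har (s t : ℝ) (hs : 0 ≤ s) (ht : 0 ≤ t) (hst : |s - t| ≤ 1) : dmP s ≤ 4 * dmP t := by
  have h1 := (dmP_bd s hs).2
  have h2 := (dmP_bd t ht).1
  have h3 : Real.exp (-s/2) ≤ 2 * Real.exp (-t/2) := by
    have e : Real.exp (-s/2) = Real.exp ((t-s)/2) * Real.exp (-t/2) := by
      rw [← Real.exp_add]; congr 1; ring
    rw [e]
    refine mul_le_mul_of_nonneg_right ?_ (Real.exp_pos _).le
    have h4 : Real.exp ((t-s)/2) ≤ Real.exp (1/2) := Real.exp_le_exp.2 (by linarith [(abs_le.1 hst).1])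
    have h5 : Real.exp (1/2) * Real.exp (1/2) = Real.exp 1 := by rw [← Real.exp_add]; norm_num
    have h6 := Real.exp_one_lt_d9
    have h7 := Real.exp_pos (1/2)
    nlinarith
  linarith

lemma dm_expx (t : ℝ) (ht : 0 ≤ t) : Real.exp (-t) ≤ 2 * dmP t := by
  have h2 := (dmP_bd t ht).1
  have : Real.exp (-t) ≤ Real.exp (-t/2) := Real.exp_le_exp.2 (by linarith)
  linarith

/-- the half-line weight -/
lemma dm_WtIci : Wt (Ici 0) (fun t => -dmA t) (fun t => -dmA1 t) (fun t => -Real.sin (dmA t))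
    dmP dmP1 dmP2 (1/8) 32 0 where
  dQ t := (dmA_deriv t).neg
  dQ1 t := (dmA1_deriv t).neg
  cQ2 := (Real.continuous_sin.comp dmA_cont).neg
  dψ := dmP_deriv
  dψ1 := dmP1_deriv
  pos t ht := lt_of_lt_of_le (by positivity) (dmP_bd t ht).1
  le t ht := by
    have := (dmP_bd t ht).2
    have : Real.exp (-t/2) ≤ 1 := Real.exp_le_one_iff.2 (by have := mem_Ici.1 ht; linarith)
    linarith
  har s hs t ht hst := by
    have h1 := dmP_har s t hs ht hst
    have h2 : 0 < dmP t := lt_of_lt_of_le (by positivity) (dmP_bd t ht).1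
    linarith
  sup t ht := by
    have h1 := (dmA_facts t ht).2.2.2.2.2.2.2
    have h2 : 0 < dmP t := lt_of_lt_of_le (by positivity) (dmP_bd t ht).1
    rw [Real.cos_neg]; linarith
  err t ht := by rw [Real.sin_neg]; simp
  sinQ t ht := by
    obtain ⟨h1, h2, -⟩ := dmA_facts t ht
    have := dm_expx t ht
    rw [Real.sin_neg, abs_neg, abs_of_nonneg h1]
    have := Real.exp_pos (-t)
    linarith
  Q1le t ht := by
    obtain ⟨-, -, -, -, h1, -⟩ := dmA_facts t ht
    have := dm_expx t ht
    have := Real.exp_pos (-t)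
    rw [abs_neg]; linarith
  cosQ t ht := by
    obtain ⟨-, -, -, h1, -⟩ := dmA_facts t ht
    have := dm_expx t ht
    have h2 := Real.exp_pos (-t)
    have : Real.exp (-t) ≤ 1 := Real.exp_le_one_iff.2 (by have := mem_Ici.1 ht; linarith)
    rw [Real.cos_neg]; nlinarith
  int := by
    have hc : Continuous dmP := continuous_iff_continuousAt.2 (fun t => (dmP_deriv t).continuousAt)
    refine dm_expint.1.mono' hc.aestronglyMeasurable.restrict
      ((ae_restrict_iff' measurableSet_Ici).2 (ae_of_all _ (fun t ht => ?_)))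
    have h1 := dmP_bd t ht
    rw [Real.norm_eq_abs, abs_of_nonneg (by have := Real.exp_pos (-t/2); linarith)]
    exact h1.2
  intle := by
    have hc : Continuous dmP := continuous_iff_continuousAt.2 (fun t => (dmP_deriv t).continuousAt)
    have h1 := norm_integral_le_of_norm_le (μ := volume.restrict (Ici 0)) (f := dmP) dm_expint.1
      ((ae_restrict_iff' measurableSet_Ici).2 (ae_of_all _ (fun t ht => by
        have h1 := dmP_bd t ht
        rw [Real.norm_eq_abs, abs_of_nonneg (by have := Real.exp_pos (-t/2); linarith)]
        exact h1.2)))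
    rw [dm_expint.2, Real.norm_eq_abs] at h1
    have := le_abs_self (∫ t in Ici (0:ℝ), dmP t)
    linarith
  c0pos := by norm_num
  c0le := by norm_num
  K1 := by norm_num
  ε0 := le_rfl
end DmPart5

section DmPart6
open Set Topology

noncomputable def dmQ (L t : ℝ) : ℝ := -dmA t + dmA (L - t) - dmA L * (1 - 2 * t / L)
noncomputable def dmQ1 (L t : ℝ) : ℝ := -dmA1 t - dmA1 (L - t) + 2 * dmA L / L
noncomputable def dmQ2 (L t : ℝ) : ℝ := -Real.sin (dmA t) + Real.sin (dmA (L - t))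
noncomputable def dmPm (L t : ℝ) : ℝ := dmP t + dmP (L - t)
noncomputable def dmPm1 (L t : ℝ) : ℝ := dmP1 t - dmP1 (L - t)
noncomputable def dmPm2 (L t : ℝ) : ℝ := dmP2 t + dmP2 (L - t)

lemma dm_refl {g g' : ℝ → ℝ} (L : ℝ) (h : ∀ t, HasDerivAt g (g' t) t) (t : ℝ) :
    HasDerivAt (fun t => g (L - t)) (-g' (L - t)) t := by
  have := (h (L - t)).comp t ((hasDerivAt_id t).const_sub L)
  exact this.congr_deriv (by simp)

structure MidF (L t : ℝ) : Prop where
  lin : |dmA L * (1 - 2 * t / L)| ≤ 4 * Real.exp (-L/2)^2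
  psi : Real.exp (-L/2) ≤ dmPm L t
  psi2 : dmPm L t ≤ 2
  px : Real.exp (-t) ≤ 2 * dmP t
  px' : Real.exp (-(L-t)) ≤ 2 * dmP (L-t)
  p0 : 0 < dmP t
  p0' : 0 < dmP (L-t)
  xx : Real.exp (-t) * Real.exp (-(L-t)) = Real.exp (-L/2)^2
  x1 : Real.exp (-t) ≤ 1
  x1' : Real.exp (-(L-t)) ≤ 1
  cosle : 1 - Real.cos (dmQ L t) ≤ (1 - Real.cos (dmA t)) + (1 - Real.cos (dmA (L-t))) +
    4 * Real.exp (-L/2)^2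
  A4 : 0 ≤ dmA L ∧ dmA L ≤ 4 * Real.exp (-L/2)^2
  cr : Real.exp (-(L-t))^2 * dmP t ≤ 2 * Real.exp (-L/2) * dmP (L-t)
  cr' : Real.exp (-t)^2 * dmP (L-t) ≤ 2 * Real.exp (-L/2) * dmP t

lemma dm_cr (s t : ℝ) (hs : 0 ≤ s) (ht : 0 ≤ t) : Real.exp (-s)^2 * dmP t ≤
    2 * Real.exp (-(s+t)/2) * dmP s := by
  have h1 := (dmP_bd t ht).2
  have h2 := (dmP_bd s hs).1
  have e1 : Real.exp (-s)^2 = Real.exp (-2*s) := by rw [← Real.exp_nat_mul]; congr 1; push_cast; ring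
  have a1 : Real.exp (-s)^2 * dmP t ≤ Real.exp (-2*s) * Real.exp (-t/2) := by
    rw [e1]; exact mul_le_mul_of_nonneg_left h1 (Real.exp_pos _).le
  have a2 : Real.exp (-2*s) * Real.exp (-t/2) ≤ Real.exp (-(s+t)/2) * Real.exp (-s/2) := by
    rw [← Real.exp_add, ← Real.exp_add]; exact Real.exp_le_exp.2 (by linarith)
  have a3 := mul_le_mul_of_nonneg_left h2 (Real.exp_pos (-(s+t)/2)).le
  linarith

lemma dm_midF (L t : ℝ) (hL : 2 ≤ L) (ht : t ∈ Icc 0 L) : MidF L t := by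
  have h0 := ht.1
  have h1 : 0 ≤ L - t := by linarith [ht.2]
  have e2 : Real.exp (-L/2)^2 = Real.exp (-L) := by
    rw [← Real.exp_nat_mul]; congr 1; push_cast; ring
  obtain ⟨-, -, -, -, -, a1, a2, -⟩ := dmA_facts L (by linarith)
  have hlin : |dmA L * (1 - 2 * t / L)| ≤ 4 * Real.exp (-L/2)^2 := by
    rw [e2, abs_mul, abs_of_nonneg a1]
    have : |1 - 2 * t / L| ≤ 1 := by
      have b1 : 2 * t / L ≤ 2 := by rw [div_le_iff₀ (by linarith)]; linarith [ht.2]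
      have b2 : 0 ≤ 2 * t / L := by positivity
      exact abs_le.2 ⟨by linarith, by linarith⟩
    nlinarith [abs_nonneg (1 - 2 * t / L)]
  have p1 := dmP_bd t h0
  have p2 := dmP_bd (L-t) h1
  have g1 : Real.exp (-L/2) ≤ Real.exp (-t/2) := Real.exp_le_exp.2 (by linarith)
  have g2 : Real.exp (-L/2) ≤ Real.exp (-(L-t)/2) := Real.exp_le_exp.2 (by linarith)
  have k1 : Real.exp (-t/2) ≤ 1 := Real.exp_le_one_iff.2 (by linarith)
  have k2 : Real.exp (-(L-t)/2) ≤ 1 := Real.exp_le_one_iff.2 (by linarith)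
  refine ⟨hlin, by unfold dmPm; linarith, by unfold dmPm; linarith, dm_expx t h0, dm_expx _ h1,
    lt_of_lt_of_le (by positivity) p1.1, lt_of_lt_of_le (by positivity) p2.1, ?_,
    Real.exp_le_one_iff.2 (by linarith), Real.exp_le_one_iff.2 (by linarith), ?_,
    ⟨a1, by rw [e2]; exact a2⟩, ?_, ?_⟩
  · rw [e2, ← Real.exp_add]; congr 1; ring
  · obtain ⟨s1, -, c1, -⟩ := dmA_facts t h0
    obtain ⟨s2, -, c2, -⟩ := dmA_facts (L-t) h1
    have b1 : Real.cos (-dmA t + dmA (L-t)) = Real.cos (dmA t) * Real.cos (dmA (L-t)) +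
        Real.sin (dmA t) * Real.sin (dmA (L-t)) := by
      rw [Real.cos_add, Real.cos_neg, Real.sin_neg]; ring
    have b2 := Real.abs_cos_sub_cos_le (dmQ L t) (-dmA t + dmA (L-t))
    have b3 : |dmQ L t - (-dmA t + dmA (L-t))| = |dmA L * (1 - 2 * t / L)| := by
      unfold dmQ; rw [← abs_neg]; congr 1; ring
    rw [b3] at b2
    have b4 := (abs_le.1 (b2.trans hlin)).1
    nlinarith [mul_nonneg s1 s2, mul_nonneg c1 c2]
  · have := dm_cr (L-t) t h1 h0
    rwa [show -(L-t+t)/2 = -L/2 by ring] at this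
  · have := dm_cr t (L-t) h0 h1
    rwa [show -(t+(L-t))/2 = -L/2 by ring] at this

lemma dm_midint (L : ℝ) (hL : 2 ≤ L) : ∫ t in Icc 0 L, dmPm L t ≤ 32 := by
  have hc : Continuous dmP := continuous_iff_continuousAt.2 (fun t => (dmP_deriv t).continuousAt)
  have hcm : Continuous (dmPm L) := by unfold dmPm; fun_prop
  rw [integral_Icc_eq_integral_Ioc, ← intervalIntegral.integral_of_le (by linarith)]
  have hd : ∀ t, HasDerivAt (fun t => -2 * Real.exp (-t/2) + 2 * Real.exp (-(L-t)/2))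
      (Real.exp (-t/2) + Real.exp (-(L-t)/2)) t := fun t => by
    have h1 : HasDerivAt (fun t : ℝ => Real.exp (-t/2)) (-1/2 * Real.exp (-t/2)) t := by
      exact (((hasDerivAt_id t).neg.div_const 2).exp).congr_deriv (by simp; ring)
    have h2 : HasDerivAt (fun t : ℝ => Real.exp (-(L-t)/2)) (1/2 * Real.exp (-(L-t)/2)) t := by
      exact ((((hasDerivAt_id t).const_sub L).neg.div_const 2).exp).congr_deriv (by simp; ring)
    exact ((h1.const_mul (-2)).add (h2.const_mul 2)).congr_deriv (by ring)
  have hci : Continuous (fun t => Real.exp (-t/2) + Real.exp (-(L-t)/2)) := by fun_prop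
  have h1 : ∫ t in (0:ℝ)..L, dmPm L t ≤ ∫ t in (0:ℝ)..L, (Real.exp (-t/2) + Real.exp (-(L-t)/2)) := by
    refine intervalIntegral.integral_mono_on (by linarith) (hcm.intervalIntegrable _ _)
      (hci.intervalIntegrable _ _) (fun t ht => ?_)
    exact add_le_add (dmP_bd t ht.1).2 (dmP_bd (L-t) (by linarith [ht.2])).2
  rw [intervalIntegral.integral_eq_sub_of_hasDerivAt (fun t _ => hd t)
    (hci.intervalIntegrable _ _)] at h1
  have e := Real.exp_pos (-L/2)
  simp at h1
  have e2 := Real.exp_pos (-L/2)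
  linarith

lemma dm_WtIcc (L : ℝ) (hL : 2 ≤ L) (hg : Real.exp (-L/2) ≤ 1/200) :
    Wt (Icc 0 L) (dmQ L) (dmQ1 L) (dmQ2 L) (dmPm L) (dmPm1 L) (dmPm2 L) (1/8) 32
      (200 * Real.exp (-L/2)) where
  dQ t := by
    have h := (((dmA_deriv t).neg.add (dm_refl L dmA_deriv t)).sub
      (((((hasDerivAt_id t).const_mul 2).div_const L).const_sub 1).const_mul (dmA L)))
    refine h.congr_deriv ?_
    unfold dmQ1; ring
  dQ1 t := by
    have h := ((dmA1_deriv t).neg.sub (dm_refl L dmA1_deriv t)).add_const (2 * dmA L / L)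
    refine h.congr_deriv ?_
    unfold dmQ2; ring
  cQ2 := by
    have := dmA_cont
    unfold dmQ2; fun_prop
  dψ t := ((dmP_deriv t).add (dm_refl L dmP_deriv t)).congr_deriv (by unfold dmPm1; ring)
  dψ1 t := ((dmP1_deriv t).sub (dm_refl L dmP1_deriv t)).congr_deriv (by unfold dmPm2; ring)
  pos t ht := by
    have M := dm_midF L t hL ht
    exact (Real.exp_pos _).trans_le M.psi
  le t ht := by
    have M := dm_midF L t hL ht
    linarith [M.psi2]
  har s hs t ht hst := by
    have M := dm_midF L t hL ht
    have h1 := dmP_har s t hs.1 ht.1 hst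
    have h2 := dmP_har (L-s) (L-t) (by linarith [hs.2]) (by linarith [ht.2])
      (by rw [show L - s - (L - t) = -(s - t) by ring, abs_neg]; exact hst)
    have := M.p0
    have := M.p0'
    unfold dmPm; linarith
  sup t ht := by
    have M := dm_midF L t hL ht
    obtain ⟨-, -, c1, c1', -, -, -, s1⟩ := dmA_facts t ht.1
    obtain ⟨-, -, c2, c2', -, -, -, s2⟩ := dmA_facts (L-t) (by linarith [ht.2])
    have k := M.cosle
    have g0 := Real.exp_pos (-L/2)
    have p0 := M.p0
    have p0' := M.p0'
    have hg2 : 4 * Real.exp (-L/2)^2 ≤ 1/40 := by nlinarith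
    have h1 : (1 - Real.cos (dmQ L t) + 1/8) * dmPm L t ≤ ((1 - Real.cos (dmA t)) +
      (1 - Real.cos (dmA (L-t))) + 1/40 + 1/8) * dmPm L t :=
      mul_le_mul_of_nonneg_right (by linarith) (by unfold dmPm; linarith)
    have h2 : (1 - Real.cos (dmA t)) * dmP (L-t) ≤ 16/200 * dmP t := by
      have a1 := mul_le_mul_of_nonneg_right c1' p0'.le
      have a2 := M.cr'
      have a3 := mul_le_mul_of_nonneg_right hg p0.le
      linarith
    have h3 : (1 - Real.cos (dmA (L-t))) * dmP t ≤ 16/200 * dmP (L-t) := by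
      have a1 := mul_le_mul_of_nonneg_right c2' p0.le
      have a2 := M.cr
      have a3 := mul_le_mul_of_nonneg_right hg p0'.le
      linarith
    refine h1.trans ?_
    unfold dmPm dmPm2
    nlinarith
  err t ht := by
    have M := dm_midF L t hL ht
    obtain ⟨s1, s1', c1, c1', -⟩ := dmA_facts t ht.1
    obtain ⟨s2, s2', c2, c2', -⟩ := dmA_facts (L-t) (by linarith [ht.2])
    have b1 : Real.sin (-dmA t + dmA (L-t)) = -Real.sin (dmA t) * Real.cos (dmA (L-t)) +
        Real.cos (dmA t) * Real.sin (dmA (L-t)) := by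
      rw [Real.sin_add, Real.cos_neg, Real.sin_neg]
    have b2 := Real.abs_sin_sub_sin_le (dmQ L t) (-dmA t + dmA (L-t))
    have b3 : |dmQ L t - (-dmA t + dmA (L-t))| = |dmA L * (1 - 2 * t / L)| := by
      unfold dmQ; rw [← abs_neg]; congr 1; ring
    rw [b3] at b2
    have b4 := abs_le.1 (b2.trans M.lin)
    have x0 := Real.exp_pos (-t)
    have x0' := Real.exp_pos (-(L-t))
    have xx := M.xx
    have d1 : Real.sin (dmA t) * (1 - Real.cos (dmA (L-t))) ≤ 32 * Real.exp (-L/2)^2 := by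
      have := mul_le_mul s1' c2' c2 (by positivity)
      have h5 : Real.exp (-t) * Real.exp (-(L-t)) * Real.exp (-(L-t)) ≤ Real.exp (-L/2)^2 * 1 := by
        rw [xx]; exact mul_le_mul_of_nonneg_left M.x1' (by positivity)
      nlinarith
    have d2 : Real.sin (dmA (L-t)) * (1 - Real.cos (dmA t)) ≤ 32 * Real.exp (-L/2)^2 := by
      have := mul_le_mul s2' c1' c1 (by positivity)
      have h5 : Real.exp (-t) * Real.exp (-(L-t)) * Real.exp (-t) ≤ Real.exp (-L/2)^2 * 1 := by
        rw [xx]; exact mul_le_mul_of_nonneg_left M.x1 (by positivity)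
      nlinarith
    have d1' := mul_nonneg s1 c2
    have d2' := mul_nonneg s2 c1
    have hfin : |dmQ2 L t - Real.sin (dmQ L t)| ≤ 100 * Real.exp (-L/2)^2 := by
      unfold dmQ2
      rw [abs_le]
      constructor <;> nlinarith
    refine hfin.trans ?_
    have g0 := Real.exp_pos (-L/2)
    have := mul_le_mul_of_nonneg_left M.psi g0.le
    nlinarith [M.psi]
  sinQ t ht := by
    have M := dm_midF L t hL ht
    obtain ⟨s1, s1', c1, c1', -⟩ := dmA_facts t ht.1
    obtain ⟨s2, s2', c2, c2', -⟩ := dmA_facts (L-t) (by linarith [ht.2])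
    have b1 : Real.sin (-dmA t + dmA (L-t)) = -Real.sin (dmA t) * Real.cos (dmA (L-t)) +
        Real.cos (dmA t) * Real.sin (dmA (L-t)) := by
      rw [Real.sin_add, Real.cos_neg, Real.sin_neg]
    have b2 := Real.abs_sin_sub_sin_le (dmQ L t) (-dmA t + dmA (L-t))
    have b3 : |dmQ L t - (-dmA t + dmA (L-t))| = |dmA L * (1 - 2 * t / L)| := by
      unfold dmQ; rw [← abs_neg]; congr 1; ring
    rw [b3] at b2
    have b4 := abs_le.1 (b2.trans M.lin)
    have b5 : |Real.sin (-dmA t + dmA (L-t))| ≤ Real.sin (dmA t) + Real.sin (dmA (L-t)) := by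
      rw [b1, abs_le]
      have := Real.cos_le_one (dmA t)
      have := Real.cos_le_one (dmA (L-t))
      have := Real.neg_one_le_cos (dmA t)
      have := Real.neg_one_le_cos (dmA (L-t))
      constructor <;> nlinarith
    have b6 := abs_le.1 b5
    have px := M.px
    have px' := M.px'
    have g0 := Real.exp_pos (-L/2)
    have g3 : Real.exp (-L/2)^2 ≤ dmPm L t := by nlinarith [M.psi]
    unfold dmPm at *
    have := M.p0
    have := M.p0'
    rw [abs_le]; constructor <;> linarith
  Q1le t ht := by
    have M := dm_midF L t hL ht
    obtain ⟨-, -, -, -, a1, -⟩ := dmA_facts t ht.1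
    obtain ⟨-, -, -, -, a2, -⟩ := dmA_facts (L-t) (by linarith [ht.2])
    have px := M.px
    have px' := M.px'
    have g0 := Real.exp_pos (-L/2)
    have g3 : Real.exp (-L/2)^2 ≤ dmPm L t := by nlinarith [M.psi]
    have l0 : 0 ≤ 2 * dmA L / L := div_nonneg (by linarith [M.A4.1]) (by linarith)
    have l1 : 2 * dmA L / L ≤ dmA L := by
      rw [div_le_iff₀ (by linarith)]; nlinarith [M.A4.1]
    have l2 := M.A4.2
    have := M.p0
    have := M.p0'
    unfold dmPm at *
    unfold dmQ1
    obtain ⟨u1, u2⟩ := abs_le.1 a1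
    obtain ⟨v1, v2⟩ := abs_le.1 a2
    rw [abs_le]; constructor <;> linarith
  cosQ t ht := by
    have M := dm_midF L t hL ht
    obtain ⟨-, -, c1, c1', -⟩ := dmA_facts t ht.1
    obtain ⟨-, -, c2, c2', -⟩ := dmA_facts (L-t) (by linarith [ht.2])
    have k := M.cosle
    have px := M.px
    have px' := M.px'
    have x0 := Real.exp_pos (-t)
    have x0' := Real.exp_pos (-(L-t))
    have g0 := Real.exp_pos (-L/2)
    have g3 : Real.exp (-L/2)^2 ≤ dmPm L t := by nlinarith [M.psi]
    have y1 : Real.exp (-t)^2 ≤ Real.exp (-t) := by nlinarith [M.x1]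
    have y2 : Real.exp (-(L-t))^2 ≤ Real.exp (-(L-t)) := by nlinarith [M.x1']
    have := M.p0
    have := M.p0'
    unfold dmPm at *
    linarith
  int := by
    have hc : Continuous dmP := continuous_iff_continuousAt.2 (fun t => (dmP_deriv t).continuousAt)
    have hcm : Continuous (dmPm L) := by unfold dmPm; fun_prop
    exact hcm.continuousOn.integrableOn_Icc
  intle := dm_midint L hL
  c0pos := by norm_num
  c0le := by norm_num
  K1 := by norm_num
  ε0 := by positivity
end DmPart6

section DmPart7
open Set Topology

section
variable {I bd : Set ℝ} {Q Q1 Q2 ψ ψ1 ψ2 : ℝ → ℝ} {c0 K ε : ℝ}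

lemma Sol.contq {c q p : ℝ → ℝ} {r : ℝ} (S : Sol I bd Q ψ c q p r) : ContinuousOn q I :=
  fun t ht => (S.dq t ht).continuousAt.continuousWithinAt

lemma Sol.contp {c q p : ℝ → ℝ} {r : ℝ} (S : Sol I bd Q ψ c q p r) : ContinuousOn p I :=
  fun t ht => (S.dp t ht).continuousAt.continuousWithinAt

lemma Sol.cint (D : Dom I bd) (W : Wt I Q Q1 Q2 ψ ψ1 ψ2 c0 K ε) {c q p : ℝ → ℝ} {r : ℝ}
    (S : Sol I bd Q ψ c q p r) (hr : 0 ≤ r) (d : ℝ → ℝ) (B : ℝ) (hd : ContinuousOn d I)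
    (hB : 0 ≤ B) (hdB : ∀ t ∈ I, |d t| ≤ B) :
    IntegrableOn (fun t => d t * (1 - Real.cos (q t))) I ∧
    |∫ t in I, d t * (1 - Real.cos (q t))| ≤ B * (K + r) * K := by
  have hK := W.K1
  have cq := S.contq
  have h : ∀ t ∈ I, |d t * (1 - Real.cos (q t))| ≤ B * (K + r) * ψ t := fun t ht => by
    rw [abs_mul, mul_assoc]
    exact mul_le_mul (hdB t ht) (S.cosle W ht) (abs_nonneg _) hB
  exact ⟨dm_intg D W _ (B * (K + r)) (by fun_prop) h, dm_intb D W _ _ (by positivity) h⟩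

lemma Sol.pint (D : Dom I bd) (W : Wt I Q Q1 Q2 ψ ψ1 ψ2 c0 K ε) {c q p : ℝ → ℝ} {r δ : ℝ}
    (S : Sol I bd Q ψ c q p r) (hr : 0 ≤ r) (hδ : 0 ≤ δ) (hc : ∀ t ∈ I, |c t - 1| ≤ δ) :
    IntegrableOn (fun t => p t ^ 2 / 2) I := by
  obtain ⟨P1, hP10, hP1⟩ := S.pbd D W hr hδ hc
  have hK := W.K1
  have cp := S.contp
  refine dm_intg D W _ (P1 * P1 * K) (by fun_prop) (fun t ht => ?_)
  have h1 := hP1 t ht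
  have h2 := W.le t ht
  have h3 := W.pos t ht
  rw [abs_of_nonneg (by positivity), ← sq_abs]
  have h4 : |p t|^2 ≤ (P1 * ψ t)^2 := pow_le_pow_left₀ (abs_nonneg _) h1 2
  have h5 : (P1 * ψ t)^2 ≤ P1 * P1 * K * ψ t := by
    have := mul_le_mul_of_nonneg_left h2 (show 0 ≤ P1 * P1 * ψ t by positivity)
    nlinarith
  nlinarith [sq_nonneg |p t|]

/-- Lipschitz dependence of the action -/
lemma dm_lip (D : Dom I bd) (W : Wt I Q Q1 Q2 ψ ψ1 ψ2 c0 K ε) {c q p c' q' p' : ℝ → ℝ}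
    {r δ N : ℝ} (S : Sol I bd Q ψ c q p r) (S' : Sol I bd Q ψ c' q' p' r) (hr : 0 ≤ r)
    (hr1 : r ≤ c0/(4*K)) (hδ0 : 0 ≤ δ) (hδ1 : δ ≤ c0/4) (hc : ∀ t ∈ I, |c t - 1| ≤ δ)
    (hc' : ∀ t ∈ I, |c' t - 1| ≤ δ) (hcc : Continuous c) (hcc' : Continuous c') (hN : 0 ≤ N)
    (hNc : ∀ t ∈ I, |c t - c' t| ≤ N) :
    |dmJ I c' q' p' - dmJ I c q p| ≤ N * (K + r) * K + 3 * (50 * K^2/c0^2 * N)^2 * K^2 := by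
  have h1 := dm_sigma D W S S' hr hr1 hδ0 hδ1 hc hc' hcc hcc' hN hNc
  have h2 := (S.cint D W hr (fun t => c' t - c t) N (by fun_prop) hN
    (fun t ht => by rw [abs_sub_comm]; exact hNc t ht)).2
  have h3 := abs_sub_abs_le_abs_sub (dmJ I c' q' p' - dmJ I c q p)
    (∫ t in I, (c' t - c t) * (1 - Real.cos (q t)))
  linarith

/-- derivative of the action along a curve of coefficients -/
lemma dm_deriv (D : Dom I bd) (W : Wt I Q Q1 Q2 ψ ψ1 ψ2 c0 K ε) {c q p : ℝ → ℝ → ℝ}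
    {r δ Λ : ℝ} (d : ℝ → ℝ) (hr : 0 ≤ r) (hr1 : r ≤ c0/(4*K)) (hδ0 : 0 ≤ δ) (hδ1 : δ ≤ c0/4)
    (hΛ : 0 ≤ Λ)
    (hS : ∀ᶠ h in 𝓝 (0:ℝ), Sol I bd Q ψ (c h) (q h) (p h) r ∧ (∀ t ∈ I, |c h t - 1| ≤ δ) ∧
      Continuous (c h) ∧ (∀ t ∈ I, |c h t - c 0 t| ≤ Λ * |h|) ∧
      ∀ t ∈ I, |c h t - c 0 t - h * d t| ≤ Λ * h^2)
    (hd : ContinuousOn d I) (hdB : ∀ t ∈ I, |d t| ≤ Λ) :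
    HasDerivAt (fun h => dmJ I (c h) (q h) (p h)) (∫ t in I, d t * (1 - Real.cos (q 0 t))) 0 := by
  obtain ⟨S0, b0, cc0, -, -⟩ := hS.self_of_nhds
  have hK := W.K1
  have hc0 := W.c0pos
  rw [hasDerivAt_iff_isLittleO]
  set C := Λ * (K + r) * K + 3 * (50 * K^2/c0^2 * Λ)^2 * K^2 with hC
  have hO : (fun h => dmJ I (c h) (q h) (p h) - dmJ I (c 0) (q 0) (p 0) -
      (h - 0) • ∫ t in I, d t * (1 - Real.cos (q 0 t))) =O[𝓝 0] (fun h : ℝ => (h - 0)^2) := by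
    refine Asymptotics.IsBigO.of_bound C ?_
    filter_upwards [hS] with h ⟨Sh, bh, cch, e1, e2⟩
    have h1 := dm_sigma D W S0 Sh hr hr1 hδ0 hδ1 b0 bh cc0 cch (N := Λ * |h|) (by positivity)
      (fun t ht => by rw [abs_sub_comm]; exact e1 t ht)
    have i1 := (S0.cint D W hr (fun t => c h t - c 0 t) (Λ * |h|) (by fun_prop) (by positivity)
      e1).1
    have i2 := (S0.cint D W hr d Λ hd hΛ hdB).1
    have i3 := (S0.cint D W hr (fun t => c h t - c 0 t - h * d t) (Λ * h^2) (by fun_prop)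
      (by positivity) e2).2
    have e3 : ∫ t in I, (c h t - c 0 t - h * d t) * (1 - Real.cos (q 0 t)) =
        (∫ t in I, (c h t - c 0 t) * (1 - Real.cos (q 0 t))) -
        h * ∫ t in I, d t * (1 - Real.cos (q 0 t)) := by
      rw [← integral_const_mul, ← integral_sub i1 (i2.const_mul h)]
      congr 1; ext t; ring
    rw [e3] at i3
    simp only [sub_zero, smul_eq_mul, Real.norm_eq_abs]
    have h4 := abs_add_le (dmJ I (c h) (q h) (p h) - dmJ I (c 0) (q 0) (p 0) -
      ∫ t in I, (c h t - c 0 t) * (1 - Real.cos (q 0 t)))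
      ((∫ t in I, (c h t - c 0 t) * (1 - Real.cos (q 0 t))) -
        h * ∫ t in I, d t * (1 - Real.cos (q 0 t)))
    rw [sub_add_sub_cancel] at h4
    refine h4.trans ((add_le_add h1 i3).trans (le_of_eq ?_))
    rw [hC, abs_of_nonneg (sq_nonneg h)]
    have : (50 * K^2/c0^2 * (Λ * |h|))^2 = (50 * K^2/c0^2 * Λ)^2 * h^2 := by
      rw [← sq_abs h]; ring
    rw [this]; ring
  refine hO.trans_isLittleO ?_
  have := Asymptotics.isLittleO_pow_id (𝕜 := ℝ) (n := 2) (by norm_num)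
  simpa using this

/-- energy -/
noncomputable def dmH (c q p : ℝ → ℝ) (t : ℝ) : ℝ := p t ^2/2 - c t * (1 - Real.cos (q t))

lemma Sol.dH {c c1 q p : ℝ → ℝ} {r : ℝ} (S : Sol I bd Q ψ c q p r)
    (hc : ∀ t, HasDerivAt c (c1 t) t) : ∀ t ∈ I,
    HasDerivAt (dmH c q p) (-(c1 t * (1 - Real.cos (q t)))) t := by
  intro t ht
  have h1 := ((S.dp t ht).pow 2).div_const 2
  have h2 := (hc t).mul (((S.dq t ht).cos).const_sub 1)
  refine (h1.sub h2).congr_deriv ?_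
  push_cast
  ring
end

section
variable {bd : Set ℝ} {L : ℝ} {Q Q1 Q2 ψ ψ1 ψ2 : ℝ → ℝ} {c0 K ε : ℝ}

lemma dm_E1 {c c1 q p : ℝ → ℝ} {r : ℝ} (hL : 0 ≤ L) (S : Sol (Icc 0 L) bd Q ψ c q p r)
    (hc : ∀ t, HasDerivAt c (c1 t) t) (hc1 : Continuous c1) :
    ∫ t in Icc 0 L, c1 t * (1 - Real.cos (q t)) = dmH c q p 0 - dmH c q p L := by
  have cq := S.contq
  have h := intervalIntegral.integral_eq_sub_of_hasDerivAt (a := 0) (b := L) (f := dmH c q p)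
    (f' := fun t => -(c1 t * (1 - Real.cos (q t))))
    (fun t ht => S.dH hc t (by rwa [uIcc_of_le hL] at ht))
    (ContinuousOn.intervalIntegrable (by rw [uIcc_of_le hL]; fun_prop))
  rw [intervalIntegral.integral_neg, intervalIntegral.integral_of_le hL,
    ← integral_Icc_eq_integral_Ioc] at h
  linarith

lemma dm_E2 {c c1 q p : ℝ → ℝ} {r : ℝ} (hL : 0 ≤ L) (S : Sol (Icc 0 L) bd Q ψ c q p r)
    (hc : ∀ t, HasDerivAt c (c1 t) t) (hc1 : Continuous c1) :
    dmJ (Icc 0 L) c q p - 2 * (∫ t in Icc 0 L, c t * (1 - Real.cos (q t))) -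
      ∫ t in Icc 0 L, t * c1 t * (1 - Real.cos (q t)) = L * dmH c q p L := by
  have cq := S.contq
  have cp := S.contp
  have cc : ContinuousOn c (Icc 0 L) := fun t _ => (hc t).continuousAt.continuousWithinAt
  have h := intervalIntegral.integral_eq_sub_of_hasDerivAt (a := 0) (b := L)
    (f := fun t => t * dmH c q p t)
    (f' := fun t => (p t ^2/2 + c t * (1 - Real.cos (q t))) - 2 * (c t * (1 - Real.cos (q t))) -
      t * c1 t * (1 - Real.cos (q t)))
    (fun t ht => ((hasDerivAt_id t).mul (S.dH hc t (by rwa [uIcc_of_le hL] at ht))).congr_deriv (by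
      simp only [id, dmH]; ring))
    (ContinuousOn.intervalIntegrable (by rw [uIcc_of_le hL]; fun_prop))
  rw [intervalIntegral.integral_of_le hL, ← integral_Icc_eq_integral_Ioc] at h
  have hK : IsCompact (Icc 0 L) := isCompact_Icc
  have i1 : IntegrableOn (fun t => p t ^2/2 + c t * (1 - Real.cos (q t))) (Icc 0 L) :=
    ContinuousOn.integrableOn_compact hK (by fun_prop)
  have i2 : IntegrableOn (fun t => 2 * (c t * (1 - Real.cos (q t)))) (Icc 0 L) :=
    ContinuousOn.integrableOn_compact hK (by fun_prop)
  have i3 : IntegrableOn (fun t => t * c1 t * (1 - Real.cos (q t))) (Icc 0 L) :=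
    ContinuousOn.integrableOn_compact hK (by fun_prop)
  have e := integral_sub (i1.sub i2) i3
  simp only [Pi.sub_apply] at e
  have e2 := integral_sub i1 i2
  rw [e, e2, integral_const_mul] at h
  unfold dmJ
  linarith
end

/-- half line energy identity -/
lemma dm_E3 {c c1 q p : ℝ → ℝ} {r δ B : ℝ}
    (S : Sol (Ici 0) {0} (fun t => -dmA t) dmP c q p r) (hr : 0 ≤ r) (hδ : 0 ≤ δ)
    (hcb : ∀ t ∈ Ici (0:ℝ), |c t - 1| ≤ δ) (hδ1 : δ ≤ 1)
    (hc : ∀ t, HasDerivAt c (c1 t) t) (hc1 : Continuous c1) (hB : 0 ≤ B) (hB1 : ∀ t, |c1 t| ≤ B) :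
    ∫ t in Ici (0:ℝ), c1 t * (1 - Real.cos (q t)) = dmH c q p 0 := by
  have hlim : Tendsto (dmH c q p) atTop (𝓝 0) := by
    obtain ⟨P, hP0, hP⟩ := S.pbd dm_domIci dm_WtIci hr hδ hcb
    have hexp : Tendsto (fun t : ℝ => Real.exp (-t/2)) atTop (𝓝 0) := by
      refine Real.tendsto_exp_atBot.comp ?_
      have : (fun t : ℝ => -t/2) = fun t => -(t * (1/2)) := by ext t; ring
      rw [this]
      exact tendsto_neg_atTop_atBot.comp (tendsto_id.atTop_mul_const (by norm_num))
    have h1 : Tendsto (fun t : ℝ => (P * Real.exp (-t/2))^2/2 + 2 * ((32 + r) * Real.exp (-t/2)))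
        atTop (𝓝 0) := by
      have := (((hexp.const_mul P).pow 2).div_const 2).add ((hexp.const_mul (32 + r)).const_mul 2)
      simpa using this
    refine squeeze_zero_norm' ?_ h1
    filter_upwards [eventually_ge_atTop 0] with t ht
    have ht' : t ∈ Ici (0:ℝ) := ht
    have h2 := hP t ht'
    have h3 := S.cosle dm_WtIci ht'
    have h4 := (dmP_bd t ht).2
    have h5 := dm_c2 (hcb t ht') hδ1
    have h6 : |p t| ≤ P * Real.exp (-t/2) := h2.trans (mul_le_mul_of_nonneg_left h4 hP0)
    have h7 : |1 - Real.cos (q t)| ≤ (32 + r) * Real.exp (-t/2) :=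
      h3.trans (mul_le_mul_of_nonneg_left h4 (by positivity))
    have h8 : |c t * (1 - Real.cos (q t))| ≤ 2 * ((32 + r) * Real.exp (-t/2)) := by
      rw [abs_mul]; exact mul_le_mul h5 h7 (abs_nonneg _) (by norm_num)
    have h9 : |p t ^2/2| ≤ (P * Real.exp (-t/2))^2/2 := by
      rw [abs_of_nonneg (by positivity), ← sq_abs]
      gcongr
    have := abs_sub (p t ^2/2) (c t * (1 - Real.cos (q t)))
    rw [Real.norm_eq_abs]; unfold dmH; linarith
  have i := (S.cint dm_domIci dm_WtIci hr c1 B hc1.continuousOn hB (fun t _ => hB1 t)).1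
  have h := integral_Ioi_of_hasDerivAt_of_tendsto' (a := 0) (f := dmH c q p)
    (f' := fun t => -(c1 t * (1 - Real.cos (q t)))) (m := 0)
    (fun t ht => S.dH hc t ht) ((i.mono_set Ioi_subset_Ici_self).neg) hlim
  rw [integral_neg] at h
  rw [integral_Ici_eq_integral_Ioi]
  linarith
end DmPart7

section DmPart8
open Set Topology

/-- uniform bounds on the perturbation -/
structure FB {n : ℕ} (f : (Fin n → ℝ) → ℝ) (f1 : (Fin n → ℝ) → (Fin n → ℝ) →L[ℝ] ℝ) (M : ℝ) :
    Prop where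
  d : ∀ x, HasFDerivAt f (f1 x) x
  c1 : Continuous f1
  b0 : ∀ x, |f x| ≤ M
  b1 : ∀ x v, |f1 x v| ≤ M * ‖v‖
  lip : ∀ x y, |f x - f y| ≤ M * ‖x - y‖
  b2 : ∀ x y, |f (x + y) - f x - f1 x y| ≤ M * ‖y‖^2
  M1 : 1 ≤ M

noncomputable def cf {n : ℕ} (f : (Fin n → ℝ) → ℝ) (μ : ℝ) (w a : Fin n → ℝ) (m t : ℝ) : ℝ :=
  m^2 * (1 - μ * f (a + (m * t) • w))

section
variable {n : ℕ} {f : (Fin n → ℝ) → ℝ} {f1 : (Fin n → ℝ) → (Fin n → ℝ) →L[ℝ] ℝ} {M μ : ℝ}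

lemma FB.cont (F : FB f f1 M) : Continuous f :=
  continuous_iff_continuousAt.2 (fun x => (F.d x).continuousAt)

lemma FB.m2 {m : ℝ} (hμ : 0 ≤ μ) (hμ1 : μ ≤ 1) (hm : |m - 1| ≤ μ) : |m| ≤ 2 ∧ |m^2 - 1| ≤ 3 * μ := by
  have := abs_le.1 hm
  constructor
  · rw [abs_le]; constructor <;> linarith
  · have e : m^2 - 1 = (m - 1) * (m + 1) := by ring
    rw [e, abs_mul, mul_comm 3]
    refine mul_le_mul hm ?_ (abs_nonneg _) hμ
    rw [abs_le]; constructor <;> linarith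

lemma dm_cf_bd (F : FB f f1 M) (hμ : 0 ≤ μ) (hμ1 : μ ≤ 1) (w a : Fin n → ℝ) (m t : ℝ)
    (hm : |m - 1| ≤ μ) : |cf f μ w a m t - 1| ≤ 7 * M * μ := by
  have hM := F.M1
  obtain ⟨h1, h2⟩ := FB.m2 hμ hμ1 hm
  have h3 := F.b0 (a + (m * t) • w)
  have e : cf f μ w a m t - 1 = (m^2 - 1) - m^2 * (μ * f (a + (m * t) • w)) := by unfold cf; ring
  rw [e]
  have h4 : |m^2 * (μ * f (a + (m * t) • w))| ≤ 4 * (μ * M) := by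
    rw [abs_mul, abs_mul, abs_of_nonneg hμ, abs_of_nonneg (sq_nonneg m)]
    refine mul_le_mul ?_ (mul_le_mul_of_nonneg_left h3 hμ) (by positivity) (by norm_num)
    rw [← sq_abs]; nlinarith [abs_nonneg m]
  have := abs_sub (m^2 - 1) (m^2 * (μ * f (a + (m * t) • w)))
  nlinarith

lemma dm_cf_dt (F : FB f f1 M) (w a : Fin n → ℝ) (m t : ℝ) :
    HasDerivAt (cf f μ w a m) (-(m^3 * μ * f1 (a + (m * t) • w) w)) t := by
  have h1 : HasDerivAt (fun t : ℝ => a + (m * t) • w) (m • w) t := by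
    have := (((hasDerivAt_id t).const_mul m).smul_const w).const_add a
    simpa using this
  have h2 := (F.d (a + (m * t) • w)).comp_hasDerivAt t h1
  have h3 := ((h2.const_mul μ).const_sub 1).const_mul (m^2)
  refine h3.congr_deriv ?_
  rw [map_smul, smul_eq_mul]; ring

lemma dm_cf_cont (F : FB f f1 M) (w a : Fin n → ℝ) (m : ℝ) : Continuous (cf f μ w a m) :=
  continuous_iff_continuousAt.2 (fun t => (dm_cf_dt F w a m t).continuousAt)

lemma dm_f1_cont (F : FB f f1 M) (w a : Fin n → ℝ) (m : ℝ) (g : ℝ → Fin n → ℝ) (hg : Continuous g) :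
    Continuous (fun t : ℝ => f1 (a + (m * t) • w) (g t)) := by
  have : Continuous (fun t : ℝ => f1 (a + (m * t) • w)) := F.c1.comp (by fun_prop)
  exact this.clm_apply hg

lemma dm_cf_lip (F : FB f f1 M) (hμ : 0 ≤ μ) (hμ1 : μ ≤ 1) (w a a' : Fin n → ℝ) (m m' t B : ℝ)
    (hm : |m - 1| ≤ μ) (hm' : |m' - 1| ≤ μ) (hB : |(m - m') * t| ≤ B * |m - m'|) :
    |cf f μ w a m t - cf f μ w a' m' t| ≤ 8 * M * |m - m'| + 4 * M * (‖a - a'‖ + B * |m - m'| * ‖w‖) := by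
  have hM := F.M1
  obtain ⟨h1, -⟩ := FB.m2 hμ hμ1 hm
  obtain ⟨h1', -⟩ := FB.m2 hμ hμ1 hm'
  have h3 := F.b0 (a + (m * t) • w)
  have h4 := F.lip (a + (m * t) • w) (a' + (m' * t) • w)
  have e : cf f μ w a m t - cf f μ w a' m' t = (m - m') * (m + m') * (1 - μ * f (a + (m * t) • w)) -
    m'^2 * (μ * (f (a + (m * t) • w) - f (a' + (m' * t) • w))) := by unfold cf; ring
  have e2 : a + (m * t) • w - (a' + (m' * t) • w) = (a - a') + ((m - m') * t) • w := by
    rw [sub_mul, sub_smul]; abel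
  have h5 : ‖a + (m * t) • w - (a' + (m' * t) • w)‖ ≤ ‖a - a'‖ + B * |m - m'| * ‖w‖ := by
    rw [e2]
    refine (norm_add_le _ _).trans ?_
    rw [norm_smul, Real.norm_eq_abs]
    gcongr
  set X := ‖a - a'‖ + B * |m - m'| * ‖w‖
  have hX : 0 ≤ X := (norm_nonneg _).trans h5
  have h6 : |f (a + (m * t) • w) - f (a' + (m' * t) • w)| ≤ M * X :=
    h4.trans (mul_le_mul_of_nonneg_left h5 (by linarith))
  have h7 : |1 - μ * f (a + (m * t) • w)| ≤ 2 * M := by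
    have := abs_sub 1 (μ * f (a + (m * t) • w))
    rw [abs_one, abs_mul, abs_of_nonneg hμ] at this
    have h8 := mul_le_mul hμ1 h3 (abs_nonneg _) (by norm_num)
    linarith
  have h8 : |m + m'| ≤ 4 := (abs_add_le _ _).trans (by linarith)
  have h9 : |(m - m') * (m + m') * (1 - μ * f (a + (m * t) • w))| ≤ |m - m'| * 4 * (2 * M) := by
    rw [abs_mul, abs_mul]
    gcongr
  have h10 : |m'^2 * (μ * (f (a + (m * t) • w) - f (a' + (m' * t) • w)))| ≤ 4 * (1 * (M * X)) := by
    rw [abs_mul, abs_mul, abs_of_nonneg hμ, abs_of_nonneg (sq_nonneg m')]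
    have : m'^2 ≤ 4 := by rw [← sq_abs]; nlinarith [abs_nonneg m']
    gcongr
  rw [e]
  have := abs_sub ((m - m') * (m + m') * (1 - μ * f (a + (m * t) • w)))
    (m'^2 * (μ * (f (a + (m * t) • w) - f (a' + (m' * t) • w))))
  linarith

/-- the derivative of the coefficient along a line -/
noncomputable def cfd (f : (Fin n → ℝ) → ℝ) (f1 : (Fin n → ℝ) → (Fin n → ℝ) →L[ℝ] ℝ)
    (μ : ℝ) (w a : Fin n → ℝ) (m : ℝ) (α : Fin n → ℝ) (β t : ℝ) : ℝ :=
  2 * m * β * (1 - μ * f (a + (m * t) • w)) - m^2 * μ * f1 (a + (m * t) • w) (α + (β * t) • w)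

lemma cfd_cont (F : FB f f1 M) (w a : Fin n → ℝ) (m : ℝ) (α : Fin n → ℝ) (β : ℝ) :
    Continuous (cfd f f1 μ w a m α β) := by
  have h1 := dm_f1_cont F w a m (fun t => α + (β * t) • w) (by fun_prop)
  have h2 : Continuous (fun t : ℝ => f (a + (m * t) • w)) := F.cont.comp (by fun_prop)
  exact (continuous_const.mul (continuous_const.sub (continuous_const.mul h2))).sub (continuous_const.mul h1)

lemma cfd_bd (F : FB f f1 M) (hμ : 0 ≤ μ) (hμ1 : μ ≤ 1) (w a : Fin n → ℝ) (m : ℝ)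
    (α : Fin n → ℝ) (β t U : ℝ) (hm : |m - 1| ≤ μ) (hU : ‖α + (β * t) • w‖ ≤ U) :
    |cfd f f1 μ w a m α β t| ≤ 8 * M * |β| + 4 * M * U := by
  have hM := F.M1
  obtain ⟨h1, -⟩ := FB.m2 hμ hμ1 hm
  have h3 := F.b0 (a + (m * t) • w)
  have h7 : |1 - μ * f (a + (m * t) • w)| ≤ 2 * M := by
    have := abs_sub 1 (μ * f (a + (m * t) • w))
    rw [abs_one, abs_mul, abs_of_nonneg hμ] at this
    have h8 := mul_le_mul hμ1 h3 (abs_nonneg _) (by norm_num)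
    linarith
  have h4 := (F.b1 (a + (m * t) • w) (α + (β * t) • w)).trans
    (mul_le_mul_of_nonneg_left hU (by linarith))
  have hU0 : 0 ≤ U := (norm_nonneg _).trans hU
  have h5 : |2 * m * β * (1 - μ * f (a + (m * t) • w))| ≤ 2 * 2 * |β| * (2 * M) := by
    rw [abs_mul, abs_mul, abs_mul, abs_two]; gcongr
  have h6 : |m^2 * μ * f1 (a + (m * t) • w) (α + (β * t) • w)| ≤ 4 * 1 * (M * U) := by
    rw [abs_mul, abs_mul, abs_of_nonneg hμ, abs_of_nonneg (sq_nonneg m)]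
    have : m^2 ≤ 4 := by rw [← sq_abs]; nlinarith [abs_nonneg m]
    gcongr
  have := abs_sub (2 * m * β * (1 - μ * f (a + (m * t) • w)))
    (m^2 * μ * f1 (a + (m * t) • w) (α + (β * t) • w))
  unfold cfd; linarith

lemma cfd_tay (F : FB f f1 M) (hμ : 0 ≤ μ) (hμ1 : μ ≤ 1) (w a : Fin n → ℝ) (m : ℝ)
    (α : Fin n → ℝ) (β t U h : ℝ) (hm : |m - 1| ≤ μ) (hU : ‖α + (β * t) • w‖ ≤ U) (hh : |h| ≤ 1) :
    |cf f μ w (a + h • α) (m + h * β) t - cf f μ w a m t - h * cfd f f1 μ w a m α β t| ≤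
      (4 * (M * U^2) + 4 * |β| * (M * U + M * U^2) + β^2 * (2 * M)) * h^2 := by
  have hM := F.M1
  obtain ⟨h1, -⟩ := FB.m2 hμ hμ1 hm
  have hU0 : 0 ≤ U := (norm_nonneg _).trans hU
  set x := a + (m * t) • w with hx
  set u := α + (β * t) • w with hu
  have ex : a + h • α + ((m + h * β) * t) • w = x + h • u := by
    rw [hx, hu, smul_add, smul_smul, add_mul, add_smul]
    have : h * β * t = h * (β * t) := by ring
    rw [this]; abel
  have hb2 := F.b2 x (h • u)
  set R := f (x + h • u) - f x - f1 x (h • u) with hR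
  have hR1 : |R| ≤ h^2 * (M * U^2) := by
    refine hb2.trans ?_
    rw [norm_smul, mul_pow, Real.norm_eq_abs, sq_abs]
    have : ‖u‖^2 ≤ U^2 := pow_le_pow_left₀ (norm_nonneg _) hU 2
    have : h^2 * ‖u‖^2 ≤ h^2 * U^2 := mul_le_mul_of_nonneg_left this (sq_nonneg h)
    nlinarith
  have hg : f (x + h • u) = f x + h * f1 x u + R := by rw [hR, map_smul, smul_eq_mul]; ring
  have hgb := F.b0 (x + h • u)
  have h4 := (F.b1 x u).trans (mul_le_mul_of_nonneg_left hU (by linarith))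
  have h7 : |1 - μ * f (x + h • u)| ≤ 2 * M := by
    have := abs_sub 1 (μ * f (x + h • u))
    rw [abs_one, abs_mul, abs_of_nonneg hμ] at this
    have h8 := mul_le_mul hμ1 hgb (abs_nonneg _) (by norm_num)
    linarith
  have e : cf f μ w (a + h • α) (m + h * β) t - cf f μ w a m t - h * cfd f f1 μ w a m α β t =
      -(m^2 * (μ * R)) + (-(2 * m * β * h * (μ * (h * f1 x u + R))) +
        h^2 * β^2 * (1 - μ * f (x + h • u))) := by
    unfold cf cfd
    rw [ex, ← hx, ← hu]
    have : f x = f (x + h • u) - h * f1 x u - R := by rw [hg]; ring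
    rw [this]; ring
  have hm4 : m^2 ≤ 4 := by rw [← sq_abs]; nlinarith [abs_nonneg m]
  have b1 : |m^2 * (μ * R)| ≤ 4 * (1 * (h^2 * (M * U^2))) := by
    rw [abs_mul, abs_mul, abs_of_nonneg hμ, abs_of_nonneg (sq_nonneg m)]; gcongr
  have hh2 : h^2 ≤ |h| := by rw [← sq_abs]; nlinarith [abs_nonneg h]
  have hs : |h * f1 x u + R| ≤ |h| * (M * U + M * U^2) := by
    refine (abs_add_le _ _).trans ?_
    rw [abs_mul]
    have : |h| * |f1 x u| ≤ |h| * (M * U) := by gcongr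
    have : h^2 * (M * U^2) ≤ |h| * (M * U^2) := by gcongr
    linarith
  have b2 : |2 * m * β * h * (μ * (h * f1 x u + R))| ≤
      2 * 2 * |β| * |h| * (1 * (|h| * (M * U + M * U^2))) := by
    rw [abs_mul, abs_mul, abs_mul, abs_mul, abs_mul, abs_of_nonneg hμ, abs_two]; gcongr
  have b3 : |h^2 * β^2 * (1 - μ * f (x + h • u))| ≤ h^2 * β^2 * (2 * M) := by
    rw [abs_mul, abs_of_nonneg (by positivity)]; gcongr
  rw [e]
  have t1 := abs_add_le (-(m^2 * (μ * R))) (-(2 * m * β * h * (μ * (h * f1 x u + R))) +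
        h^2 * β^2 * (1 - μ * f (x + h • u)))
  have t2 := abs_add_le (-(2 * m * β * h * (μ * (h * f1 x u + R))))
        (h^2 * β^2 * (1 - μ * f (x + h • u)))
  rw [abs_neg] at t1 t2
  have e5 : 2 * 2 * |β| * |h| * (1 * (|h| * (M * U + M * U^2))) =
    4 * |β| * (M * U + M * U^2) * h^2 := by rw [← sq_abs h]; ring
  rw [e5] at b2
  linarith

/-- family of solutions -/
def Fam (I bd : Set ℝ) (Q ψ : ℝ → ℝ) (f : (Fin n → ℝ) → ℝ) (μ : ℝ) (w : Fin n → ℝ)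
    (q p : (Fin n → ℝ) → ℝ → ℝ → ℝ) (r : ℝ) : Prop :=
  ∀ a m, |m - 1| ≤ μ → Sol I bd Q ψ (cf f μ w a m) (q a m) (p a m) r

noncomputable def dmS (I : Set ℝ) (f : (Fin n → ℝ) → ℝ) (μ : ℝ) (w : Fin n → ℝ)
    (q p : (Fin n → ℝ) → ℝ → ℝ → ℝ) (a : Fin n → ℝ) (m : ℝ) : ℝ :=
  dmJ I (cf f μ w a m) (q a m) (p a m) / m

variable {I bd : Set ℝ} {Q Q1 Q2 ψ ψ1 ψ2 : ℝ → ℝ} {c0 K ε r : ℝ}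
  {w : Fin n → ℝ} {q p : (Fin n → ℝ) → ℝ → ℝ → ℝ}

lemma dm_fam (D : Dom I bd) (W : Wt I Q Q1 Q2 ψ ψ1 ψ2 c0 K ε) (F : FB f f1 M) (hμ : 0 ≤ μ)
    (hμ1 : μ ≤ 1) (w : Fin n → ℝ) (hδ1 : 7 * M * μ ≤ c0/4)
    (hsmall : 6 * (ε + 7 * M * μ * K)/c0^2 ≤ c0/(4*K)) :
    ∃ q p, Fam I bd Q ψ f μ w q p (6 * (ε + 7 * M * μ * K)/c0^2) := by
  have hM := F.M1
  have : ∀ (a : Fin n → ℝ) (m : ℝ), ∃ q p : ℝ → ℝ, |m - 1| ≤ μ →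
      Sol I bd Q ψ (cf f μ w a m) q p (6 * (ε + 7 * M * μ * K)/c0^2) := by
    intro a m
    by_cases hm : |m - 1| ≤ μ
    · obtain ⟨q, p, h⟩ := dm_exists D W (cf f μ w a m) (dm_cf_cont F w a m) (7 * M * μ)
        (by positivity) (fun t _ => dm_cf_bd F hμ hμ1 w a m t hm) hδ1 hsmall
      exact ⟨q, p, fun _ => h⟩
    · exact ⟨0, 0, fun h => absurd h hm⟩
  choose q p h using this
  exact ⟨q, p, h⟩

lemma dm_Sderiv (D : Dom I bd) (W : Wt I Q Q1 Q2 ψ ψ1 ψ2 c0 K ε) (F : FB f f1 M) (hμ : 0 ≤ μ)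
    (hμ1 : μ < 1) (hδ1 : 7 * M * μ ≤ c0/4) (hr : 0 ≤ r) (hr1 : r ≤ c0/(4*K))
    (hF : Fam I bd Q ψ f μ w q p r) (a : Fin n → ℝ) (m : ℝ) (α : Fin n → ℝ) (β U : ℝ)
    (hm : ∀ᶠ h in 𝓝 (0:ℝ), |m + h * β - 1| ≤ μ) (hU : ∀ t ∈ I, ‖α + (β * t) • w‖ ≤ U) (hU0 : 0 ≤ U) :
    HasDerivAt (fun h => dmS I f μ w q p (a + h • α) (m + h * β))
      ((∫ t in I, cfd f f1 μ w a m α β t * (1 - Real.cos (q a m t))) / m -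
        dmJ I (cf f μ w a m) (q a m) (p a m) * β / m^2) 0 := by
  have hM := F.M1
  have hm0 : |m - 1| ≤ μ := by simpa using hm.self_of_nhds
  have hmpos : 0 < m := by have := abs_le.1 hm0; linarith
  set Λ1 := 8 * M * |β| + 4 * M * U with hΛ1
  set Λ2 := 4 * (M * U^2) + 4 * |β| * (M * U + M * U^2) + β^2 * (2 * M) with hΛ2
  have h1 : 0 ≤ Λ1 := by positivity
  have h2 : 0 ≤ Λ2 := by positivity
  have key := dm_deriv D W (c := fun h => cf f μ w (a + h • α) (m + h * β))
    (q := fun h => q (a + h • α) (m + h * β)) (p := fun h => p (a + h • α) (m + h * β))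
    (r := r) (δ := 7 * M * μ) (Λ := Λ1 + Λ2) (cfd f f1 μ w a m α β) hr hr1 (by positivity) hδ1
    (by positivity) (by
      have hb : ∀ᶠ h in 𝓝 (0:ℝ), |h| ≤ 1 := by
        filter_upwards [Metric.ball_mem_nhds (0:ℝ) one_pos] with h hh
        have : |h| < 1 := by simpa using hh
        exact this.le
      filter_upwards [hm, hb] with h hmh hh
      have T : ∀ t ∈ I, |cf f μ w (a + h • α) (m + h * β) t - cf f μ w a m t -
          h * cfd f f1 μ w a m α β t| ≤ Λ2 * h^2 := fun t ht =>
        cfd_tay F hμ hμ1.le w a m α β t U h hm0 (hU t ht) hh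
      refine ⟨hF _ _ hmh, fun t _ => dm_cf_bd F hμ hμ1.le w _ _ t hmh, dm_cf_cont F w _ _, ?_, ?_⟩
      · intro t ht
        simp only [zero_smul, add_zero, zero_mul]
        have b1 := T t ht
        have b2 := cfd_bd F hμ hμ1.le w a m α β t U hm0 (hU t ht)
        have b3 := abs_add_le (cf f μ w (a + h • α) (m + h * β) t - cf f μ w a m t -
          h * cfd f f1 μ w a m α β t) (h * cfd f f1 μ w a m α β t)
        rw [sub_add_cancel, abs_mul h] at b3
        have b4 : |h| * |cfd f f1 μ w a m α β t| ≤ |h| * Λ1 := by gcongr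
        have hh2 : h^2 ≤ |h| := by rw [← sq_abs]; nlinarith [abs_nonneg h]
        have b5 : Λ2 * h^2 ≤ Λ2 * |h| := by gcongr
        linarith
      · intro t ht
        simp only [zero_smul, add_zero, zero_mul]
        have b1 := T t ht
        have : 0 ≤ Λ1 * h^2 := by positivity
        linarith)
    (cfd_cont F w a m α β).continuousOn
    (fun t ht => (cfd_bd F hμ hμ1.le w a m α β t U hm0 (hU t ht)).trans (by linarith))
  simp only [zero_smul, add_zero, zero_mul] at key
  have hden : HasDerivAt (fun h : ℝ => m + h * β) β 0 := by
    have := ((hasDerivAt_id (0:ℝ)).mul_const β).const_add m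
    simpa using this
  have := key.div hden (by simpa using hmpos.ne')
  refine this.congr_deriv ?_
  simp only [zero_smul, add_zero, zero_mul]
  field_simp

lemma dm_Slip (D : Dom I bd) (W : Wt I Q Q1 Q2 ψ ψ1 ψ2 c0 K ε) (F : FB f f1 M) (hμ : 0 ≤ μ)
    (hμ1 : μ < 1) (hδ1 : 7 * M * μ ≤ c0/4) (hr : 0 ≤ r) (hr1 : r ≤ c0/(4*K))
    (hF : Fam I bd Q ψ f μ w q p r) (X : Set ((Fin n → ℝ) × ℝ)) (B : ℝ)
    (hX : ∀ x ∈ X, |x.2 - 1| ≤ μ)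
    (hB : ∀ x ∈ X, ∀ y ∈ X, ∀ t ∈ I, |(x.2 - y.2) * t| ≤ B * |x.2 - y.2|) (hB0 : 0 ≤ B) :
    ContinuousOn (fun x : (Fin n → ℝ) × ℝ => dmS I f μ w q p x.1 x.2) X := by
  have hM := F.M1
  unfold dmS
  refine ContinuousOn.div ?_ (by fun_prop) (fun x hx => by
    have := abs_le.1 (hX x hx); intro h; rw [h] at this; linarith)
  intro x hx
  have hlim : Tendsto (fun y : (Fin n → ℝ) × ℝ =>
      8 * M * |x.2 - y.2| + 4 * M * (‖x.1 - y.1‖ + B * |x.2 - y.2| * ‖w‖)) (𝓝[X] x) (𝓝 0) := by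
    have : Continuous (fun y : (Fin n → ℝ) × ℝ =>
      8 * M * |x.2 - y.2| + 4 * M * (‖x.1 - y.1‖ + B * |x.2 - y.2| * ‖w‖)) := by fun_prop
    have h := (this.tendsto x).mono_left (nhdsWithin_le_nhds (s := X))
    simpa using h
  have hlim2 := ((hlim.mul_const (K + r)).mul_const K).add
    ((((hlim.const_mul (50 * K^2/c0^2)).pow 2).const_mul 3).mul_const (K^2))
  simp only [zero_mul, mul_zero, add_zero, ne_eq, OfNat.ofNat_ne_zero, not_false_eq_true,
    zero_pow] at hlim2
  refine tendsto_iff_norm_sub_tendsto_zero.2 (squeeze_zero' (Eventually.of_forall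
    (fun _ => norm_nonneg _)) ?_ hlim2)
  filter_upwards [self_mem_nhdsWithin] with y hy
  exact dm_lip D W (hF _ _ (hX x hx)) (hF _ _ (hX y hy)) hr hr1 (show 0 ≤ 7 * M * μ by positivity)
    hδ1 (fun t _ => dm_cf_bd F hμ hμ1.le w _ _ t (hX x hx))
    (fun t _ => dm_cf_bd F hμ hμ1.le w _ _ t (hX y hy)) (dm_cf_cont F w _ _) (dm_cf_cont F w _ _)
    (by positivity) (fun t ht => dm_cf_lip F hμ hμ1.le w _ _ _ _ t B (hX x hx) (hX y hy)
      (hB x hx y hy t ht))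
end
end DmPart8

section DmPart9
open Set Topology

section
variable {n : ℕ} {f : (Fin n → ℝ) → ℝ} {f1 : (Fin n → ℝ) → (Fin n → ℝ) →L[ℝ] ℝ} {M μ : ℝ}
variable {I bd : Set ℝ} {Q Q1 Q2 ψ ψ1 ψ2 : ℝ → ℝ} {c0 K ε r L : ℝ}
  {w : Fin n → ℝ} {q p : (Fin n → ℝ) → ℝ → ℝ → ℝ}

/-- momentum increment of a segment -/
noncomputable def dmG (I : Set ℝ) (f1 : (Fin n → ℝ) → (Fin n → ℝ) →L[ℝ] ℝ) (μ : ℝ) (w : Fin n → ℝ)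
    (q : (Fin n → ℝ) → ℝ → ℝ → ℝ) (a : Fin n → ℝ) (m : ℝ) (v : Fin n → ℝ) : ℝ :=
  -(m * μ * ∫ t in I, f1 (a + (m * t) • w) v * (1 - Real.cos (q a m t)))

lemma dm_Sv (D : Dom I bd) (W : Wt I Q Q1 Q2 ψ ψ1 ψ2 c0 K ε) (F : FB f f1 M) (hμ : 0 ≤ μ)
    (hμ1 : μ < 1) (hδ1 : 7 * M * μ ≤ c0/4) (hr : 0 ≤ r) (hr1 : r ≤ c0/(4*K))
    (hF : Fam I bd Q ψ f μ w q p r) (a : Fin n → ℝ) (m : ℝ) (hm : |m - 1| ≤ μ) (v : Fin n → ℝ) :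
    HasDerivAt (fun h : ℝ => dmS I f μ w q p (a + h • v) m) (dmG I f1 μ w q a m v) 0 := by
  have hmpos : 0 < m := by have := abs_le.1 hm; linarith
  have := dm_Sderiv D W F hμ hμ1 hδ1 hr hr1 hF a m v 0 ‖v‖ (by simpa using hm) (by simp)
    (norm_nonneg _)
  simp only [mul_zero, add_zero] at this
  refine this.congr_deriv ?_
  unfold dmG cfd
  have e : ∀ t, (2 * m * 0 * (1 - μ * f (a + (m * t) • w)) -
      m^2 * μ * f1 (a + (m * t) • w) (v + ((0:ℝ) * t) • w)) * (1 - Real.cos (q a m t)) =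
      -(m^2 * μ) * (f1 (a + (m * t) • w) v * (1 - Real.cos (q a m t))) := fun t => by
    rw [zero_mul, zero_smul, add_zero]; ring
  simp_rw [e]
  rw [integral_const_mul]
  field_simp
  ring

lemma dm_Smid (W : Wt (Icc 0 L) Q Q1 Q2 ψ ψ1 ψ2 c0 K ε) (F : FB f f1 M) (hμ : 0 ≤ μ)
    (hμ1 : μ < 1) (hδ1 : 7 * M * μ ≤ c0/4) (hr : 0 ≤ r) (hr1 : r ≤ c0/(4*K)) (hL : 2 ≤ L)
    (hF : Fam (Icc 0 L) {0, L} Q ψ f μ w q p r) (a : Fin n → ℝ) (m x β : ℝ)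
    (hm : ∀ᶠ h in 𝓝 (0:ℝ), |m + h * β - 1| ≤ μ) :
    HasDerivAt (fun h : ℝ => dmS (Icc 0 L) f μ w q p (a + h • (x • w)) (m + h * β))
      ((x * (dmH (cf f μ w a m) (q a m) (p a m) 0 - dmH (cf f μ w a m) (q a m) (p a m) L) -
        β * L * dmH (cf f μ w a m) (q a m) (p a m) L)/m^2) 0 := by
  have hm0 : |m - 1| ≤ μ := by simpa using hm.self_of_nhds
  have hmpos : 0 < m := by have := abs_le.1 hm0; linarith
  have hL0 : 0 ≤ L := by linarith
  have S := hF a m hm0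
  have := dm_Sderiv (dm_domIcc L hL) W F hμ hμ1 hδ1 hr hr1 hF a m (x • w) β
    (|x| * ‖w‖ + |β| * L * ‖w‖) hm (fun t ht => by
      refine (norm_add_le _ _).trans ?_
      rw [norm_smul, norm_smul, Real.norm_eq_abs, Real.norm_eq_abs, abs_mul, abs_of_nonneg ht.1]
      have := ht.2
      gcongr) (by positivity)
  refine this.congr_deriv ?_
  set c1 : ℝ → ℝ := fun t => -(m^3 * μ * f1 (a + (m * t) • w) w) with hc1d
  have hc1 : Continuous c1 := by
    have := dm_f1_cont F w a m (fun _ => w) continuous_const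
    exact (continuous_const.mul this).neg
  have hcd : ∀ t, HasDerivAt (cf f μ w a m) (c1 t) t := fun t => dm_cf_dt F w a m t
  have E1 := dm_E1 hL0 S hcd hc1
  have E2 := dm_E2 hL0 S hcd hc1
  have cq := S.contq
  have cc := dm_cf_cont (μ := μ) F w a m
  have hKc : IsCompact (Icc 0 L) := isCompact_Icc
  have i1 : IntegrableOn (fun t => (2 * β/m) * (cf f μ w a m t * (1 - Real.cos (q a m t)))) (Icc 0 L) :=
    ContinuousOn.integrableOn_compact hKc (by fun_prop)
  have i2 : IntegrableOn (fun t => (x/m) * (c1 t * (1 - Real.cos (q a m t)))) (Icc 0 L) :=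
    ContinuousOn.integrableOn_compact hKc (by fun_prop)
  have i3 : IntegrableOn (fun t => (β/m) * (t * c1 t * (1 - Real.cos (q a m t)))) (Icc 0 L) :=
    ContinuousOn.integrableOn_compact hKc (by fun_prop)
  have e : ∫ t in Icc 0 L, cfd f f1 μ w a m (x • w) β t * (1 - Real.cos (q a m t)) =
      (2 * β/m) * (∫ t in Icc 0 L, cf f μ w a m t * (1 - Real.cos (q a m t))) +
      (x/m) * (∫ t in Icc 0 L, c1 t * (1 - Real.cos (q a m t))) +
      (β/m) * (∫ t in Icc 0 L, t * c1 t * (1 - Real.cos (q a m t))) := by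
    rw [← integral_const_mul, ← integral_const_mul, ← integral_const_mul, ← integral_add i1 i2]
    have a1 := integral_add (i1.add i2) i3
    simp only [Pi.add_apply] at a1
    rw [← a1]
    congr 1; ext t
    unfold cfd cf
    rw [hc1d, ← add_smul, map_smul, smul_eq_mul]
    field_simp
    ring
  rw [e, E1]
  have : dmJ (Icc 0 L) (cf f μ w a m) (q a m) (p a m) =
    2 * (∫ t in Icc 0 L, cf f μ w a m t * (1 - Real.cos (q a m t))) +
      (∫ t in Icc 0 L, t * c1 t * (1 - Real.cos (q a m t))) +
      L * dmH (cf f μ w a m) (q a m) (p a m) L := by linarith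
  rw [this]
  field_simp
  ring

/-- `dmG` in the direction of `w`, mid segment -/
lemma dm_Gmid (F : FB f f1 M) (hμ : 0 ≤ μ) (hμ1 : μ < 1) (hL : 0 ≤ L)
    (hF : Fam (Icc 0 L) bd Q ψ f μ w q p r) (a : Fin n → ℝ) (m : ℝ) (hm : |m - 1| ≤ μ) :
    dmG (Icc 0 L) f1 μ w q a m w =
      (dmH (cf f μ w a m) (q a m) (p a m) 0 - dmH (cf f μ w a m) (q a m) (p a m) L)/m^2 := by
  have hmpos : 0 < m := by have := abs_le.1 hm; linarith
  have hc1 : Continuous (fun t => -(m^3 * μ * f1 (a + (m * t) • w) w)) :=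
    (continuous_const.mul (dm_f1_cont F w a m (fun _ => w) continuous_const)).neg
  have E1 := dm_E1 hL (hF a m hm) (fun t => dm_cf_dt F w a m t) hc1
  rw [← E1]
  have e : ∀ t, -(m^3 * μ * f1 (a + (m * t) • w) w) * (1 - Real.cos (q a m t)) =
    -(m^3 * μ) * (f1 (a + (m * t) • w) w * (1 - Real.cos (q a m t))) := fun t => by ring
  simp_rw [e]
  rw [integral_const_mul]
  unfold dmG
  field_simp

lemma dm_Ghalf (F : FB f f1 M) (hμ : 0 ≤ μ) (hδ1 : 7 * M * μ ≤ 1) (hr : 0 ≤ r)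
    (hF : Fam (Ici 0) {0} (fun t => -dmA t) dmP f μ w q p r) (a : Fin n → ℝ) :
    dmG (Ici 0) f1 μ w q a 1 w = dmH (cf f μ w a 1) (q a 1) (p a 1) 0 := by
  have hM := F.M1
  have hμ1 : μ ≤ 1 := by nlinarith
  have hm : |(1:ℝ) - 1| ≤ μ := by simpa using hμ
  have hc1 : Continuous (fun t : ℝ => -((1:ℝ)^3 * μ * f1 (a + (1 * t) • w) w)) :=
    (continuous_const.mul (dm_f1_cont F w a 1 (fun _ => w) continuous_const)).neg
  have E := dm_E3 (hF a 1 hm) hr (show 0 ≤ 7 * M * μ by positivity)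
    (fun t _ => dm_cf_bd F hμ hμ1 w a 1 t hm) hδ1
    (fun t => dm_cf_dt F w a 1 t) hc1 (B := μ * (M * ‖w‖)) (by positivity) (fun t => by
      rw [abs_neg, one_pow, one_mul, abs_mul, abs_of_nonneg hμ]
      have := F.b1 (a + (1 * t) • w) w
      gcongr)
  rw [← E]
  have e : ∀ t : ℝ, -((1:ℝ)^3 * μ * f1 (a + (1 * t) • w) w) * (1 - Real.cos (q a 1 t)) =
    -(1 * μ) * (f1 (a + (1 * t) • w) w * (1 - Real.cos (q a 1 t))) := fun t => by ring
  simp_rw [e]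
  rw [integral_const_mul]
  unfold dmG
  ring

lemma dmG_lin (D : Dom I bd) (W : Wt I Q Q1 Q2 ψ ψ1 ψ2 c0 K ε) (F : FB f f1 M)
    (hr : 0 ≤ r) (hF : Fam I bd Q ψ f μ w q p r) (a : Fin n → ℝ) (m : ℝ) (hm : |m - 1| ≤ μ)
    (x y : ℝ) (u v : Fin n → ℝ) :
    dmG I f1 μ w q a m (x • u + y • v) = x * dmG I f1 μ w q a m u + y * dmG I f1 μ w q a m v := by
  have hM := F.M1
  have i : ∀ v : Fin n → ℝ, IntegrableOn
      (fun t => f1 (a + (m * t) • w) v * (1 - Real.cos (q a m t))) I := fun v =>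
    ((hF a m hm).cint D W hr _ (M * ‖v‖) (dm_f1_cont F w a m (fun _ => v)
      continuous_const).continuousOn (by positivity) (fun t _ => F.b1 _ _)).1
  have : ∫ t in I, f1 (a + (m * t) • w) (x • u + y • v) * (1 - Real.cos (q a m t)) =
      x * (∫ t in I, f1 (a + (m * t) • w) u * (1 - Real.cos (q a m t))) +
      y * (∫ t in I, f1 (a + (m * t) • w) v * (1 - Real.cos (q a m t))) := by
    rw [← integral_const_mul, ← integral_const_mul, ← integral_add ((i u).const_mul x)
      ((i v).const_mul y)]
    congr 1; ext t
    rw [map_add, map_smul, map_smul, smul_eq_mul, smul_eq_mul]; ring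
  unfold dmG
  rw [this]; ring
end
end DmPart9

section DmPart10
open Set Topology

section
variable {n : ℕ} {f : (Fin n → ℝ) → ℝ} {f1 : (Fin n → ℝ) → (Fin n → ℝ) →L[ℝ] ℝ} {M μ : ℝ}

/-- half Melnikov primitive -/
noncomputable def gm (f : (Fin n → ℝ) → ℝ) (w a : Fin n → ℝ) : ℝ :=
  ∫ t in Ici (0:ℝ), f (a + t • w) * (1 - Real.cos (dmA t))

lemma dmA_cosb (t : ℝ) (ht : 0 ≤ t) : |1 - Real.cos (dmA t)| ≤ 8 * Real.exp (-t/2) ∧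
    t * |1 - Real.cos (dmA t)| ≤ 8 * Real.exp (-t/2) ∧
    ∀ L ≤ t, |1 - Real.cos (dmA t)| ≤ 8 * (Real.exp (-L/2) * Real.exp (-t/2)) := by
  obtain ⟨-, -, h1, h2, -⟩ := dmA_facts t ht
  have e : Real.exp (-t)^2 = Real.exp (-t) * Real.exp (-t) := by ring
  have h3 : Real.exp (-t) ≤ 1 := Real.exp_le_one_iff.2 (by linarith)
  have h4 : Real.exp (-t) ≤ Real.exp (-t/2) := Real.exp_le_exp.2 (by linarith)
  have h5 := Real.exp_pos (-t)
  rw [abs_of_nonneg h1]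
  refine ⟨by nlinarith, ?_, fun L hL => ?_⟩
  · have h6 : t * Real.exp (-t) ≤ 1 := by
      rw [Real.exp_neg, ← div_eq_mul_inv, div_le_one (Real.exp_pos _)]
      linarith [Real.add_one_le_exp t]
    have h7 : t * (1 - Real.cos (dmA t)) ≤ t * (8 * Real.exp (-t)^2) :=
      mul_le_mul_of_nonneg_left h2 ht
    rw [e] at h7
    nlinarith
  · have h6 : Real.exp (-t) * Real.exp (-t) ≤ Real.exp (-L/2) * Real.exp (-t/2) := by
      rw [← Real.exp_add, ← Real.exp_add]; exact Real.exp_le_exp.2 (by linarith)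
    rw [e] at h2
    linarith

lemma dmA_cosc : Continuous (fun t => 1 - Real.cos (dmA t)) :=
  continuous_const.sub (Real.continuous_cos.comp dmA_cont)

lemma gm_int (F : FB f f1 M) (w a : Fin n → ℝ) (m : ℝ) :
    IntegrableOn (fun t => f (a + (m * t) • w) * (1 - Real.cos (dmA t))) (Ici 0) := by
  have hM := F.M1
  have hc : Continuous (fun t : ℝ => f (a + (m * t) • w) * (1 - Real.cos (dmA t))) :=
    (F.cont.comp (by fun_prop)).mul dmA_cosc
  refine (dm_expint.1.const_mul (8 * M)).mono' hc.aestronglyMeasurable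
    ((ae_restrict_iff' measurableSet_Ici).2 (ae_of_all _ fun t ht => ?_))
  rw [Real.norm_eq_abs, abs_mul]
  have h1 := (dmA_cosb t ht).1
  have h2 := F.b0 (a + (m * t) • w)
  have := mul_le_mul h2 h1 (abs_nonneg _) (by linarith)
  linarith

lemma gm_trunc (F : FB f f1 M) (w b : Fin n → ℝ) (m L ν : ℝ) (hν : |m - 1| ≤ ν) :
    |(∫ t in Icc 0 L, f (b + (m * t) • w) * (1 - Real.cos (dmA t))) - gm f w b| ≤
      16 * M * (ν * ‖w‖ + Real.exp (-L/2)) := by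
  have hM := F.M1
  have hν0 : 0 ≤ ν := (abs_nonneg _).trans hν
  have hs : Ici (0:ℝ) ∩ Icc 0 L = Icc 0 L := inter_eq_right.2 Icc_subset_Ici_self
  have e1 : ∫ t in Icc 0 L, f (b + (m * t) • w) * (1 - Real.cos (dmA t)) =
      ∫ t in Ici (0:ℝ), (Icc 0 L).indicator
        (fun t => f (b + (m * t) • w) * (1 - Real.cos (dmA t))) t := by
    rw [setIntegral_indicator measurableSet_Icc, hs]
  have i1 : IntegrableOn ((Icc 0 L).indicator
        (fun t => f (b + (m * t) • w) * (1 - Real.cos (dmA t)))) (Ici 0) :=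
    (gm_int F w b m).indicator measurableSet_Icc
  have i2 := gm_int F w b 1
  simp only [one_mul] at i2
  unfold gm
  rw [e1, ← integral_sub i1 i2]
  have := norm_integral_le_of_norm_le (μ := volume.restrict (Ici 0))
    (f := fun t => (Icc 0 L).indicator
        (fun t => f (b + (m * t) • w) * (1 - Real.cos (dmA t))) t -
        f (b + t • w) * (1 - Real.cos (dmA t)))
    (dm_expint.1.const_mul (8 * M * (ν * ‖w‖ + Real.exp (-L/2))))
    ((ae_restrict_iff' measurableSet_Ici).2 (ae_of_all _ fun t ht => ?_))
  · rw [integral_const_mul, dm_expint.2] at this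
    rw [← Real.norm_eq_abs]
    linarith
  · have ht0 : 0 ≤ t := ht
    obtain ⟨h1, h2, h3⟩ := dmA_cosb t ht0
    have hE := Real.exp_pos (-t/2)
    have hEL := Real.exp_pos (-L/2)
    rw [Real.norm_eq_abs]
    by_cases htL : t ∈ Icc 0 L
    · rw [indicator_of_mem htL, ← sub_mul, abs_mul]
      have h4 := F.lip (b + (m * t) • w) (b + t • w)
      have e : b + (m * t) • w - (b + t • w) = ((m - 1) * t) • w := by
        rw [sub_mul, sub_smul, one_mul]; abel
      rw [e, norm_smul, Real.norm_eq_abs, abs_mul, abs_of_nonneg ht0] at h4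
      have h5 : |f (b + (m * t) • w) - f (b + t • w)| ≤ M * (ν * t * ‖w‖) := h4.trans (by gcongr)
      calc _ ≤ M * (ν * t * ‖w‖) * |1 - Real.cos (dmA t)| := by gcongr
        _ = M * (ν * ‖w‖) * (t * |1 - Real.cos (dmA t)|) := by ring
        _ ≤ M * (ν * ‖w‖) * (8 * Real.exp (-t/2)) := by gcongr
        _ ≤ _ := by
          have : 0 ≤ 8 * M * Real.exp (-L/2) * Real.exp (-t/2) := by positivity
          linarith
    · have hLt : L ≤ t := by
        by_contra hcon
        exact htL ⟨ht0, by linarith⟩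
      rw [indicator_of_notMem htL, zero_sub, abs_neg, abs_mul]
      have h4 := F.b0 (b + t • w)
      calc _ ≤ M * (8 * (Real.exp (-L/2) * Real.exp (-t/2))) := by
            have := h3 L hLt; gcongr
        _ ≤ _ := by
          have : 0 ≤ 8 * M * (ν * ‖w‖) * Real.exp (-t/2) := by positivity
          linarith

lemma dm_reflint (L : ℝ) (hL : 0 ≤ L) (g : ℝ → ℝ) :
    ∫ t in Icc 0 L, g (L - t) = ∫ t in Icc 0 L, g t := by
  rw [integral_Icc_eq_integral_Ioc, integral_Icc_eq_integral_Ioc,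
    ← intervalIntegral.integral_of_le hL, ← intervalIntegral.integral_of_le hL,
    intervalIntegral.integral_comp_sub_left]
  simp

/-- interaction estimate for the approximate solution -/
lemma gm_mid (F : FB f f1 M) (w a : Fin n → ℝ) (m L ν : ℝ) (hν : |m - 1| ≤ ν) (hL : 2 ≤ L)
    (hg : Real.exp (-L/2) ≤ 1/200) :
    |(∫ t in Icc 0 L, f (a + (m * t) • w) * (1 - Real.cos (dmQ L t))) -
      gm f w a - gm f (-w) (a + (m * L) • w)| ≤
      32 * M * (ν * ‖w‖ + 85 * Real.exp (-L/2)) := by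
  have hM := F.M1
  have hL0 : 0 ≤ L := by linarith
  have W := dm_WtIcc L hL hg
  have cQ : Continuous (dmQ L) := continuous_iff_continuousAt.2 (fun t => (W.dQ t).continuousAt)
  have cf0 : Continuous (fun t : ℝ => f (a + (m * t) • w)) := F.cont.comp (by fun_prop)
  have cA := dmA_cosc
  have cA2 : Continuous (fun t => 1 - Real.cos (dmA (L - t))) :=
    dmA_cosc.comp (continuous_const.sub continuous_id)
  have hKc : IsCompact (Icc 0 L) := isCompact_Icc
  have i0 : IntegrableOn (fun t => f (a + (m * t) • w) * (1 - Real.cos (dmQ L t))) (Icc 0 L) :=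
    (cf0.mul (continuous_const.sub
      (Real.continuous_cos.comp cQ))).continuousOn.integrableOn_compact hKc
  have i1 : IntegrableOn (fun t => f (a + (m * t) • w) * (1 - Real.cos (dmA t))) (Icc 0 L) :=
    (cf0.mul cA).continuousOn.integrableOn_compact hKc
  have i2 : IntegrableOn (fun t => f (a + (m * t) • w) * (1 - Real.cos (dmA (L - t)))) (Icc 0 L) :=
    (cf0.mul cA2).continuousOn.integrableOn_compact hKc
  have h1 := gm_trunc F w a m L ν hν
  have h2 := gm_trunc F (-w) (a + (m * L) • w) m L ν hν
  rw [norm_neg] at h2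
  have e2 : ∫ t in Icc 0 L, f (a + (m * L) • w + (m * t) • (-w)) * (1 - Real.cos (dmA t)) =
      ∫ t in Icc 0 L, f (a + (m * t) • w) * (1 - Real.cos (dmA (L - t))) := by
    rw [← dm_reflint L hL0]
    congr 1; ext t
    congr 2
    rw [mul_sub, sub_smul, smul_neg, smul_neg]; abel
  rw [e2] at h2
  have h3 := dm_intb (dm_domIcc L hL) W (fun t => f (a + (m * t) • w) * (1 - Real.cos (dmQ L t)) -
    f (a + (m * t) • w) * (1 - Real.cos (dmA t)) -
    f (a + (m * t) • w) * (1 - Real.cos (dmA (L - t)))) (M * (84 * Real.exp (-L/2))) (by positivity) (by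
    intro t ht
    have X := dm_midF L t hL ht
    have ht2 : 0 ≤ L - t := by linarith [ht.2]
    obtain ⟨s1, s2, c1, c2, -⟩ := dmA_facts t ht.1
    obtain ⟨s1', s2', c1', c2', -⟩ := dmA_facts (L - t) ht2
    have hgp := Real.exp_pos (-L/2)
    set g := Real.exp (-L/2)
    have lin := X.lin
    have hcl := Real.abs_cos_sub_cos_le (-dmA t + dmA (L - t) - dmA L * (1 - 2 * t / L))
      (-dmA t + dmA (L - t))
    have e5 : -dmA t + dmA (L - t) - dmA L * (1 - 2 * t / L) - (-dmA t + dmA (L - t)) =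
      -(dmA L * (1 - 2 * t / L)) := by ring
    rw [e5, abs_neg] at hcl
    have hcl2 := hcl.trans lin
    have ss : Real.sin (dmA t) * Real.sin (dmA (L - t)) ≤ 16 * g^2 := by
      rw [← X.xx]
      have := mul_le_mul s2 s2' s1' (by positivity)
      linarith
    have cc : (1 - Real.cos (dmA t)) * (1 - Real.cos (dmA (L - t))) ≤ 64 * g^2 := by
      have h := mul_le_mul c2 c2' c1' (by positivity)
      have e : 8 * Real.exp (-t)^2 * (8 * Real.exp (-(L-t))^2) = 64 * (g^2)^2 := by
        rw [← X.xx]; ring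
      rw [e] at h
      have : g^2 ≤ 1 := by nlinarith
      nlinarith [sq_nonneg g]
    have ss0 := mul_nonneg s1 s1'
    have cc0 := mul_nonneg c1 c1'
    have hb : |(1 - Real.cos (dmQ L t)) - (1 - Real.cos (dmA t)) - (1 - Real.cos (dmA (L-t)))| ≤
        84 * g^2 := by
      have ec : Real.cos (-dmA t + dmA (L - t)) =
        Real.cos (dmA t) * Real.cos (dmA (L-t)) + Real.sin (dmA t) * Real.sin (dmA (L-t)) := by
        rw [Real.cos_add, Real.cos_neg, Real.sin_neg]; ring
      rw [ec] at hcl2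
      unfold dmQ
      have := abs_le.1 hcl2
      rw [abs_le]; constructor <;> nlinarith
    have hb2 : |(1 - Real.cos (dmQ L t)) - (1 - Real.cos (dmA t)) - (1 - Real.cos (dmA (L-t)))| ≤
        84 * g * dmPm L t := by
      refine hb.trans ?_
      have h7 : g * g ≤ g * dmPm L t := mul_le_mul_of_nonneg_left X.psi hgp.le
      nlinarith
    have e6 : f (a + (m * t) • w) * (1 - Real.cos (dmQ L t)) -
      f (a + (m * t) • w) * (1 - Real.cos (dmA t)) -
      f (a + (m * t) • w) * (1 - Real.cos (dmA (L - t))) = f (a + (m * t) • w) *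
      ((1 - Real.cos (dmQ L t)) - (1 - Real.cos (dmA t)) - (1 - Real.cos (dmA (L-t)))) := by ring
    rw [e6, abs_mul, mul_assoc]
    exact mul_le_mul (F.b0 _) hb2 (abs_nonneg _) (by linarith))
  have e3 := integral_sub (i0.sub i1) i2
  simp only [Pi.sub_apply] at e3
  rw [e3, integral_sub i0 i1] at h3
  set X0 := ∫ t in Icc 0 L, f (a + (m * t) • w) * (1 - Real.cos (dmQ L t))
  set X1 := ∫ t in Icc 0 L, f (a + (m * t) • w) * (1 - Real.cos (dmA t))
  set X2 := ∫ t in Icc 0 L, f (a + (m * t) • w) * (1 - Real.cos (dmA (L - t)))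
  have b1 := abs_le.1 h1
  have b2 := abs_le.1 h2
  have b3 := abs_le.1 h3
  rw [abs_le]; constructor <;> linarith
end
end DmPart10

section DmPart11
open Set Topology

section
variable {I bd : Set ℝ} {Q Q1 Q2 ψ ψ1 ψ2 : ℝ → ℝ} {c0 K ε : ℝ}

lemma Wt.q1sq (W : Wt I Q Q1 Q2 ψ ψ1 ψ2 c0 K ε) {t : ℝ} (ht : t ∈ I) :
    |Q1 t^2/2| ≤ K^3 * ψ t := by
  have h1 := W.Q1le t ht
  have h2 := W.le t ht
  have h3 := W.pos t ht
  have hK := W.K1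
  rw [abs_of_nonneg (by positivity), ← sq_abs]
  have h4 : |Q1 t|^2 ≤ (K * ψ t)^2 := pow_le_pow_left₀ (abs_nonneg _) h1 2
  have h5 : (K * ψ t)^2 ≤ K^3 * ψ t := by
    have := mul_le_mul_of_nonneg_left h2 (show 0 ≤ K * K * ψ t by positivity)
    nlinarith
  have : 0 ≤ K^3 * ψ t := by positivity
  linarith

lemma Wt.cosb (W : Wt I Q Q1 Q2 ψ ψ1 ψ2 c0 K ε) {t : ℝ} (ht : t ∈ I) :
    |1 - Real.cos (Q t)| ≤ K * ψ t := by
  rw [abs_of_nonneg (sub_nonneg.2 (Real.cos_le_one _))]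
  exact W.cosQ t ht

lemma dm_Jsplit (D : Dom I bd) (W : Wt I Q Q1 Q2 ψ ψ1 ψ2 c0 K ε) (c : ℝ → ℝ) (B : ℝ)
    (hc : Continuous c) (hB : ∀ t ∈ I, |c t - 1| ≤ B) (hB0 : 0 ≤ B) :
    dmJ I c Q Q1 = dmJ I (fun _ => 1) Q Q1 + ∫ t in I, (c t - 1) * (1 - Real.cos (Q t)) := by
  have cQ : Continuous Q := continuous_iff_continuousAt.2 (fun t => (W.dQ t).continuousAt)
  have cQ1 : Continuous Q1 := continuous_iff_continuousAt.2 (fun t => (W.dQ1 t).continuousAt)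
  have i1 : IntegrableOn (fun t => Q1 t^2/2 + 1 * (1 - Real.cos (Q t))) I := by
    refine dm_intg D W _ (K^3 + K) (by fun_prop) (fun t ht => ?_)
    have := abs_add_le (Q1 t^2/2) (1 * (1 - Real.cos (Q t)))
    have h1 := W.q1sq ht
    have h2 := W.cosb ht
    rw [one_mul] at this ⊢
    linarith
  have i2 : IntegrableOn (fun t => (c t - 1) * (1 - Real.cos (Q t))) I := by
    refine dm_intg D W _ (B * K) (by fun_prop) (fun t ht => ?_)
    rw [abs_mul, mul_assoc]
    exact mul_le_mul (hB t ht) (W.cosb ht) (abs_nonneg _) hB0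
  unfold dmJ
  rw [← integral_add i1 i2]
  congr 1; ext t; ring

lemma dm_ebd (D : Dom I bd) (W : Wt I Q Q1 Q2 ψ ψ1 ψ2 c0 K ε) :
    |dmJ I (fun _ => 1) Q Q1| ≤ 2 * K^4 := by
  have hK := W.K1
  have := dm_intb D W (fun t => Q1 t^2/2 + 1 * (1 - Real.cos (Q t))) (K^3 + K) (by positivity)
    (fun t ht => by
      have := abs_add_le (Q1 t^2/2) (1 * (1 - Real.cos (Q t)))
      have h1 := W.q1sq ht
      have h2 := W.cosb ht
      rw [one_mul] at this ⊢
      linarith)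
  refine this.trans ?_
  have h2 : K^2 ≤ K^4 := pow_le_pow_right₀ hK (by norm_num)
  nlinarith
end

section
variable {n : ℕ} {f : (Fin n → ℝ) → ℝ} {f1 : (Fin n → ℝ) → (Fin n → ℝ) →L[ℝ] ℝ} {M μ : ℝ}
  {w : Fin n → ℝ} {q p : (Fin n → ℝ) → ℝ → ℝ → ℝ}

lemma dm_rsmall {M μ ε : ℝ} (hM : 1 ≤ M) (hμ : 0 ≤ μ) (hs : M * μ ≤ 1/10^9) (hε : ε ≤ μ) :
    6 * (ε + 7 * M * μ * 32)/(1/8)^2 ≤ (1/8)/(4*32) ∧ 7 * M * μ ≤ (1/8)/4 ∧ μ < 1 := by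
  have : μ ≤ M * μ := by nlinarith
  refine ⟨?_, ?_, ?_⟩
  · rw [div_le_div_iff₀ (by norm_num) (by norm_num)]; nlinarith
  · linarith
  · linarith

lemma dm_valhalf (F : FB f f1 M) (hμ : 0 ≤ μ) (hs : M * μ ≤ 1/10^9)
    (hF : Fam (Ici 0) {0} (fun t => -dmA t) dmP f μ w q p (6 * (0 + 7 * M * μ * 32)/(1/8)^2))
    (a : Fin n → ℝ) :
    |dmS (Ici 0) f μ w q p a 1 - (dmJ (Ici 0) (fun _ => 1) (fun t => -dmA t) (fun t => -dmA1 t) -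
      μ * gm f w a)| ≤ 10^18 * M^2 * μ^2 := by
  have hM := F.M1
  obtain ⟨s1, s2, s3⟩ := dm_rsmall hM hμ hs hμ
  have hm : |(1:ℝ) - 1| ≤ μ := by simpa using hμ
  have hcb : ∀ t ∈ Ici (0:ℝ), |cf f μ w a 1 t - 1| ≤ 7 * M * μ :=
    fun t _ => dm_cf_bd F hμ s3.le w a 1 t hm
  have V := dm_val dm_domIci dm_WtIci (hF a 1 hm) s1 (by positivity) s2 hcb (dm_cf_cont F w a 1)
  have J := dm_Jsplit dm_domIci dm_WtIci (cf f μ w a 1) (7 * M * μ) (dm_cf_cont F w a 1) hcb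
    (by positivity)
  have e : ∫ t in Ici (0:ℝ), (cf f μ w a 1 t - 1) * (1 - Real.cos (-dmA t)) = -μ * gm f w a := by
    unfold gm
    rw [← integral_const_mul]
    congr 1; ext t
    unfold cf
    rw [Real.cos_neg, one_mul]; ring
  rw [e] at J
  rw [J] at V
  unfold dmS
  rw [div_one]
  have e2 : dmJ (Ici 0) (fun _ => 1) (fun t => -dmA t) (fun t => -dmA1 t) - μ * gm f w a =
    dmJ (Ici 0) (fun _ => 1) (fun t => -dmA t) (fun t => -dmA1 t) + -μ * gm f w a := by ring
  rw [e2]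
  refine V.trans ?_
  have h : 0 ≤ M^2 * μ^2 := by positivity
  nlinarith

lemma dm_arith (M μ ν g W z1 z2 z3 z4 z5 : ℝ) (hM : 1 ≤ M) (hμ : 0 ≤ μ) (hν0 : 0 ≤ ν) (hν : ν ≤ μ)
    (hgp : 0 < g) (hgν : 200 * g ≤ ν) (hW : 0 ≤ W)
    (b1 : z1 ≤ (1200 * 32^6/(1/8)^4 * (7 * M * μ + 200 * g)^2) * 2)
    (b2 : z2 ≤ (2 * 32^4) * (ν * 2)) (b3 : z3 ≤ (ν * (3 * 2)) * (32 * 32))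
    (b4 : z4 ≤ ν * (1 * (M * 32 * 32))) (b5 : z5 ≤ 1 * (32 * M * (ν * W + 85 * g))) :
    z1 + (z2 + (z3 + (z4 + z5))) ≤ 10^18 * M^2 * (1 + W) * (μ^2 + ν) := by
  have c1 : (7 * M * μ + 200 * g)^2 ≤ 64 * (M^2 * μ^2) := by
    have h1 : 1 * μ ≤ M * μ := mul_le_mul_of_nonneg_right hM hμ
    have : 7 * M * μ + 200 * g ≤ 8 * (M * μ) := by linarith
    calc _ ≤ (8 * (M * μ))^2 := pow_le_pow_left₀ (by positivity) this 2
      _ = _ := by ring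
  have hM2 : M ≤ M^2 := by nlinarith
  have hM3 : 1 ≤ M^2 := by linarith
  have u1 : 1 * ν ≤ M^2 * ν := mul_le_mul_of_nonneg_right hM3 hν0
  have u2 : M * ν ≤ M^2 * ν := mul_le_mul_of_nonneg_right hM2 hν0
  have u3 : M * (ν * W) ≤ M^2 * (ν * W) := mul_le_mul_of_nonneg_right hM2 (by positivity)
  have u4 : M * g ≤ M * ν := mul_le_mul_of_nonneg_left (by linarith) (by linarith)
  have u5 : 0 ≤ M^2 * μ^2 * W := by positivity
  have u6 : 0 ≤ M^2 * (ν * W) := by positivity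
  have u7 : 0 ≤ M^2 * ν := by positivity
  have u8 : 0 ≤ M^2 * μ^2 := by positivity
  have fin : (10:ℝ)^18 * M^2 * (1 + W) * (μ^2 + ν) = 10^18 * (M^2 * μ^2) + 10^18 * (M^2 * ν) +
    10^18 * (M^2 * μ^2 * W) + 10^18 * (M^2 * (ν * W)) := by ring
  rw [fin]
  linarith

set_option maxHeartbeats 1000000 in
lemma dm_valmid (F : FB f f1 M) (hμ : 0 ≤ μ) (hs : M * μ ≤ 1/10^9) (L : ℝ) (hL : 2 ≤ L) (ν : ℝ)
    (hg : Real.exp (-L/2) ≤ 1/200) (hν : ν ≤ μ) (hgν : 200 * Real.exp (-L/2) ≤ ν)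
    (hF : Fam (Icc 0 L) {0, L} (dmQ L) (dmPm L) f μ w q p
      (6 * (200 * Real.exp (-L/2) + 7 * M * μ * 32)/(1/8)^2))
    (a : Fin n → ℝ) (m : ℝ) (hm : |m - 1| ≤ ν) :
    |dmS (Icc 0 L) f μ w q p a m - (dmJ (Icc 0 L) (fun _ => 1) (dmQ L) (dmQ1 L) -
      μ * gm f w a - μ * gm f (-w) (a + (m * L) • w))| ≤ 10^18 * M^2 * (1 + ‖w‖) * (μ^2 + ν) := by
  have hM := F.M1
  have hgp := Real.exp_pos (-L/2)
  set g := Real.exp (-L/2) with hgd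
  have hν0 : 0 ≤ ν := by linarith
  obtain ⟨s1, s2, s3⟩ := dm_rsmall hM hμ hs (hgν.trans hν)
  have hmμ := hm.trans hν
  have W := dm_WtIcc L hL hg
  have D := dm_domIcc L hL
  have hcb : ∀ t ∈ Icc 0 L, |cf f μ w a m t - 1| ≤ 7 * M * μ :=
    fun t _ => dm_cf_bd F hμ s3.le w a m t hmμ
  have V := dm_val D W (hF a m hmμ) s1 (by positivity) s2 hcb (dm_cf_cont F w a m)
  have J := dm_Jsplit D W (cf f μ w a m) (7 * M * μ) (dm_cf_cont F w a m) hcb (by positivity)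
  have E := dm_ebd D W
  have G := gm_mid F w a m L ν hm hL hg
  have cQ : Continuous (dmQ L) := continuous_iff_continuousAt.2 (fun t => (W.dQ t).continuousAt)
  have cf0 : Continuous (fun t : ℝ => f (a + (m * t) • w)) := F.cont.comp (by fun_prop)
  have cX : Continuous (fun t => f (a + (m * t) • w) * (1 - Real.cos (dmQ L t))) :=
    cf0.mul (continuous_const.sub (Real.continuous_cos.comp cQ))
  have i1 : IntegrableOn (fun t => (m^2 - 1) * (1 - Real.cos (dmQ L t))) (Icc 0 L) :=
    ContinuousOn.integrableOn_compact isCompact_Icc (by fun_prop)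
  have i2 : IntegrableOn (fun t => (m^2 * μ) * (f (a + (m * t) • w) * (1 - Real.cos (dmQ L t))))
      (Icc 0 L) := (continuous_const.mul cX).continuousOn.integrableOn_compact isCompact_Icc
  have hX : |∫ t in Icc 0 L, f (a + (m * t) • w) * (1 - Real.cos (dmQ L t))| ≤ M * 32 * 32 :=
    dm_intb D W _ (M * 32) (by positivity) (fun t ht => by
      rw [abs_mul, mul_assoc]
      exact mul_le_mul (F.b0 _) (W.cosb ht) (abs_nonneg _) (by linarith))
  have hB : |∫ t in Icc 0 L, (1 - Real.cos (dmQ L t))| ≤ 32 * 32 :=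
    dm_intb D W _ 32 (by norm_num) (fun t ht => W.cosb ht)
  have e : ∫ t in Icc 0 L, (cf f μ w a m t - 1) * (1 - Real.cos (dmQ L t)) =
      (m^2 - 1) * (∫ t in Icc 0 L, (1 - Real.cos (dmQ L t))) -
      (m^2 * μ) * ∫ t in Icc 0 L, f (a + (m * t) • w) * (1 - Real.cos (dmQ L t)) := by
    rw [← integral_const_mul, ← integral_const_mul, ← integral_sub i1 i2]
    congr 1; ext t
    unfold cf; ring
  rw [e] at J
  set X := ∫ t in Icc 0 L, f (a + (m * t) • w) * (1 - Real.cos (dmQ L t))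
  set B := ∫ t in Icc 0 L, (1 - Real.cos (dmQ L t))
  set e0 := dmJ (Icc 0 L) (fun _ => 1) (dmQ L) (dmQ1 L)
  set J0 := dmJ (Icc 0 L) (cf f μ w a m) (dmQ L) (dmQ1 L)
  set g1 := gm f w a
  set g2 := gm f (-w) (a + (m * L) • w)
  unfold dmS
  set J1 := dmJ (Icc 0 L) (cf f μ w a m) (q a m) (p a m)
  have hmb := abs_le.1 hm
  have hm1 : 1/2 ≤ m := by have : μ ≤ M * μ := by nlinarith
                           linarith
  have hm2 : m ≤ 2 := by linarith
  have hmp : 0 < m := by linarith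
  have hinv : |1/m| ≤ 2 := by
    rw [abs_of_pos (by positivity), div_le_iff₀ hmp]; linarith
  have hmu : μ ≤ 1 := s3.le
  have id : J1/m - (e0 - μ * g1 - μ * g2) = (J1 - J0) * (1/m) + (-(e0 * ((m - 1) * (1/m))) +
      (((m - 1) * ((m + 1) * (1/m))) * B + (-((m - 1) * (μ * X)) + -(μ * (X - g1 - g2))) )) := by
    rw [J]; field_simp; ring
  have b1 : |(J1 - J0) * (1/m)| ≤ (1200 * 32^6/(1/8)^4 * (7 * M * μ + 200 * g)^2) * 2 := by
    rw [abs_mul]; gcongr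
  have b2 : |e0 * ((m - 1) * (1/m))| ≤ (2 * 32^4) * (ν * 2) := by
    rw [abs_mul, abs_mul]; gcongr
  have b3 : |((m - 1) * ((m + 1) * (1/m))) * B| ≤ (ν * (3 * 2)) * (32 * 32) := by
    have : |m + 1| ≤ 3 := by rw [abs_of_pos (by linarith)]; linarith
    rw [abs_mul, abs_mul, abs_mul]; gcongr
  have b4 : |(m - 1) * (μ * X)| ≤ ν * (1 * (M * 32 * 32)) := by
    rw [abs_mul, abs_mul, abs_of_nonneg hμ]; gcongr
  have b5 : |μ * (X - g1 - g2)| ≤ 1 * (32 * M * (ν * ‖w‖ + 85 * g)) := by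
    rw [abs_mul, abs_of_nonneg hμ]; gcongr
  have t1 := abs_add_le ((J1 - J0) * (1/m)) (-(e0 * ((m - 1) * (1/m))) +
      (((m - 1) * ((m + 1) * (1/m))) * B + (-((m - 1) * (μ * X)) + -(μ * (X - g1 - g2))) ))
  have t2 := abs_add_le (-(e0 * ((m - 1) * (1/m))))
      (((m - 1) * ((m + 1) * (1/m))) * B + (-((m - 1) * (μ * X)) + -(μ * (X - g1 - g2))) )
  have t3 := abs_add_le (((m - 1) * ((m + 1) * (1/m))) * B) (-((m - 1) * (μ * X)) + -(μ * (X - g1 - g2)))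
  have t4 := abs_add_le (-((m - 1) * (μ * X))) (-(μ * (X - g1 - g2)))
  rw [abs_neg] at t2 t4
  rw [abs_neg] at t4
  rw [id]
  have := dm_arith M μ ν g ‖w‖ _ _ _ _ _ hM hμ hν0 hν hgp hgν (norm_nonneg w) b1 b2 b3 b4 b5
  linarith
end
end DmPart11

section DmPart12
open Set Topology

section
variable {n : ℕ} {f : (Fin n → ℝ) → ℝ} {f1 : (Fin n → ℝ) → (Fin n → ℝ) →L[ℝ] ℝ} {M μ : ℝ}

lemma dm_perbd (g : (Fin n → ℝ) → ℝ) (hg : Continuous g)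
    (hper : ∀ (k : Fin n → ℤ) (x : Fin n → ℝ), g (x + fun i => 2 * Real.pi * (k i : ℝ)) = g x) :
    ∃ B, ∀ x, |g x| ≤ B := by
  have hc : IsCompact (Icc (fun _ : Fin n => (0:ℝ)) (fun _ => 2 * Real.pi)) := isCompact_Icc
  obtain ⟨B, hB⟩ := hc.exists_bound_of_continuousOn hg.continuousOn
  refine ⟨B, fun x => ?_⟩
  have hp : (0:ℝ) < 2 * Real.pi := by positivity
  rw [← hper (fun i => -⌊x i / (2 * Real.pi)⌋) x]
  refine hB _ ⟨fun i => ?_, fun i => ?_⟩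
  · have := Int.floor_le (x i / (2 * Real.pi))
    rw [le_div_iff₀ hp] at this
    simp only [Pi.add_apply]; push_cast; linarith
  · have := (Int.lt_floor_add_one (x i / (2 * Real.pi))).le
    rw [div_le_iff₀ hp] at this
    simp only [Pi.add_apply]; push_cast; linarith

lemma dm_FB (hf : ContDiff ℝ (⊤ : ℕ∞) f)
    (hper : ∀ (k : Fin n → ℤ) (x : Fin n → ℝ), f (x + fun i => 2 * Real.pi * (k i : ℝ)) = f x) :
    ∃ M, FB f (fderiv ℝ f) M := by
  have hd : Differentiable ℝ f := hf.differentiable (by simp)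
  have h1 : ContDiff ℝ 1 (fderiv ℝ f) := hf.fderiv_right (m := 1) (by norm_cast)
  have hd1 : Differentiable ℝ (fderiv ℝ f) := h1.differentiable (by simp)
  have h2 : Continuous (fderiv ℝ (fderiv ℝ f)) := h1.continuous_fderiv (by simp)
  have h2n : Continuous (fun x => ‖fderiv ℝ (fderiv ℝ f) x‖) := by
    have := continuous_norm (E := (Fin n → ℝ) →L[ℝ] (Fin n → ℝ) →L[ℝ] ℝ)
    exact this.comp h2
  have p1 : ∀ (k : Fin n → ℤ) (x : Fin n → ℝ),
      fderiv ℝ f (x + fun i => 2 * Real.pi * (k i : ℝ)) = fderiv ℝ f x := by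
    intro k x
    rw [← fderiv_comp_add_right]
    congr 1; ext y; exact hper k y
  have p2 : ∀ (k : Fin n → ℤ) (x : Fin n → ℝ),
      fderiv ℝ (fderiv ℝ f) (x + fun i => 2 * Real.pi * (k i : ℝ)) = fderiv ℝ (fderiv ℝ f) x := by
    intro k x
    rw [← fderiv_comp_add_right]
    congr 1; ext1 y; exact p1 k y
  obtain ⟨B0, b0⟩ := dm_perbd f hf.continuous hper
  obtain ⟨B1, b1⟩ := dm_perbd (fun x => ‖fderiv ℝ f x‖) h1.continuous.norm (fun k x => by rw [p1])
  obtain ⟨B2, b2⟩ := dm_perbd (fun x => ‖fderiv ℝ (fderiv ℝ f) x‖) h2n (fun k x => by rw [p2])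
  have z2 := (abs_nonneg _).trans (b2 0)
  replace b1 := fun x => (le_abs_self _).trans (b1 x)
  replace b2 := fun x => (le_abs_self _).trans (b2 x)
  have z0 := (abs_nonneg _).trans (b0 0)
  have z1 := (norm_nonneg _).trans (b1 0)
  have l1 : ∀ x y, ‖f x - f y‖ ≤ B1 * ‖x - y‖ := fun x y =>
    Convex.norm_image_sub_le_of_norm_fderiv_le (𝕜 := ℝ) (s := univ) (fun z _ => hd z) (fun z _ => b1 z)
      convex_univ (mem_univ y) (mem_univ x)
  have l2 : ∀ x y, ‖fderiv ℝ f x - fderiv ℝ f y‖ ≤ B2 * ‖x - y‖ := fun x y =>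
    Convex.norm_image_sub_le_of_norm_fderiv_le (𝕜 := ℝ) (s := univ) (fun z _ => hd1 z)
      (fun z _ => b2 z) convex_univ (mem_univ y) (mem_univ x)
  refine ⟨1 + B0 + B1 + B2, fun x => (hd x).hasFDerivAt, h1.continuous, fun x => by linarith [b0 x],
    fun x v => ?_, fun x y => ?_, fun x y => ?_, by linarith⟩
  · refine ((fderiv ℝ f x).le_opNorm v).trans ?_
    refine mul_le_mul_of_nonneg_right (by linarith [b1 x]) (norm_nonneg _)
  · refine (l1 x y).trans (mul_le_mul_of_nonneg_right (by linarith) (norm_nonneg _))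
  · have hy := norm_nonneg y
    have := Convex.norm_image_sub_le_of_norm_hasFDerivWithin_le' (𝕜 := ℝ)
      (f := f) (f' := fderiv ℝ f) (φ := fderiv ℝ f x) (C := B2 * ‖y‖)
      (s := Metric.closedBall x ‖y‖) (x := x) (y := x + y)
      (fun z _ => (hd z).hasFDerivAt.hasFDerivWithinAt)
      (fun z hz => (l2 z x).trans (mul_le_mul_of_nonneg_left (mem_closedBall_iff_norm.1 hz) z2))
      (convex_closedBall _ _) (Metric.mem_closedBall_self hy)
      (mem_closedBall_iff_norm.2 (by simp))
    simp only [add_sub_cancel_left] at this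
    refine (this.trans (le_of_eq (by ring : _ = B2 * ‖y‖^2))).trans
      (mul_le_mul_of_nonneg_right (by linarith) (by positivity))

lemma q0_cos (t : ℝ) : Real.cos (q0 t) = Real.cos (dmA t) ∧ Real.cos (q0 (-t)) = Real.cos (dmA t) := by
  have e : q0 (-t) = dmA t := rfl
  refine ⟨?_, by rw [e]⟩
  have h := Real.arctan_inv_of_pos (Real.exp_pos t)
  rw [← Real.exp_neg] at h
  have : q0 t = 2 * Real.pi - dmA t := by unfold q0 dmA; rw [h]; ring
  rw [this, Real.cos_two_pi_sub]

lemma dm_mel (F : FB f f1 M) (ω A : Fin n → ℝ) :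
    Melnikov n ω f A = gm f ω A + gm f (-ω) A := by
  have i1 := gm_int F ω A 1
  have i2 := gm_int F (-ω) A 1
  simp only [one_mul] at i1 i2
  set g : ℝ → ℝ := fun t => (1 - Real.cos (q0 t)) * f (fun i => ω i * t + A i)
  have e1 : ∀ t, g t = f (A + t • ω) * (1 - Real.cos (dmA t)) := by
    intro t
    have : (fun i => ω i * t + A i) = A + t • ω := by
      ext i; simp [smul_eq_mul]; ring
    simp only [g]; rw [this, (q0_cos t).1]; ring
  have e2 : ∀ t, g (-t) = f (A + t • (-ω)) * (1 - Real.cos (dmA t)) := by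
    intro t
    have : (fun i => ω i * (-t) + A i) = A + t • (-ω) := by
      ext i; simp [smul_eq_mul]; ring
    simp only [g]; rw [this, (q0_cos t).2]; ring
  have j1 : IntegrableOn g (Ioi 0) := by
    refine (i1.mono_set Ioi_subset_Ici_self).congr_fun (fun t _ => (e1 t).symm) measurableSet_Ioi
  have j2 : IntegrableOn (fun t => g (-t)) (Ioi 0) := by
    refine (i2.mono_set Ioi_subset_Ici_self).congr_fun (fun t _ => (e2 t).symm) measurableSet_Ioi
  have j3 : IntegrableOn g (Iic 0) := by
    have := (integrableOn_Ici_iff_integrableOn_Ioi (b := (0:ℝ)) (f := fun t => g (-t)) (μ := volume)).2 j2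
    have h := (Measure.measurePreserving_neg (volume : Measure ℝ)).integrableOn_comp_preimage
      (MeasurableEquiv.neg ℝ).measurableEmbedding (f := g) (s := Iic 0)
    refine h.1 ?_
    simpa [Function.comp_def] using this
  unfold Melnikov gm
  change ∫ t, g t = _
  rw [← intervalIntegral.integral_Iic_add_Ioi j3 j1, add_comm]
  congr 1
  · rw [integral_Ici_eq_integral_Ioi]
    exact setIntegral_congr_fun measurableSet_Ioi (fun t _ => e1 t)
  · rw [integral_Ici_eq_integral_Ioi]
    have := integral_comp_neg_Ioi (0:ℝ) g
    rw [neg_zero] at this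
    rw [← this]
    exact setIntegral_congr_fun measurableSet_Ioi (fun t _ => e2 t)

lemma gm_lip (F : FB f f1 M) (w a b : Fin n → ℝ) :
    |gm f w a - gm f w b| ≤ 16 * M * ‖a - b‖ := by
  have hM := F.M1
  have i1 := gm_int F w a 1
  have i2 := gm_int F w b 1
  simp only [one_mul] at i1 i2
  unfold gm
  rw [← integral_sub i1 i2]
  obtain ⟨ie, he⟩ : IntegrableOn (fun t : ℝ => Real.exp (-t/2)) (Ici 0) ∧
      ∫ t in Ici (0:ℝ), Real.exp (-t/2) = 2 := dm_expint
  have := norm_integral_le_of_norm_le (μ := volume.restrict (Ici (0:ℝ)))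
    (f := fun t => f (a + t • w) * (1 - Real.cos (dmA t)) - f (b + t • w) * (1 - Real.cos (dmA t)))
    (ie.const_mul (8 * M * ‖a - b‖)) ?_
  · refine this.trans (le_of_eq ?_)
    rw [integral_const_mul, he]; ring
  · refine (ae_restrict_iff' measurableSet_Ici).2 (ae_of_all _ fun t ht => ?_)
    rw [← sub_mul, Real.norm_eq_abs, abs_mul]
    have h1 := F.lip (a + t • w) (b + t • w)
    rw [add_sub_add_right_eq_sub] at h1
    have h2 := (dmA_cosb t ht).1
    calc _ ≤ (M * ‖a - b‖) * (8 * Real.exp (-t/2)) :=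
          mul_le_mul h1 h2 (abs_nonneg _) (by positivity)
      _ = _ := by ring

lemma gm_per (hper : ∀ (k : Fin n → ℤ) (x : Fin n → ℝ), f (x + fun i => 2 * Real.pi * (k i : ℝ)) = f x)
    (w a : Fin n → ℝ) (k : Fin n → ℤ) : gm f w (a + fun i => 2 * Real.pi * (k i : ℝ)) = gm f w a := by
  unfold gm
  congr 1; ext t
  rw [add_right_comm, hper]

lemma dm_quad (G : (Fin n → ℝ) → ℝ) (hG : Continuous G) (hn : 0 < n) (A : Fin n → ℝ)
    (hcrit : fderiv ℝ G A = 0)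
    (hnondeg : ∀ v : Fin n → ℝ, v ≠ 0 → 0 < iteratedFDeriv ℝ 2 G A ![v, v]) :
    ∃ c > 0, ∃ r > 0, ∀ v : Fin n → ℝ, ‖v‖ ≤ r → G A + c * ‖v‖^2 ≤ G (A + v) := by
  have : Nonempty (Fin n) := ⟨⟨0, hn⟩⟩
  simp only [iteratedFDeriv_two_apply, Matrix.cons_val_zero, Matrix.cons_val_one] at hnondeg
  set H := fderiv ℝ (fderiv ℝ G) A with hH
  have hd : DifferentiableAt ℝ (fderiv ℝ G) A := by
    by_contra h
    have h0 : H = 0 := fderiv_zero_of_not_differentiableAt h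
    have := hnondeg (fun _ => 1) (by
      intro h; have := congrFun h ⟨0, hn⟩; simp at this)
    rw [h0] at this; simp at this
  have hc : IsCompact (Metric.sphere (0 : Fin n → ℝ) 1) := isCompact_sphere _ _
  obtain ⟨v0, hv0, hmin⟩ := hc.exists_isMinOn (NormedSpace.sphere_nonempty.2 zero_le_one)
    (f := fun v => H v v) (by fun_prop)
  have hv0n : v0 ≠ 0 := by
    rintro rfl; simp at hv0
  set c := H v0 v0 with hcd
  have hcp : 0 < c := hnondeg v0 hv0n
  have hquad : ∀ v, c * ‖v‖^2 ≤ H v v := by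
    intro v
    by_cases hv : v = 0
    · simp [hv]
    have hvn : 0 < ‖v‖ := norm_pos_iff.2 hv
    have := hmin (show (‖v‖⁻¹ • v) ∈ Metric.sphere (0 : Fin n → ℝ) 1 by
      simp [norm_smul, hvn.ne'])
    simp only [mem_ofPred_eq, map_smul, _root_.smul_apply, smul_eq_mul] at this
    rw [← hcd] at this
    have h3 : ‖v‖⁻¹ * (‖v‖⁻¹ * (H v v)) * ‖v‖^2 = H v v := by field_simp
    nlinarith [mul_le_mul_of_nonneg_right this (sq_nonneg ‖v‖)]
  have hlit := hd.hasFDerivAt.isLittleO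
  rw [Asymptotics.isLittleO_iff] at hlit
  obtain ⟨r, hr, hball⟩ := Metric.eventually_nhds_iff.1 (hlit (show 0 < c/2 by positivity))
  refine ⟨c/4, by positivity, r/2, by positivity, fun v hv => ?_⟩
  have key : ∀ t ∈ Ioo (0:ℝ) 1, c/2 * t * ‖v‖^2 ≤ fderiv ℝ G (A + t • v) v := by
    intro t ht
    have h1 := hball (y := A + t • v) (by
      rw [dist_eq_norm, add_sub_cancel_left, norm_smul, Real.norm_of_nonneg ht.1.le]
      nlinarith [ht.2, norm_nonneg v])
    rw [hcrit, sub_zero, add_sub_cancel_left] at h1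
    have h2 := (ContinuousLinearMap.le_opNorm (fderiv ℝ G (A + t • v) - (fderiv ℝ (fderiv ℝ G) A) (t • v)) v).trans
      (mul_le_mul_of_nonneg_right h1 (norm_nonneg v))
    rw [norm_smul, Real.norm_of_nonneg ht.1.le] at h2
    have h3 := (abs_le.1 h2).1
    simp only [_root_.sub_apply, map_smul, _root_.smul_apply, smul_eq_mul,
      ← hH] at h3
    have h4 := mul_le_mul_of_nonneg_left (hquad v) ht.1.le
    nlinarith
  by_cases hv0 : v = 0
  · simp [hv0]
  have hvn : 0 < ‖v‖ := norm_pos_iff.2 hv0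
  have hdt : ∀ t ∈ Ioo (0:ℝ) 1, HasDerivAt (fun t : ℝ => G (A + t • v) - c/4 * ‖v‖^2 * t^2)
      (fderiv ℝ G (A + t • v) v - c/4 * ‖v‖^2 * (2 * t)) t := by
    intro t ht
    have hk := key t ht
    have hdiff : DifferentiableAt ℝ G (A + t • v) := by
      by_contra h
      rw [fderiv_zero_of_not_differentiableAt h] at hk
      have : 0 < c/2 * t * ‖v‖^2 := by have := ht.1; positivity
      simp at hk; linarith
    have h1 : HasDerivAt (fun t : ℝ => A + t • v) v t := by
      simpa using ((hasDerivAt_id t).smul_const v).const_add A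
    have h2 := hdiff.hasFDerivAt.comp_hasDerivAt t h1
    have h3 := (hasDerivAt_pow 2 t).const_mul (c/4 * ‖v‖^2)
    refine (h2.sub h3).congr_deriv (by norm_num)
  have hmono : MonotoneOn (fun t : ℝ => G (A + t • v) - c/4 * ‖v‖^2 * t^2) (Icc 0 1) := by
    refine monotoneOn_of_deriv_nonneg (convex_Icc 0 1) ?_ ?_ ?_
    · exact ((hG.comp (by fun_prop)).sub (by fun_prop)).continuousOn
    · rw [interior_Icc]; exact fun t ht => (hdt t ht).differentiableAt.differentiableWithinAt
    · rw [interior_Icc]; intro t ht; rw [(hdt t ht).deriv]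
      have := key t ht
      linarith
  have := hmono (left_mem_Icc.2 zero_le_one) (right_mem_Icc.2 zero_le_one) zero_le_one
  simp at this
  linarith
end
end DmPart12

section DmPart13
open Set Topology

section
variable {n : ℕ}

lemma dm_rec1 (ω : Fin n → ℝ) (ε T0 : ℝ) (hε : 0 < ε) :
    ∃ t ≥ T0, ∃ k : Fin n → ℤ, ‖t • ω - fun i => 2 * Real.pi * (k i : ℝ)‖ ≤ ε := by
  wlog hT : 0 ≤ T0 generalizing T0
  · obtain ⟨t, h1, h2⟩ := this 0 le_rfl
    exact ⟨t, by linarith, h2⟩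
  have hc : IsCompact (Icc (fun _ : Fin n => (0:ℝ)) (fun _ => 2 * Real.pi)) := isCompact_Icc
  have hp : (0:ℝ) < 2 * Real.pi := by positivity
  let y : ℕ → Fin n → ℝ := fun j => ((j * T0 : ℝ) • ω) -
    fun i => 2 * Real.pi * (⌊(j * T0 : ℝ) * ω i / (2 * Real.pi)⌋ : ℝ)
  have hy : ∀ j, y j ∈ Icc (fun _ : Fin n => (0:ℝ)) (fun _ => 2 * Real.pi) := by
    intro j
    refine ⟨fun i => ?_, fun i => ?_⟩
    · have := Int.floor_le ((j * T0 : ℝ) * ω i / (2 * Real.pi))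
      rw [le_div_iff₀ hp] at this
      simp only [y, Pi.sub_apply, Pi.smul_apply, smul_eq_mul]; linarith
    · have := (Int.lt_floor_add_one ((j * T0 : ℝ) * ω i / (2 * Real.pi))).le
      rw [div_le_iff₀ hp] at this
      simp only [y, Pi.sub_apply, Pi.smul_apply, smul_eq_mul]; linarith
  obtain ⟨z, -, g, hg, hlim⟩ := hc.tendsto_subseq hy
  obtain ⟨N, hN⟩ := Metric.cauchySeq_iff'.1 hlim.cauchySeq ε hε
  have h1 := hN (N + 1) (by omega)
  have hlt : g N < g (N + 1) := hg (by omega)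
  refine ⟨((g (N+1) : ℝ) - g N) * T0, ?_, fun i => ⌊(g (N+1) * T0 : ℝ) * ω i / (2 * Real.pi)⌋ -
    ⌊(g N * T0 : ℝ) * ω i / (2 * Real.pi)⌋, ?_⟩
  · have : (g N : ℝ) + 1 ≤ g (N + 1) := by exact_mod_cast hlt
    nlinarith
  · rw [dist_eq_norm] at h1
    refine le_of_eq_of_le ?_ h1.le
    congr 1; ext i
    simp only [y, Function.comp_apply, Pi.sub_apply, Pi.smul_apply, smul_eq_mul]
    push_cast; ring

lemma dm_rec (ω : Fin n → ℝ) (ε L : ℝ) (hε : 0 < ε) :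
    ∃ T : ℕ → ℝ, (∀ i, L ≤ T (i + 1) - T i) ∧
      ∀ i, ∃ k : Fin n → ℤ, ‖T i • ω - fun i => 2 * Real.pi * (k i : ℝ)‖ ≤ ε := by
  choose t ht hk using fun T0 => dm_rec1 ω ε T0 hε
  let T : ℕ → ℝ := fun i => Nat.rec (t 0) (fun _ x => t (x + L)) i
  refine ⟨T, fun i => ?_, fun i => ?_⟩
  · have := ht (T i + L)
    change L ≤ t (T i + L) - T i
    linarith
  · cases i with
    | zero => exact hk 0
    | succ i => exact hk (T i + L)

lemma dm_perp (ω v : Fin n → ℝ) (x : ℝ) (h : ∑ i, ω i * v i = 0) :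
    ‖v‖^2 ≤ n * ‖v + x • ω‖^2 := by
  have h1 : ‖v‖^2 ≤ ∑ i, (v i)^2 := by
    by_cases hn : Nonempty (Fin n)
    · obtain ⟨i, hi⟩ : ∃ i, ‖v‖ = ‖v i‖ := by
        obtain ⟨i, -, hi⟩ := Finset.exists_mem_eq_sup (Finset.univ : Finset (Fin n))
          Finset.univ_nonempty (fun i => ‖v i‖₊)
        exact ⟨i, by rw [Pi.norm_def, hi]; rfl⟩
      rw [hi, Real.norm_eq_abs, sq_abs]
      exact Finset.single_le_sum (f := fun i => (v i)^2) (fun i _ => sq_nonneg _) (Finset.mem_univ i)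
    · have : v = 0 := by ext i; exact absurd ⟨i⟩ hn
      simp [this]
  have h2 : ∑ i, (v i + x * ω i)^2 ≤ ∑ _i : Fin n, ‖v + x • ω‖^2 := by
    refine Finset.sum_le_sum (fun i _ => ?_)
    have := norm_le_pi_norm (v + x • ω) i
    rw [Real.norm_eq_abs] at this
    simp only [Pi.add_apply, Pi.smul_apply, smul_eq_mul] at this
    rw [← sq_abs]
    exact pow_le_pow_left₀ (abs_nonneg _) this 2
  have h3 : ∑ i, (v i + x * ω i)^2 = ∑ i, (v i)^2 + x^2 * ∑ i, (ω i)^2 := by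
    have : ∀ i, (v i + x * ω i)^2 = (v i)^2 + (2 * x) * (ω i * v i) + x^2 * (ω i)^2 := fun i => by ring
    simp only [this, Finset.sum_add_distrib, ← Finset.mul_sum, h]; ring
  have h4 : 0 ≤ x^2 * ∑ i, (ω i)^2 := mul_nonneg (sq_nonneg _) (Finset.sum_nonneg fun i _ => sq_nonneg _)
  simp at h2
  linarith

/-- total reduced action -/
noncomputable def dmF (V : ℕ → (Fin n → ℝ) → ℝ → ℝ → ℝ) (k : ℕ) (Δ A : Fin n → ℝ) (S : ℕ → ℝ) : ℝ :=
  ∑ j ∈ Finset.range (k + 2), V j A (S j) (S (j + 1)) - ∑ i, Δ i * A i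

lemma dmF_update (V : ℕ → (Fin n → ℝ) → ℝ → ℝ → ℝ) (k : ℕ) (Δ A : Fin n → ℝ) (S : ℕ → ℝ) (j : ℕ)
    (hj : j ≤ k) (x : ℝ) :
    dmF V k Δ A (Function.update S (j + 1) x) - dmF V k Δ A S =
      (V j A (S j) x + V (j + 1) A x (S (j + 2))) -
        (V j A (S j) (S (j + 1)) + V (j + 1) A (S (j + 1)) (S (j + 2))) := by
  unfold dmF
  rw [sub_sub_sub_cancel_right, ← Finset.sum_sub_distrib]
  rw [Finset.sum_eq_add (a := j) (b := j + 1) (by omega)]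
  · simp only [Function.update_self]
    rw [Function.update_of_ne (by omega), Function.update_of_ne (by omega)]
    ring
  · intro i _ hi
    rw [Function.update_of_ne (by omega), Function.update_of_ne (by omega)]
    ring
  · intro h; exact absurd (Finset.mem_range.2 (by omega)) h
  · intro h; exact absurd (Finset.mem_range.2 (by omega)) h

lemma dm_max (k : ℕ) (ω As : Fin n → ℝ) (Gp Gm : (Fin n → ℝ) → ℝ)
    (V : ℕ → (Fin n → ℝ) → ℝ → ℝ → ℝ) (e : ℕ → ℝ) (σ ρ κ μ c : ℝ) (Δ : Fin n → ℝ)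
    (hσ : 0 < σ) (hρ : 0 < ρ) (hμ : 0 < μ)
    (hV : ∀ j ≤ k + 1, ContinuousOn (fun x : (Fin n → ℝ) × ℝ × ℝ => V j x.1 x.2.1 x.2.2)
      {x | |x.2.1| ≤ σ ∧ |x.2.2| ≤ σ})
    (happ : ∀ j ≤ k + 1, ∀ A x y, |x| ≤ σ → |y| ≤ σ →
      |V j A x y - (e j - μ * (if j = 0 then 0 else Gp (A + x • ω)) -
        μ * (if j = k + 1 then 0 else Gm (A + y • ω)))| ≤ κ * μ)
    (hs : ∀ A x, ‖A - As‖ ≤ ρ → ∑ i, ω i * (A - As) i = 0 → |x| = σ →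
      Gp A + Gm A + 4 * κ < Gp (A + x • ω) + Gm (A + x • ω))
    (hA : ∀ A x, ‖A - As‖ = ρ → ∑ i, ω i * (A - As) i = 0 → |x| ≤ σ →
      Gp As + Gm As + c ≤ Gp (A + x • ω) + Gm (A + x • ω))
    (hk : 2 * (k + 2) * (κ * μ) + n * ‖Δ‖ * ρ < (k + 1) * (μ * c)) :
    ∃ (A : Fin n → ℝ) (S : ℕ → ℝ), (∀ j, |S j| ≤ σ) ∧ (∀ j ≤ k, |S (j + 1)| < σ) ∧
      (∀ j ≤ k, IsLocalMax (fun h : ℝ => V j A (S j) (S (j + 1) + h) +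
        V (j + 1) A (S (j + 1) + h) (S (j + 2))) 0) ∧
      ∀ v : Fin n → ℝ, ∑ i, ω i * v i = 0 →
        IsLocalMax (fun h : ℝ => dmF V k Δ (A + h • v) S) 0 := by
  classical
  let KA : Set (Fin n → ℝ) := Metric.closedBall As ρ ∩ {A | ∑ i, ω i * (A - As) i = 0}
  let KS : Set (ℕ → ℝ) := Set.pi univ (fun _ => Icc (-σ) σ)
  have hKA : IsCompact KA := (isCompact_closedBall As ρ).inter_right
    (isClosed_eq (by fun_prop) continuous_const)
  have hKS : IsCompact KS := isCompact_univ_pi (fun _ => isCompact_Icc)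
  have hKSm : ∀ S : ℕ → ℝ, S ∈ KS ↔ ∀ j, |S j| ≤ σ := by
    intro S; simp only [KS, mem_univ_pi, mem_Icc, abs_le]
  have hKAm : ∀ A, A ∈ KA ↔ ‖A - As‖ ≤ ρ ∧ ∑ i, ω i * (A - As) i = 0 := by
    intro A; simp only [KA, mem_inter_iff, mem_closedBall_iff_norm]; rfl
  have hA0 : As ∈ KA := by rw [hKAm]; simp [hρ.le]
  have hS0 : (fun _ => 0 : ℕ → ℝ) ∈ KS := by rw [hKSm]; simp [hσ.le]
  have hcont : ContinuousOn (fun x : (Fin n → ℝ) × (ℕ → ℝ) => dmF V k Δ x.1 x.2) (KA ×ˢ KS) := by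
    unfold dmF
    refine ContinuousOn.sub (continuousOn_finsetSum _ fun j hj => ?_) (by fun_prop)
    have hj' := Finset.mem_range.1 hj
    refine (hV j (by omega)).comp (f := fun x : (Fin n → ℝ) × (ℕ → ℝ) => (x.1, x.2 j, x.2 (j+1)))
      (by fun_prop) ?_
    rintro ⟨A, S⟩ ⟨-, h⟩
    exact ⟨(hKSm S).1 h j, (hKSm S).1 h (j+1)⟩
  obtain ⟨⟨A, S⟩, ⟨hAm, hSm⟩, hmax⟩ := (hKA.prod hKS).exists_isMaxOn ⟨(As, fun _ => 0), hA0, hS0⟩ hcont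
  have hmax' : ∀ A' S', A' ∈ KA → S' ∈ KS → dmF V k Δ A' S' ≤ dmF V k Δ A S :=
    fun A' S' h1 h2 => hmax (show (A', S') ∈ KA ×ˢ KS from ⟨h1, h2⟩)
  clear hmax
  obtain ⟨hA1, hA2⟩ := (hKAm A).1 hAm
  have hS1 := (hKSm S).1 hSm
  have hupd : ∀ j ≤ k, ∀ x, |x| ≤ σ → V j A (S j) x + V (j + 1) A x (S (j + 2)) ≤
      V j A (S j) (S (j + 1)) + V (j + 1) A (S (j + 1)) (S (j + 2)) := by
    intro j hj x hx
    have h1 := dmF_update V k Δ A S j hj x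
    have h2 := hmax' A (Function.update S (j + 1) x) hAm (by
      rw [hKSm]; intro i
      by_cases hi : i = j + 1
      · subst hi; rw [Function.update_self]; exact hx
      · rw [Function.update_of_ne hi]; exact hS1 i)
    linarith
  have hIntg : ∀ j ≤ k, |S (j + 1)| < σ := by
    intro j hj
    refine lt_of_le_of_ne (hS1 _) (fun hne => ?_)
    have h0 := hupd j hj 0 (by simpa using hσ.le)
    have h1 := hs A (S (j+1)) hA1 hA2 hne
    have a1 := abs_le.1 (happ j (by omega) A (S j) 0 (hS1 _) (by simpa using hσ.le))
    have a2 := abs_le.1 (happ (j+1) (by omega) A 0 (S (j+2)) (by simpa using hσ.le) (hS1 _))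
    have a3 := abs_le.1 (happ j (by omega) A (S j) (S (j+1)) (hS1 _) (hS1 _))
    have a4 := abs_le.1 (happ (j+1) (by omega) A (S (j+1)) (S (j+2)) (hS1 _) (hS1 _))
    have nj : j ≠ k + 1 := by omega
    simp only [nj, if_false, Nat.succ_ne_zero] at a1 a2 a3 a4
    rw [zero_smul, add_zero] at a1 a2
    have := mul_lt_mul_of_pos_left h1 hμ
    linarith [a1.1, a2.1, a3.2, a4.2]
  have hAint : ‖A - As‖ < ρ := by
    refine lt_of_le_of_ne hA1 (fun hne => ?_)
    have h0 := hmax' As (fun _ => 0) hA0 hS0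
    have key : ∀ (A' : Fin n → ℝ) (S' : ℕ → ℝ), (∀ j, |S' j| ≤ σ) →
        |∑ j ∈ Finset.range (k + 2), V j A' (S' j) (S' (j + 1)) -
          (∑ j ∈ Finset.range (k + 2), e j -
            μ * ∑ j ∈ Finset.range (k + 1), (Gp (A' + S' (j+1) • ω) + Gm (A' + S' (j+1) • ω)))|
          ≤ (k + 2) * (κ * μ) := by
      intro A' S' hS'
      have e1 : ∑ j ∈ Finset.range (k + 2), (if j = 0 then 0 else Gp (A' + S' j • ω)) =
          ∑ j ∈ Finset.range (k + 1), Gp (A' + S' (j+1) • ω) := by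
        rw [Finset.sum_range_succ']; simp
      have e2 : ∑ j ∈ Finset.range (k + 2), (if j = k + 1 then 0 else Gm (A' + S' (j+1) • ω)) =
          ∑ j ∈ Finset.range (k + 1), Gm (A' + S' (j+1) • ω) := by
        rw [Finset.sum_range_succ]
        simp only [if_true, add_zero]
        refine Finset.sum_congr rfl (fun j hj => ?_)
        have := Finset.mem_range.1 hj
        rw [if_neg (by omega)]
      have e3 : ∑ j ∈ Finset.range (k + 2), V j A' (S' j) (S' (j + 1)) -
          (∑ j ∈ Finset.range (k + 2), e j -
            μ * ∑ j ∈ Finset.range (k + 1), (Gp (A' + S' (j+1) • ω) + Gm (A' + S' (j+1) • ω))) =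
          ∑ j ∈ Finset.range (k + 2), (V j A' (S' j) (S' (j + 1)) -
            (e j - μ * (if j = 0 then 0 else Gp (A' + S' j • ω)) -
              μ * (if j = k + 1 then 0 else Gm (A' + S' (j+1) • ω)))) := by
        rw [Finset.sum_sub_distrib, Finset.sum_sub_distrib, Finset.sum_sub_distrib,
          ← Finset.mul_sum, ← Finset.mul_sum, e1, e2, Finset.sum_add_distrib]
        ring
      rw [e3]
      refine (Finset.abs_sum_le_sum_abs _ _).trans ?_
      refine (Finset.sum_le_sum (fun j hj => happ j
        (by have := Finset.mem_range.1 hj; omega) A' _ _ (hS' _) (hS' _))).trans ?_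
      simp
    have k1 := abs_le.1 (key As (fun _ => 0) (by simpa using hσ.le))
    have k2 := abs_le.1 (key A S hS1)
    simp only [zero_smul, add_zero, Finset.sum_const, Finset.card_range, nsmul_eq_mul] at k1
    push_cast at k1
    have k3 : (k + 1 : ℝ) * (Gp As + Gm As + c) ≤
        ∑ j ∈ Finset.range (k + 1), (Gp (A + S (j+1) • ω) + Gm (A + S (j+1) • ω)) := by
      have := Finset.sum_le_sum (s := Finset.range (k + 1)) (fun j _ => hA A (S (j+1)) hne hA2 (hS1 _))
      simp at this
      linarith
    have k4 := mul_le_mul_of_nonneg_left k3 hμ.le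
    have k5 : |∑ i, Δ i * A i - ∑ i, Δ i * As i| ≤ n * ‖Δ‖ * ρ := by
      rw [← Finset.sum_sub_distrib]
      refine (Finset.abs_sum_le_sum_abs _ _).trans ?_
      have : ∀ i ∈ (Finset.univ : Finset (Fin n)), |Δ i * A i - Δ i * As i| ≤ ‖Δ‖ * ρ := by
        intro i _
        rw [← mul_sub, abs_mul]
        refine mul_le_mul (norm_le_pi_norm Δ i) ?_ (abs_nonneg _) (norm_nonneg _)
        exact (norm_le_pi_norm (A - As) i).trans hA1
      refine (Finset.sum_le_sum this).trans (le_of_eq ?_)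
      simp; ring
    have k6 := abs_le.1 k5
    unfold dmF at h0
    simp only at h0
    nlinarith [k1.1, k2.2, k6.1]
  refine ⟨A, S, hS1, hIntg, fun j hj => ?_, fun v hv => ?_⟩
  · have hev : ∀ᶠ h in 𝓝 (0:ℝ), |S (j + 1) + h| < σ := by
      have hc : ContinuousAt (fun h : ℝ => |S (j+1) + h|) 0 := by fun_prop
      refine hc.eventually (gt_mem_nhds ?_)
      simpa using hIntg j hj
    filter_upwards [hev] with h hh
    have := hupd j hj (S (j+1) + h) hh.le
    simpa using this
  · have hev : ∀ᶠ h in 𝓝 (0:ℝ), ‖A + h • v - As‖ < ρ := by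
      have hc : ContinuousAt (fun h : ℝ => ‖A + h • v - As‖) 0 := by fun_prop
      refine hc.eventually (gt_mem_nhds ?_)
      simpa using hAint
    filter_upwards [hev] with h hh
    have : A + h • v ∈ KA := by
      rw [hKAm]
      refine ⟨hh.le, ?_⟩
      have e : ∀ i, ω i * (A + h • v - As) i = ω i * (A - As) i + h * (ω i * v i) := fun i => by
        simp only [Pi.sub_apply, Pi.add_apply, Pi.smul_apply, smul_eq_mul]; ring
      simp only [e, Finset.sum_add_distrib, ← Finset.mul_sum, hv, hA2]; ring
    have := hmax' _ S this hSm
    simpa using this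
end
end DmPart13

section DmPart14
open Set Topology

section
variable {E : Type*} [NormedAddCommGroup E] [NormedSpace ℝ E]

lemma dm_glue (G : ℝ → E → E) (x y : ℝ → E) (θ : ℝ) (J : Set ℝ) (hθ : θ ∈ J)
    (hx : ∀ t ≤ θ, HasDerivAt x (G t (x t)) t) (hy : ∀ t ∈ J, θ ≤ t → HasDerivAt y (G t (y t)) t)
    (hxy : x θ = y θ) :
    ∃ z : ℝ → E, (∀ t, t ≤ θ ∨ t ∈ J → HasDerivAt z (G t (z t)) t) ∧ (∀ t ≤ θ, z t = x t) ∧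
      ∀ t, θ ≤ t → z t = y t := by
  classical
  set z : ℝ → E := fun t => if t ≤ θ then x t else y t with hz
  have z1 : ∀ t ≤ θ, z t = x t := fun t ht => if_pos ht
  have z2 : ∀ t, θ ≤ t → z t = y t := by
    intro t ht
    rcases ht.eq_or_lt with h | h
    · subst h; rw [z1 _ le_rfl, hxy]
    · exact if_neg (not_le.2 h)
  refine ⟨z, fun t ht => ?_, z1, z2⟩
  rcases lt_trichotomy t θ with h | h | h
  · rw [z1 t h.le]
    refine (hx t h.le).congr_of_eventuallyEq ?_
    filter_upwards [Iio_mem_nhds h] with s hs using z1 s hs.le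
  · subst h
    have h1 : HasDerivWithinAt z (G t (z t)) (Iic t) t := by
      rw [z1 t le_rfl]
      exact (hx t le_rfl).hasDerivWithinAt.congr (fun s hs => z1 s hs) (z1 t le_rfl)
    have h2 : HasDerivWithinAt z (G t (z t)) (Ici t) t := by
      rw [z2 t le_rfl]
      exact (hy t hθ le_rfl).hasDerivWithinAt.congr (fun s hs => z2 s hs) (z2 t le_rfl)
    have := h1.union h2
    rwa [Iic_union_Ici, hasDerivWithinAt_univ] at this
  · have htJ : t ∈ J := ht.resolve_left (not_le.2 h)
    rw [z2 t h.le]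
    refine (hy t htJ h.le).congr_of_eventuallyEq ?_
    filter_upwards [Ioi_mem_nhds h] with s hs using z2 s (le_of_lt hs)

lemma dm_chain (G : ℝ → E → E) (k : ℕ) (x : ℕ → ℝ → E) (θ : ℕ → ℝ)
    (h0 : ∀ t ≤ θ 1, HasDerivAt (x 0) (G t (x 0 t)) t)
    (hj : ∀ j < k, ∀ t ∈ Icc (θ (j + 1)) (θ (j + 2)), HasDerivAt (x (j + 1)) (G t (x (j + 1) t)) t)
    (hl : ∀ t, θ (k + 1) ≤ t → HasDerivAt (x (k + 1)) (G t (x (k + 1) t)) t)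
    (hm : ∀ j ≤ k, x j (θ (j + 1)) = x (j + 1) (θ (j + 1)))
    (hθ : ∀ j < k, θ (j + 1) < θ (j + 2)) :
    ∃ z : ℝ → E, (∀ t, HasDerivAt z (G t (z t)) t) ∧ (∀ t ≤ θ 1, z t = x 0 t) ∧
      ∀ t, θ (k + 1) ≤ t → z t = x (k + 1) t := by
  have key : ∀ j ≤ k, θ 1 ≤ θ (j + 1) ∧ ∃ z : ℝ → E, (∀ t ≤ θ (j + 1), HasDerivAt z (G t (z t)) t) ∧
      (∀ t ≤ θ 1, z t = x 0 t) ∧ z (θ (j + 1)) = x j (θ (j + 1)) := by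
    intro j
    induction j with
    | zero => exact fun _ => ⟨le_rfl, x 0, h0, fun _ _ => rfl, rfl⟩
    | succ j ih =>
      intro hjk
      obtain ⟨hle, z, z1, z2, z3⟩ := ih (by omega)
      have hlt := hθ j (by omega)
      obtain ⟨w, w1, w2, w3⟩ := dm_glue G z (x (j + 1)) (θ (j + 1)) (Icc (θ (j + 1)) (θ (j + 2)))
        ⟨le_rfl, hlt.le⟩ z1 (fun t ht _ => hj j (by omega) t ht) (by rw [z3]; exact hm j (by omega))
      refine ⟨hle.trans hlt.le, w, fun t ht => w1 t ?_, fun t ht => ?_, w3 _ hlt.le⟩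
      · rcases le_total t (θ (j + 1)) with h | h
        · exact Or.inl h
        · exact Or.inr ⟨h, ht⟩
      · rw [w2 t (ht.trans hle), z2 t ht]
  obtain ⟨hle, z, z1, z2, z3⟩ := key k le_rfl
  obtain ⟨w, w1, w2, w3⟩ := dm_glue G z (x (k + 1)) (θ (k + 1)) (Ici (θ (k + 1))) (mem_Ici.2 le_rfl) z1
    (fun t ht _ => hl t ht) (by rw [z3]; exact hm k le_rfl)
  refine ⟨w, fun t => w1 t (le_total t _), fun t ht => ?_, w3⟩
  rw [w2 t (ht.trans hle), z2 t ht]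

/-- primitive on a compact interval -/
lemma dm_prim (L : ℝ) (hL : 0 ≤ L) (g : ℝ → ℝ) (hg : ContinuousOn g (Icc 0 L)) :
    ∃ J : ℝ → ℝ, (∀ t ∈ Icc 0 L, HasDerivAt J (g t) t) ∧ J 0 = 0 ∧ J L = ∫ t in Icc 0 L, g t := by
  have hc : Continuous (IccExtend hL ((Icc 0 L).domRestrict g)) :=
    (continuousOn_iff_continuous_domRestrict.1 hg).Icc_extend'
  set G := IccExtend hL ((Icc 0 L).domRestrict g)
  have e : ∀ t ∈ Icc 0 L, G t = g t := fun t ht => by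
    simp only [G]; rw [IccExtend_of_mem _ _ ht]; rfl
  refine ⟨fun t => ∫ s in (0:ℝ)..t, G s, fun t ht => ?_, by simp, ?_⟩
  · rw [← e t ht]; exact hc.integral_hasStrictDerivAt 0 t |>.hasDerivAt
  · beta_reduce
    rw [intervalIntegral.integral_of_le hL, ← integral_Icc_eq_integral_Ioc]
    exact setIntegral_congr_fun measurableSet_Icc e

/-- primitive on a half line -/
lemma dm_primI (g : ℝ → ℝ) (B : ℝ) (hg : ContinuousOn g (Ici 0))
    (hB : ∀ t ∈ Ici (0:ℝ), |g t| ≤ B * Real.exp (-t/2)) :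
    ∃ J : ℝ → ℝ, (∀ t ∈ Ici (0:ℝ), HasDerivAt J (g t) t) ∧ J 0 = 0 ∧
      ∀ t ∈ Ici (0:ℝ), |(∫ t in Ici (0:ℝ), g t) - J t| ≤ 2 * B * Real.exp (-t/2) := by
  set G : ℝ → ℝ := fun t => g (max t 0) with hG
  have hc : Continuous G := by
    refine hg.comp_continuous (by fun_prop) (fun t => le_max_right t 0)
  have e : ∀ t ∈ Ici (0:ℝ), G t = g t := fun t ht => by
    simp only [G]; rw [max_eq_left ht]
  have hi : IntegrableOn G (Ici 0) := by
    refine (dm_expint.1.const_mul B).mono' hc.aestronglyMeasurable.restrict ?_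
    refine (ae_restrict_iff' measurableSet_Ici).2 (ae_of_all _ fun t ht => ?_)
    rw [e t ht]; exact hB t ht
  refine ⟨fun t => ∫ s in (0:ℝ)..t, G s, fun t ht => ?_, by simp, fun t ht => ?_⟩
  · rw [← e t ht]; exact hc.integral_hasStrictDerivAt 0 t |>.hasDerivAt
  · have ht' : 0 ≤ t := ht
    have h1 : ∫ t in Ici (0:ℝ), g t = ∫ t in Ioi (0:ℝ), G t := by
      rw [← integral_Ici_eq_integral_Ioi]
      exact setIntegral_congr_fun measurableSet_Ici (fun t ht => (e t ht).symm)
    have hi0 : IntegrableOn G (Ioi 0) := hi.mono_set Ioi_subset_Ici_self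
    have hit : IntegrableOn G (Ioi t) := hi0.mono_set (Ioi_subset_Ioi ht')
    have h2 := intervalIntegral.integral_Ioi_sub_Ioi hi0 ht'
    have h3 : (∫ t in Ici (0:ℝ), g t) - ∫ s in (0:ℝ)..t, G s = ∫ s in Ioi t, G s := by
      rw [h1, ← h2]; ring
    rw [h3]
    have hee : ∀ s : ℝ, Real.exp (-1/2 * s) = Real.exp (-s/2) := fun t => by congr 1; ring
    have i1 := integrableOn_exp_mul_Ioi (a := -1/2) (by norm_num) t
    have i2 := integral_exp_mul_Ioi (a := -1/2) (by norm_num) t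
    simp only [hee] at i1 i2
    refine (norm_integral_le_of_norm_le (μ := volume.restrict (Ioi t)) (f := G)
      (i1.const_mul B) ?_).trans (le_of_eq ?_)
    · refine (ae_restrict_iff' measurableSet_Ioi).2 (ae_of_all _ fun s hs => ?_)
      have : s ∈ Ici (0:ℝ) := mem_Ici.2 (ht'.trans (le_of_lt hs))
      rw [e s this]; exact hB s this
    · rw [integral_const_mul, i2]; ring
end

section
variable {n : ℕ}

lemma dm_infd (I0 : Fin n → ℝ) (N : ℤ) (φ I : Fin n → ℝ) (q p b : ℝ) (h1 : |q - 2 * Real.pi * N| ≤ b)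
    (h2 : |p| ≤ b) (h3 : ‖I - I0‖ ≤ b) : Metric.infDist (φ, I, q, p) (TorusSet n I0) ≤ b := by
  have hmem : (φ, I0, 2 * Real.pi * (N : ℝ), (0:ℝ)) ∈ TorusSet n I0 := ⟨φ, N, rfl⟩
  refine (Metric.infDist_le_dist_of_mem hmem).trans ?_
  have hb : 0 ≤ b := (abs_nonneg _).trans h2
  rw [Prod.dist_eq, Prod.dist_eq, Prod.dist_eq]
  simp only [dist_self, Real.dist_eq, sub_zero]
  refine max_le hb (max_le ?_ (max_le h1 h2))
  rw [dist_eq_norm]; exact h3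

lemma dm_final (ω A : Fin n → ℝ) (f : (Fin n → ℝ) → ℝ) (μ : ℝ) (I : ℝ → Fin n → ℝ) (q p : ℝ → ℝ)
    (hsol : IsSolution n ω f μ (fun t => A + t • ω) I q p) (I0 I0' : Fin n → ℝ) (N N' : ℤ)
    (B τ : ℝ) (hB : 1 ≤ B) (hτ : 0 ≤ τ) (hμ : 0 < μ) (hμ1 : μ ≤ 1)
    (hm : ∀ t ≤ -τ, |q t - 2 * Real.pi * N| ≤ B * Real.exp (t/2) ∧ |p t| ≤ B * Real.exp (t/2) ∧
      ‖I t - I0‖ ≤ B * Real.exp (t/2))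
    (hp : ∀ t ≥ τ, |q t - 2 * Real.pi * N'| ≤ B * Real.exp (-t/2) ∧ |p t| ≤ B * Real.exp (-t/2) ∧
      ‖I t - I0'‖ ≤ B * Real.exp (-t/2)) :
    (∃ (φ I : ℝ → Fin n → ℝ) (qq pp : ℝ → ℝ),
          IsSolution n ω f μ φ I qq pp ∧
          Tendsto (fun t => Metric.infDist (φ t, I t, qq t, pp t) (TorusSet n I0))
            atBot (nhds 0) ∧
          Tendsto (fun t => Metric.infDist (φ t, I t, qq t, pp t) (TorusSet n I0'))
            atTop (nhds 0)) ∧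
        ∃ η0 > (0:ℝ), ∀ η : ℝ, 0 < η → η < η0 →
          ∃ (φ I : ℝ → Fin n → ℝ) (qq pp : ℝ → ℝ) (t0 t1 : ℝ),
            IsSolution n ω f μ φ I qq pp ∧ t0 ≤ t1 ∧
            Metric.infDist (φ t0, I t0, qq t0, pp t0) (TorusSet n I0) < η ∧
            Metric.infDist (φ t1, I t1, qq t1, pp t1) (TorusSet n I0') < η ∧
            t1 - t0 ≤ 5 * (1 / μ) * Real.log (1 / μ) + 5 * |Real.log η| := by
  have dm : ∀ t ≤ -τ, Metric.infDist (A + t • ω, I t, q t, p t) (TorusSet n I0) ≤ B * Real.exp (t/2) :=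
    fun t ht => dm_infd I0 N _ _ _ _ _ (hm t ht).1 (hm t ht).2.1 (hm t ht).2.2
  have dp : ∀ t ≥ τ, Metric.infDist (A + t • ω, I t, q t, p t) (TorusSet n I0') ≤ B * Real.exp (-t/2) :=
    fun t ht => dm_infd I0' N' _ _ _ _ _ (hp t ht).1 (hp t ht).2.1 (hp t ht).2.2
  refine ⟨⟨fun t => A + t • ω, I, q, p, hsol, ?_, ?_⟩, ?_⟩
  · have h1 : Tendsto (fun t : ℝ => B * Real.exp (t/2)) atBot (𝓝 0) := by
      rw [← mul_zero B]
      exact (Real.tendsto_exp_atBot.comp (tendsto_id.atBot_div_const (by norm_num))).const_mul B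
    refine tendsto_of_tendsto_of_tendsto_of_le_of_le' tendsto_const_nhds h1
      (Eventually.of_forall fun t => Metric.infDist_nonneg) ?_
    filter_upwards [eventually_le_atBot (-τ)] with t ht using dm t ht
  · have h1 : Tendsto (fun t : ℝ => B * Real.exp (-t/2)) atTop (𝓝 0) := by
      rw [← mul_zero B]
      exact (Real.tendsto_exp_atBot.comp (tendsto_neg_atTop_atBot.atBot_div_const
        (by norm_num))).const_mul B
    refine tendsto_of_tendsto_of_tendsto_of_le_of_le' tendsto_const_nhds h1
      (Eventually.of_forall fun t => Metric.infDist_nonneg) ?_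
    filter_upwards [eventually_ge_atTop τ] with t ht using dp t ht
  · have hl : 0 ≤ Real.log (2 * B) := Real.log_nonneg (by linarith)
    refine ⟨Real.exp (-(4 * Real.log (2 * B) + τ + 1)), Real.exp_pos _, fun η hη hη0 => ?_⟩
    have h1 : Real.log η < -(4 * Real.log (2 * B) + τ + 1) := by
      rw [← Real.log_exp (-(4 * Real.log (2 * B) + τ + 1))]
      exact Real.log_lt_log hη hη0
    have h2 : |Real.log η| = -Real.log η := abs_of_neg (by linarith)
    set s := 2 * Real.log (2 * B) - 2 * Real.log η with hs
    have hsτ : τ ≤ s := by linarith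
    have he : B * Real.exp (-s/2) < η := by
      have : -s/2 = Real.log η - Real.log (2 * B) := by rw [hs]; ring
      rw [this, Real.exp_sub, Real.exp_log hη, Real.exp_log (by linarith)]
      have : B * (η / (2 * B)) = η/2 := by field_simp
      rw [this]; linarith
    refine ⟨fun t => A + t • ω, I, q, p, -s, s, hsol, by linarith, ?_, ?_, ?_⟩
    · exact (dm (-s) (by linarith)).trans_lt he
    · exact (dp s hsτ).trans_lt he
    · have h3 : 0 ≤ Real.log (1/μ) := Real.log_nonneg (by rw [le_div_iff₀ hμ]; linarith)
      have h4 : 0 ≤ 5 * (1 / μ) * Real.log (1 / μ) := by positivity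
      rw [h2]; linarith
end
end DmPart14

section DmPart15
open Set Topology

section
variable {n : ℕ}

/-- interface for the half-line segments -/
structure Half (f : (Fin n → ℝ) → ℝ) (f1 : (Fin n → ℝ) → (Fin n → ℝ) →L[ℝ] ℝ) (M μ : ℝ)
    (w : Fin n → ℝ) (e : ℝ) (U p0 : (Fin n → ℝ) → ℝ) (D : (Fin n → ℝ) → (Fin n → ℝ) → ℝ) : Prop where
  cont : Continuous U
  val : ∀ a, |U a - (e - μ * gm f w a)| ≤ 10^18 * M^2 * μ^2
  der : ∀ a v, HasDerivAt (fun h : ℝ => U (a + h • v)) (D a v) 0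
  Dw : ∀ a, D a w = p0 a ^ 2 / 2 - 2 * (1 - μ * f a)
  pos : ∀ a, 0 < p0 a
  lin : ∀ a (x y : ℝ) u v, D a (x • u + y • v) = x * D a u + y * D a v
  traj : ∀ a, ∃ (q p : ℝ → ℝ) (J : ℝ → Fin n → ℝ) (B : ℝ), q 0 = -Real.pi ∧ p 0 = p0 a ∧ J 0 = 0 ∧
    ∀ t, 0 ≤ t → HasDerivAt q (p t) t ∧ HasDerivAt p ((1 - μ * f (a + t • w)) * Real.sin (q t)) t ∧
      HasDerivAt J ((-(μ * (1 - Real.cos (q t)))) • fun i => f1 (a + t • w) (Pi.single i 1)) t ∧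
      |q t| ≤ B * Real.exp (-t/2) ∧ |p t| ≤ B * Real.exp (-t/2) ∧
      ∀ i, |D a (Pi.single i 1) - J t i| ≤ B * Real.exp (-t/2)

/-- interface for the compact segments -/
structure Mid (f : (Fin n → ℝ) → ℝ) (f1 : (Fin n → ℝ) → (Fin n → ℝ) →L[ℝ] ℝ) (M μ ν L : ℝ)
    (w : Fin n → ℝ) (e : ℝ) (U pa pb : (Fin n → ℝ) → ℝ → ℝ)
    (D : (Fin n → ℝ) → ℝ → (Fin n → ℝ) → ℝ) : Prop where
  cont : ContinuousOn (fun x : (Fin n → ℝ) × ℝ => U x.1 x.2) {x | |x.2 - 1| ≤ ν}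
  val : ∀ a m, |m - 1| ≤ ν → |U a m - (e - μ * gm f w a - μ * gm f (-w) (a + (m * L) • w))| ≤
    10^18 * M^2 * (1 + ‖w‖) * (μ^2 + ν)
  der : ∀ a m v, |m - 1| ≤ ν → HasDerivAt (fun h : ℝ => U (a + h • v) m) (D a m v) 0
  dera : ∀ a m, |m - 1| < ν → HasDerivAt (fun h : ℝ => U (a + h • w) (m - h / L))
    (pa a m ^ 2 / 2 - 2 * (1 - μ * f a)) 0
  derb : ∀ a m, |m - 1| < ν → HasDerivAt (fun h : ℝ => U a (m + h / L))
    (-(pb a m ^ 2 / 2 - 2 * (1 - μ * f (a + (m * L) • w)))) 0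
  Dw : ∀ a m, |m - 1| ≤ ν → D a m w = (pa a m ^ 2 / 2 - 2 * (1 - μ * f a)) -
    (pb a m ^ 2 / 2 - 2 * (1 - μ * f (a + (m * L) • w)))
  pos : ∀ a m, |m - 1| ≤ ν → 0 < pa a m ∧ 0 < pb a m
  lin : ∀ a m, |m - 1| ≤ ν → ∀ (x y : ℝ) u v, D a m (x • u + y • v) = x * D a m u + y * D a m v
  traj : ∀ a m, |m - 1| ≤ ν → ∃ (q p : ℝ → ℝ) (J : ℝ → Fin n → ℝ), q 0 = -Real.pi ∧ p 0 = pa a m ∧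
    J 0 = 0 ∧ q (m * L) = Real.pi ∧ p (m * L) = pb a m ∧ J (m * L) = (fun i => D a m (Pi.single i 1)) ∧
    ∀ t ∈ Icc 0 (m * L), HasDerivAt q (p t) t ∧
      HasDerivAt p ((1 - μ * f (a + t • w)) * Real.sin (q t)) t ∧
      HasDerivAt J ((-(μ * (1 - Real.cos (q t)))) • fun i => f1 (a + t • w) (Pi.single i 1)) t

variable {f : (Fin n → ℝ) → ℝ} {f1 : (Fin n → ℝ) → (Fin n → ℝ) →L[ℝ] ℝ} {M μ : ℝ}

lemma dmA_zero : dmA 0 = Real.pi := by unfold dmA; simp; ring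
lemma dmA1_zero : dmA1 0 = -2 := by unfold dmA1; simp; norm_num
lemma dmA1_np (t : ℝ) : dmA1 t ≤ 0 := by
  unfold dmA1; have := Real.exp_pos (-t); rw [neg_nonpos]; positivity

lemma dm_pposs (hM : 1 ≤ M) (hμ : 0 ≤ μ) (hs : M * μ ≤ 1/10^9) {ε : ℝ} (hε0 : 0 ≤ ε) (hε : ε ≤ μ) (p Q ψ : ℝ)
    (hψ0 : 0 ≤ ψ) (hψ : ψ ≤ 2) (hQ : 2 ≤ Q)
    (h : |p - Q| ≤ 32 * (2 * (6 * (ε + 7 * M * μ * 32)/(1/8)^2) +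
      (7 * M * μ * (32 + (6 * (ε + 7 * M * μ * 32)/(1/8)^2)) +
        (6 * (ε + 7 * M * μ * 32)/(1/8)^2) + ε)) * ψ) : 0 < p := by
  have h1 : μ ≤ 1/10^9 := by nlinarith
  set r := 6 * (ε + 7 * M * μ * 32)/(1/8)^2 with hr
  have hr0 : 0 ≤ r := by positivity
  have hr1 : r ≤ 1/10^4 := by rw [hr]; norm_num; linarith
  have h2 : 7 * M * μ * (32 + r) ≤ 7/10^9 * 33 := by
    refine mul_le_mul (by linarith) (by linarith) (by positivity) (by norm_num)
  have h3 : 0 ≤ 7 * M * μ * (32 + r) := by positivity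
  have h4 : 32 * (2 * r + (7 * M * μ * (32 + r) + r + ε)) * ψ ≤ (1/2) * 2 := by
    refine mul_le_mul (by norm_num at *; linarith) hψ hψ0 (by norm_num)
  have := (abs_le.1 h).1
  linarith

lemma dm_half (F : FB f f1 M) (hμ : 0 ≤ μ) (hs : M * μ ≤ 1/10^9) (w : Fin n → ℝ) :
    ∃ U p0 D, Half f f1 M μ w (dmJ (Ici 0) (fun _ => 1) (fun t => -dmA t) (fun t => -dmA1 t)) U p0 D := by
  have hM := F.M1
  obtain ⟨s1, s2, s3⟩ := dm_rsmall hM hμ hs hμ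
  obtain ⟨s1', -, -⟩ := dm_rsmall (ε := 0) hM hμ hs hμ
  have W := dm_WtIci
  have D := dm_domIci
  obtain ⟨q, p, hF⟩ := dm_fam D W F hμ s3.le w s2 s1'
  have hr : 0 ≤ 6 * (0 + 7 * M * μ * 32)/(1/8)^2 := by positivity
  have hm : |(1:ℝ) - 1| ≤ μ := by simpa using hμ
  have hpn : ∀ a, ∀ t ∈ Ici (0:ℝ), |p a 1 t - -dmA1 t| ≤ _ := fun a => (hF a 1 hm).pnear D W hr
    (δ := 7 * M * μ) (by positivity) (fun t _ => dm_cf_bd F hμ s3.le w a 1 t hm)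
  have h00 : (0:ℝ) ∈ Ici (0:ℝ) := mem_Ici.2 le_rfl
  have hq0 : ∀ a, q a 1 0 = -Real.pi := fun a => by
    rw [(hF a 1 hm).bc 0 rfl, dmA_zero]
  refine ⟨fun a => dmS (Ici 0) f μ w q p a 1, fun a => p a 1 0, fun a v => dmG (Ici 0) f1 μ w q a 1 v,
    ?_, dm_valhalf F hμ hs hF, fun a v => dm_Sv D W F hμ s3 s2 hr s1' hF a 1 hm v, fun a => ?_,
    fun a => ?_, fun a x y u v => dmG_lin D W F hr hF a 1 hm x y u v, fun a => ?_⟩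
  · have h := dm_Slip D W F hμ s3 s2 hr s1' hF {x | x.2 = 1} 0 (fun x hx => by rw [hx]; exact hm)
      (fun x hx y hy t _ => by rw [show x.2 = 1 from hx, show y.2 = 1 from hy]; simp) le_rfl
    exact h.comp_continuous (f := fun a : Fin n → ℝ => (a, (1:ℝ))) (by fun_prop) (fun a => rfl)
  · rw [dm_Ghalf F hμ (by linarith) hr hF a]
    unfold dmH cf
    rw [hq0, Real.cos_neg, Real.cos_pi]
    simp only [mul_zero, zero_smul, add_zero]; ring
  · refine dm_pposs hM hμ hs le_rfl hμ (p a 1 0) (-dmA1 0) (dmP 0) (W.pos 0 h00).le ?_ ?_ (hpn a 0 h00)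
    · have := (dmP_bd 0 le_rfl).2; simp at this; linarith
    · rw [dmA1_zero]; norm_num
  · set S := hF a 1 hm
    set r := 6 * (0 + 7 * M * μ * 32)/(1/8)^2 with hrd
    have hcos : ∀ t ∈ Ici (0:ℝ), 1 - Real.cos (q a 1 t) ≤ (32 + r) * Real.exp (-t/2) := by
      intro t ht
      have h1 := S.cosle W ht
      have h2 := (dmP_bd t ht).2
      have h3 := mul_le_mul_of_nonneg_left h2 (show 0 ≤ 32 + r by positivity)
      first
        | linarith
        | nlinarith [abs_le.1 h1]
    have hJ : ∀ i : Fin n, ∃ J : ℝ → ℝ, (∀ t ∈ Ici (0:ℝ), HasDerivAt J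
        (-(1 * μ * (f1 (a + (1 * t) • w) (Pi.single i 1) * (1 - Real.cos (q a 1 t))))) t) ∧ J 0 = 0 ∧
        ∀ t ∈ Ici (0:ℝ), |dmG (Ici 0) f1 μ w q a 1 (Pi.single i 1) - J t| ≤
          2 * (μ * (M * ((32 + r)))) * Real.exp (-t/2) := by
      intro i
      obtain ⟨J, j1, j2, j3⟩ := dm_primI
        (fun t => -(1 * μ * (f1 (a + (1 * t) • w) (Pi.single i 1) * (1 - Real.cos (q a 1 t)))))
        (μ * (M * (32 + r)))
        ((continuousOn_const.mul ((dm_f1_cont F w a 1 (fun _ => Pi.single i 1)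
          continuous_const).continuousOn.mul (continuousOn_const.sub
            (Real.continuous_cos.comp_continuousOn S.contq)))).neg) (fun t ht => by
          rw [abs_neg, one_mul μ, abs_mul, abs_mul, abs_of_nonneg hμ,
            abs_of_nonneg (sub_nonneg.2 (Real.cos_le_one _))]
          have h1 := F.b1 (a + (1 * t) • w) (Pi.single i 1)
          have h2 : ‖(Pi.single i 1 : Fin n → ℝ)‖ = 1 := by rw [Pi.norm_single, norm_one]
          rw [h2, mul_one] at h1
          calc μ * (|f1 (a + (1 * t) • w) (Pi.single i 1)| * (1 - Real.cos (q a 1 t)))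
              ≤ μ * (M * ((32 + r) * Real.exp (-t/2))) := by
                refine mul_le_mul_of_nonneg_left ?_ hμ
                exact mul_le_mul h1 (hcos t ht) (sub_nonneg.2 (Real.cos_le_one _)) (by linarith)
            _ = _ := by ring)
      refine ⟨J, j1, j2, ?_⟩
      unfold dmG
      rw [← integral_const_mul, ← integral_neg]
      exact j3
    choose J j1 j2 j3 using hJ
    set B1 := 2 * (μ * (M * ((32 + r))))
    set B2 := 32 * (2 * r + (7 * M * μ * (32 + r) + r + 0))
    have hB1 : 0 ≤ B1 := by positivity
    have hB2 : 0 ≤ B2 := by positivity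
    refine ⟨q a 1, p a 1, fun t i => J i t, B1 + B2 + r + 4, hq0 a, rfl, ?_, fun t ht => ?_⟩
    · ext i; exact j2 i
    have hE := Real.exp_pos (-t/2)
    have hE2 : Real.exp (-t) ≤ Real.exp (-t/2) := Real.exp_le_exp.2 (by linarith)
    have hP := (dmP_bd t ht).2
    obtain ⟨-, -, -, -, k1, k2, k3, -⟩ := dmA_facts t ht
    refine ⟨S.dq t ht, ?_, ?_, ?_, ?_, fun i => ?_⟩
    · refine (S.dp t ht).congr_deriv ?_
      unfold cf; simp only [one_mul, one_pow]
    · rw [hasDerivAt_pi]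
      intro i
      refine (j1 i t ht).congr_deriv ?_
      simp only [Pi.smul_apply, smul_eq_mul, one_mul]; ring
    · have h1 := abs_le.1 (S.near t ht)
      have h2 := mul_le_mul_of_nonneg_left hP hr
      have h3 := mul_nonneg hB1 hE.le
      have h4 := mul_nonneg hB2 hE.le
      have h5 := mul_nonneg hr hE.le
      rw [abs_le]; constructor <;> nlinarith [h1.1, h1.2]
    · have h1 := abs_le.1 (hpn a t ht)
      have h2 := mul_le_mul_of_nonneg_left hP hB2
      have h3 := mul_nonneg hB1 hE.le
      have h4 := mul_nonneg hB2 hE.le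
      have h5 := mul_nonneg hr hE.le
      have h6 := abs_le.1 k1
      rw [abs_le]; constructor <;> nlinarith [h1.1, h1.2, h6.1, h6.2]
    · refine (j3 i t ht).trans ?_
      have h4 := mul_nonneg hB2 hE.le
      have h5 := mul_nonneg hr hE.le
      nlinarith
end
end DmPart15

section DmPart16
open Set Topology

section
variable {n : ℕ} {f : (Fin n → ℝ) → ℝ} {f1 : (Fin n → ℝ) → (Fin n → ℝ) →L[ℝ] ℝ} {M μ : ℝ}

lemma dmQ_zero (L : ℝ) : dmQ L 0 = -Real.pi := by
  unfold dmQ; rw [dmA_zero]; simp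
lemma dmQ_L (L : ℝ) (hL : 2 ≤ L) : dmQ L L = Real.pi := by
  unfold dmQ
  have : L ≠ 0 := by linarith
  rw [sub_self, dmA_zero, mul_div_assoc, div_self this]; ring
lemma dmQ1_ge (L t : ℝ) (hL : 2 ≤ L) (ht : t = 0 ∨ t = L) : 2 ≤ dmQ1 L t := by
  obtain ⟨-, -, -, -, -, a1, a2, -⟩ := dmA_facts L (by linarith)
  have h : 0 ≤ 2 * dmA L / L := by positivity
  have h2 := dmA1_np L
  unfold dmQ1
  rcases ht with rfl | rfl
  · rw [dmA1_zero, sub_zero]; linarith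
  · rw [sub_self, dmA1_zero]; linarith

lemma dm_mid (F : FB f f1 M) (hμ : 0 ≤ μ) (hs : M * μ ≤ 1/10^9) (L : ℝ) (hL : 2 ≤ L) (ν : ℝ)
    (hg : Real.exp (-L/2) ≤ 1/200) (hν : ν ≤ μ) (hgν : 200 * Real.exp (-L/2) ≤ ν) (w : Fin n → ℝ) :
    ∃ U pa pb D, Mid f f1 M μ ν L w (dmJ (Icc 0 L) (fun _ => 1) (dmQ L) (dmQ1 L)) U pa pb D := by
  have hM := F.M1
  have hgp := Real.exp_pos (-L/2)
  obtain ⟨s1, s2, s3⟩ := dm_rsmall hM hμ hs (hgν.trans hν)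
  have W := dm_WtIcc L hL hg
  have D := dm_domIcc L hL
  obtain ⟨q, p, hF⟩ := dm_fam D W F hμ s3.le w s2 s1
  have hr : 0 ≤ 6 * (200 * Real.exp (-L/2) + 7 * M * μ * 32)/(1/8)^2 := by positivity
  have hL0 : 0 < L := by linarith
  have h00 : (0:ℝ) ∈ Icc 0 L := ⟨le_rfl, hL0.le⟩
  have hLL : L ∈ Icc 0 L := ⟨hL0.le, le_rfl⟩
  have hpn : ∀ a m, |m - 1| ≤ ν → ∀ t ∈ Icc 0 L, |p a m t - dmQ1 L t| ≤ _ := fun a m hm =>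
    (hF a m (hm.trans hν)).pnear D W hr
    (δ := 7 * M * μ) (by positivity) (fun t _ => dm_cf_bd F hμ s3.le w a m t (hm.trans hν))
  have hq0 : ∀ a m, |m - 1| ≤ ν → q a m 0 = -Real.pi := fun a m hm => by
    rw [(hF a m (hm.trans hν)).bc 0 (by simp), dmQ_zero]
  have hqL : ∀ a m, |m - 1| ≤ ν → q a m L = Real.pi := fun a m hm => by
    rw [(hF a m (hm.trans hν)).bc L (by simp), dmQ_L L hL]
  have hmp : ∀ m, |m - 1| ≤ ν → 0 < m := fun m hm => by have := abs_le.1 hm; linarith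
  have hH0 : ∀ a m, |m - 1| ≤ ν → dmH (cf f μ w a m) (q a m) (p a m) 0 / m^2 =
      (p a m 0 / m)^2/2 - 2 * (1 - μ * f a) := fun a m hm => by
    have := hmp m hm
    unfold dmH cf
    rw [hq0 a m hm, Real.cos_neg, Real.cos_pi]
    simp only [mul_zero, zero_smul, add_zero]; field_simp; ring
  have hHL : ∀ a m, |m - 1| ≤ ν → dmH (cf f μ w a m) (q a m) (p a m) L / m^2 =
      (p a m L / m)^2/2 - 2 * (1 - μ * f (a + (m * L) • w)) := fun a m hm => by
    have := hmp m hm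
    unfold dmH cf
    rw [hqL a m hm, Real.cos_pi]
    field_simp; ring
  have hev : ∀ m β : ℝ, |m - 1| < ν → ∀ᶠ h in 𝓝 (0:ℝ), |m + h * β - 1| ≤ μ := fun m β hm => by
    have hc : ContinuousAt (fun h : ℝ => |m + h * β - 1|) 0 := by fun_prop
    have := hc.eventually_lt (continuousAt_const (y := μ)) (by simpa using hm.trans_le hν)
    exact this.mono (fun h hh => hh.le)
  refine ⟨dmS (Icc 0 L) f μ w q p, fun a m => p a m 0 / m, fun a m => p a m L / m,
    dmG (Icc 0 L) f1 μ w q, ?_, dm_valmid F hμ hs L hL ν hg hν hgν hF,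
    fun a m v hm => dm_Sv D W F hμ s3 s2 hr s1 hF a m (hm.trans hν) v, fun a m hm => ?_, fun a m hm => ?_,
    fun a m hm => ?_, fun a m hm => ⟨?_, ?_⟩,
    fun a m hm x y u v => dmG_lin D W F hr hF a m (hm.trans hν) x y u v, fun a m hm => ?_⟩
  · refine dm_Slip D W F hμ s3 s2 hr s1 hF {x | |x.2 - 1| ≤ ν} L (fun x hx => le_trans hx hν)
      (fun x hx y hy t ht => ?_) hL0.le
    rw [abs_mul, abs_of_nonneg ht.1, mul_comm]
    exact mul_le_mul_of_nonneg_right ht.2 (abs_nonneg _)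
  · have h := dm_Smid W F hμ s3 s2 hr s1 hL hF a m 1 (-1/L) (hev m _ hm)
    have e : (fun h : ℝ => dmS (Icc 0 L) f μ w q p (a + h • ((1:ℝ) • w)) (m + h * (-1/L))) =
        fun h : ℝ => dmS (Icc 0 L) f μ w q p (a + h • w) (m - h / L) := by
      ext h; rw [one_smul]; congr 1; ring
    rw [e] at h
    refine h.congr_deriv ?_
    rw [← hH0 a m hm.le]
    have := hmp m hm.le
    field_simp; ring
  · have h := dm_Smid W F hμ s3 s2 hr s1 hL hF a m 0 (1/L) (hev m _ hm)
    have e : (fun h : ℝ => dmS (Icc 0 L) f μ w q p (a + h • ((0:ℝ) • w)) (m + h * (1/L))) =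
        fun h : ℝ => dmS (Icc 0 L) f μ w q p a (m + h / L) := by
      ext h; rw [zero_smul, smul_zero, add_zero]; congr 1; ring
    rw [e] at h
    refine h.congr_deriv ?_
    rw [← hHL a m hm.le]
    have := hmp m hm.le
    field_simp; ring
  · rw [dm_Gmid F hμ s3 hL0.le hF a m (hm.trans hν), sub_div, hH0 a m hm, hHL a m hm]
  · refine div_pos ?_ (hmp m hm)
    exact dm_pposs hM hμ hs (by positivity) (hgν.trans hν) (p a m 0) (dmQ1 L 0) (dmPm L 0)
      (W.pos 0 h00).le (dm_midF L 0 hL h00).psi2 (dmQ1_ge L 0 hL (Or.inl rfl)) (hpn a m hm 0 h00)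
  · refine div_pos ?_ (hmp m hm)
    exact dm_pposs hM hμ hs (by positivity) (hgν.trans hν) (p a m L) (dmQ1 L L) (dmPm L L)
      (W.pos L hLL).le (dm_midF L L hL hLL).psi2 (dmQ1_ge L L hL (Or.inr rfl)) (hpn a m hm L hLL)
  · have S := hF a m (hm.trans hν)
    have hm0 := hmp m hm
    have hJ : ∀ i : Fin n, ∃ J : ℝ → ℝ, (∀ t ∈ Icc 0 L, HasDerivAt J
        (-(m * μ * (f1 (a + (m * t) • w) (Pi.single i 1) * (1 - Real.cos (q a m t))))) t) ∧ J 0 = 0 ∧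
        J L = dmG (Icc 0 L) f1 μ w q a m (Pi.single i 1) := by
      intro i
      obtain ⟨J, j1, j2, j3⟩ := dm_prim L hL0.le
        (fun t => -(m * μ * (f1 (a + (m * t) • w) (Pi.single i 1) * (1 - Real.cos (q a m t)))))
        ((continuousOn_const.mul ((dm_f1_cont F w a m (fun _ => Pi.single i 1)
          continuous_const).continuousOn.mul (continuousOn_const.sub
            (Real.continuous_cos.comp_continuousOn S.contq)))).neg)
      refine ⟨J, j1, j2, ?_⟩
      unfold dmG
      rw [← integral_const_mul, ← integral_neg]
      exact j3
    choose J j1 j2 j3 using hJ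
    have hdiv : ∀ t, HasDerivAt (fun t : ℝ => t / m) (1 / m) t := fun t =>
      (hasDerivAt_id t).div_const m
    have hmL : m * L / m = L := by field_simp
    refine ⟨fun t => q a m (t / m), fun t => p a m (t / m) / m, fun t i => J i (t / m), ?_, ?_, ?_, ?_,
      ?_, ?_, fun t ht => ?_⟩
    · simp only [zero_div]; exact hq0 a m hm
    · simp only [zero_div]
    · ext i; simp only [zero_div]; exact j2 i
    · simp only [hmL]; exact hqL a m hm
    · simp only [hmL]
    · ext i; simp only [hmL]; exact j3 i
    · have ht' : t / m ∈ Icc 0 L := ⟨div_nonneg ht.1 hm0.le, by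
        rw [div_le_iff₀ hm0]; linarith [ht.2]⟩
      have hmt : m * (t / m) = t := by field_simp
      refine ⟨?_, ?_, ?_⟩
      · refine ((S.dq _ ht').comp t (hdiv t)).congr_deriv ?_
        ring
      · refine (((S.dp _ ht').comp t (hdiv t)).div_const m).congr_deriv ?_
        unfold cf; rw [hmt]; field_simp
      · rw [hasDerivAt_pi]
        intro i
        refine ((j1 i _ ht').comp t (hdiv t)).congr_deriv ?_
        rw [hmt]
        simp only [Pi.smul_apply, smul_eq_mul]; field_simp
end
end DmPart16

section DmPart17
open Set Topology

section
variable {n : ℕ}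

lemma dm_sol (ω A : Fin n → ℝ) (f : (Fin n → ℝ) → ℝ) (μ : ℝ) (k : ℕ) (θ : ℕ → ℝ)
    (D : ℕ → Fin n → ℝ) (pin pout : ℕ → ℝ) (I0 I0' : Fin n → ℝ)
    (q p : ℕ → ℝ → ℝ) (J : ℕ → ℝ → Fin n → ℝ) (q0 p0 : ℝ → ℝ) (J0 : ℝ → Fin n → ℝ) (B0 B1 : ℝ)
    (hθ : ∀ j < k, θ (j + 1) < θ (j + 2)) (hμ : 0 < μ) (hμ1 : μ ≤ 1)
    (hl0 : q0 0 = -Real.pi) (hl1 : p0 0 = pout 0) (hl2 : J0 0 = 0)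
    (hl : ∀ t, 0 ≤ t → HasDerivAt q0 (p0 t) t ∧
      HasDerivAt p0 ((1 - μ * f (A + θ 1 • ω + t • (-ω))) * Real.sin (q0 t)) t ∧
      HasDerivAt J0 ((-(μ * (1 - Real.cos (q0 t)))) •
        fun i => fderiv ℝ f (A + θ 1 • ω + t • (-ω)) (Pi.single i 1)) t ∧
      |q0 t| ≤ B0 * Real.exp (-t/2) ∧ |p0 t| ≤ B0 * Real.exp (-t/2) ∧
      ∀ i, |D 0 i - J0 t i| ≤ B0 * Real.exp (-t/2))
    (hi : ∀ j ≤ k, q (j + 1) 0 = -Real.pi ∧ p (j + 1) 0 = pin (j + 1) ∧ J (j + 1) 0 = 0)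
    (ho : ∀ j < k, q (j + 1) (θ (j + 2) - θ (j + 1)) = Real.pi ∧
      p (j + 1) (θ (j + 2) - θ (j + 1)) = pout (j + 1) ∧ J (j + 1) (θ (j + 2) - θ (j + 1)) = D (j + 1))
    (hj : ∀ j ≤ k, ∀ t, 0 ≤ t → (j < k → t ≤ θ (j + 2) - θ (j + 1)) → HasDerivAt (q (j + 1)) (p (j + 1) t) t ∧
      HasDerivAt (p (j + 1)) ((1 - μ * f (A + θ (j + 1) • ω + t • ω)) * Real.sin (q (j + 1) t)) t ∧
      HasDerivAt (J (j + 1)) ((-(μ * (1 - Real.cos (q (j + 1) t)))) •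
        fun i => fderiv ℝ f (A + θ (j + 1) • ω + t • ω) (Pi.single i 1)) t)
    (hr : ∀ t, 0 ≤ t → |q (k + 1) t| ≤ B1 * Real.exp (-t/2) ∧ |p (k + 1) t| ≤ B1 * Real.exp (-t/2) ∧
      ∀ i, |D (k + 1) i - J (k + 1) t i| ≤ B1 * Real.exp (-t/2))
    (hmatch : ∀ j ≤ k, pout j = pin (j + 1))
    (hD : ∑ j ∈ Finset.range (k + 2), D j = I0' - I0) :
    (∃ (φ I : ℝ → Fin n → ℝ) (qq pp : ℝ → ℝ),
          IsSolution n ω f μ φ I qq pp ∧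
          Tendsto (fun t => Metric.infDist (φ t, I t, qq t, pp t) (TorusSet n I0))
            atBot (nhds 0) ∧
          Tendsto (fun t => Metric.infDist (φ t, I t, qq t, pp t) (TorusSet n I0'))
            atTop (nhds 0)) ∧
        ∃ η0 > (0:ℝ), ∀ η : ℝ, 0 < η → η < η0 →
          ∃ (φ I : ℝ → Fin n → ℝ) (qq pp : ℝ → ℝ) (t0 t1 : ℝ),
            IsSolution n ω f μ φ I qq pp ∧ t0 ≤ t1 ∧
            Metric.infDist (φ t0, I t0, qq t0, pp t0) (TorusSet n I0) < η ∧
            Metric.infDist (φ t1, I t1, qq t1, pp t1) (TorusSet n I0') < η ∧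
            t1 - t0 ≤ 5 * (1 / μ) * Real.log (1 / μ) + 5 * |Real.log η| := by
  set G : ℝ → ((Fin n → ℝ) × ℝ × ℝ) → ((Fin n → ℝ) × ℝ × ℝ) := fun t x =>
    ((-(μ * (1 - Real.cos x.2.1))) • (fun i => fderiv ℝ f (A + t • ω) (Pi.single i 1)), x.2.2,
      (1 - μ * f (A + t • ω)) * Real.sin x.2.1) with hG
  set C : ℕ → Fin n → ℝ := fun j => I0 + ∑ i ∈ Finset.range j, D i with hC
  set x : ℕ → ℝ → ((Fin n → ℝ) × ℝ × ℝ) := fun j t => if j = 0 then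
    (I0 + D 0 - J0 (θ 1 - t), -q0 (θ 1 - t), p0 (θ 1 - t)) else
    (C j + J j (t - θ j), q j (t - θ j) + 2 * Real.pi * j, p j (t - θ j)) with hx
  have x0 : x 0 = fun t => (I0 + D 0 - J0 (θ 1 - t), -q0 (θ 1 - t), p0 (θ 1 - t)) := by
    simp [hx]
  have xs : ∀ j, x (j + 1) = fun t => (C (j + 1) + J (j + 1) (t - θ (j + 1)),
      q (j + 1) (t - θ (j + 1)) + 2 * Real.pi * (j + 1 : ℕ), p (j + 1) (t - θ (j + 1))) := by
    intro j; simp [hx]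
  have hseg : ∀ j ≤ k, ∀ t, θ (j + 1) ≤ t → (j < k → t ≤ θ (j + 2)) →
      HasDerivAt (x (j + 1)) (G t (x (j + 1) t)) t := by
    intro j hjk t ht ht2
    obtain ⟨a1, a2, a3⟩ := hj j hjk (t - θ (j + 1)) (by linarith) (fun h => by linarith [ht2 h])
    have e : A + θ (j + 1) • ω + (t - θ (j + 1)) • ω = A + t • ω := by module
    rw [e] at a2 a3
    have c1 := (a1.comp_sub_const t (θ (j + 1))).add_const (2 * Real.pi * (j + 1 : ℕ))
    have c2 := a2.comp_sub_const t (θ (j + 1))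
    have c3 := (a3.comp_sub_const t (θ (j + 1))).const_add (C (j + 1))
    have := c3.prodMk (c1.prodMk c2)
    rw [xs]
    refine this.congr_deriv ?_
    have per : 2 * Real.pi * ((j + 1 : ℕ) : ℝ) = ((j + 1 : ℕ) : ℝ) * (2 * Real.pi) := by ring
    simp only [hG, per, Real.cos_add_nat_mul_two_pi, Real.sin_add_nat_mul_two_pi]
  obtain ⟨z, z1, z2, z3⟩ := dm_chain G k x θ (fun t ht => by
      obtain ⟨a1, a2, a3, -⟩ := hl (θ 1 - t) (by linarith)
      have e : A + θ 1 • ω + (θ 1 - t) • (-ω) = A + t • ω := by module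
      rw [e] at a2 a3
      have c1 := (a1.comp_const_sub (θ 1) t).neg
      have c2 := a2.comp_const_sub (θ 1) t
      have c3 := (a3.comp_const_sub (θ 1) t).const_sub (I0 + D 0)
      have := c3.prodMk (c1.prodMk c2)
      rw [x0]
      refine this.congr_deriv ?_
      simp only [hG, Real.cos_neg, Real.sin_neg, neg_neg, mul_neg])
    (fun j hjk t ht => hseg j hjk.le t ht.1 (fun _ => ht.2))
    (fun t ht => hseg k le_rfl t ht (fun h => absurd h (lt_irrefl _)))
    (fun j hjk => by
      obtain ⟨i1, i2, i3⟩ := hi j hjk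
      rw [xs]
      simp only [sub_self, i1, i2, i3, ← hmatch j hjk]
      cases j with
      | zero =>
        rw [x0]
        simp only [sub_self, hl0, hl1, hl2, hC]
        ext i <;> simp
        ring
      | succ j =>
        rw [xs]
        obtain ⟨o1, o2, o3⟩ := ho j (by omega)
        simp only [o1, o2, o3, hC]
        rw [Finset.sum_range_succ _ (j + 1)]
        ext i <;> simp
        · ring
        · ring) hθ
  refine dm_final ω A f μ (fun t => (z t).1) (fun t => (z t).2.1) (fun t => (z t).2.2) ?_ I0 I0' 0 (k + 1 : ℕ)
    (1 + |B0| * Real.exp (-θ 1/2) + |B1| * Real.exp (θ (k + 1)/2)) (max |θ 1| |θ (k + 1)|)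
    (by have h1 : 0 ≤ |B0| * Real.exp (-θ 1/2) := by positivity
        have h2 : 0 ≤ |B1| * Real.exp (θ (k + 1)/2) := by positivity
        linarith) (by positivity) hμ hμ1 ?_ ?_
  · intro t
    have h := z1 t
    have h1 := (ContinuousLinearMap.fst ℝ (Fin n → ℝ) (ℝ × ℝ)).hasFDerivAt.comp_hasDerivAt t h
    have h2 := (ContinuousLinearMap.snd ℝ (Fin n → ℝ) (ℝ × ℝ)).hasFDerivAt.comp_hasDerivAt t h
    have h3 := (ContinuousLinearMap.fst ℝ ℝ ℝ).hasFDerivAt.comp_hasDerivAt t h2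
    have h4 := (ContinuousLinearMap.snd ℝ ℝ ℝ).hasFDerivAt.comp_hasDerivAt t h2
    refine ⟨?_, h1, h3, h4.congr_deriv ?_⟩
    · have := ((hasDerivAt_id t).smul_const ω).const_add A
      exact this.congr_deriv (by simp)
    · simp only [hG, ContinuousLinearMap.coe_snd']; ring
  · intro t ht
    have ht1 : t ≤ θ 1 := by
      have := le_max_left |θ 1| |θ (k + 1)|; have := neg_abs_le (θ 1); linarith
    obtain ⟨-, -, -, b1, b2, b3⟩ := hl (θ 1 - t) (by linarith)
    have hb : B0 * Real.exp (-(θ 1 - t)/2) ≤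
        (1 + |B0| * Real.exp (-θ 1/2) + |B1| * Real.exp (θ (k + 1)/2)) * Real.exp (t/2) := by
      have e : Real.exp (-(θ 1 - t)/2) = Real.exp (-θ 1/2) * Real.exp (t/2) := by
        rw [← Real.exp_add]; congr 1; ring
      rw [e, ← mul_assoc]
      refine mul_le_mul_of_nonneg_right ?_ (Real.exp_pos _).le
      have h1 := mul_le_mul_of_nonneg_right (le_abs_self B0) (Real.exp_pos (-θ 1/2)).le
      have h2 : 0 ≤ |B1| * Real.exp (θ (k + 1)/2) := by positivity
      linarith
    rw [z2 t ht1, x0]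
    refine ⟨?_, b2.trans hb, ?_⟩
    · simp only [Int.cast_zero, mul_zero, sub_zero, abs_neg]; exact b1.trans hb
    · rw [pi_norm_le_iff_of_nonneg (by positivity)]
      intro i
      refine le_trans ?_ ((b3 i).trans hb)
      rw [Real.norm_eq_abs]
      apply le_of_eq; congr 1; simp only [Pi.sub_apply, Pi.add_apply]; ring
  · intro t ht
    have ht1 : θ (k + 1) ≤ t := by
      have := le_max_right |θ 1| |θ (k + 1)|; have := le_abs_self (θ (k + 1)); linarith
    obtain ⟨b1, b2, b3⟩ := hr (t - θ (k + 1)) (by linarith)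
    have hb : B1 * Real.exp (-(t - θ (k + 1))/2) ≤
        (1 + |B0| * Real.exp (-θ 1/2) + |B1| * Real.exp (θ (k + 1)/2)) * Real.exp (-t/2) := by
      have e : Real.exp (-(t - θ (k + 1))/2) = Real.exp (θ (k + 1)/2) * Real.exp (-t/2) := by
        rw [← Real.exp_add]; congr 1; ring
      rw [e, ← mul_assoc]
      refine mul_le_mul_of_nonneg_right ?_ (Real.exp_pos _).le
      have h1 := mul_le_mul_of_nonneg_right (le_abs_self B1) (Real.exp_pos (θ (k + 1)/2)).le
      have h2 : 0 ≤ |B0| * Real.exp (-θ 1/2) := by positivity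
      linarith
    rw [z3 t ht1, xs]
    refine ⟨?_, b2.trans hb, ?_⟩
    · simp only [Int.cast_natCast, add_sub_cancel_right]; exact b1.trans hb
    · rw [pi_norm_le_iff_of_nonneg (by positivity)]
      intro i
      refine le_trans ?_ ((b3 i).trans hb)
      rw [Real.norm_eq_abs, abs_sub_comm]
      apply le_of_eq; congr 1
      have h3 := congrFun hD i
      rw [Finset.sum_range_succ] at h3
      simp only [hC, Pi.sub_apply, Pi.add_apply] at h3 ⊢
      linarith
end
end DmPart17

section DmPart18
open Set Topology

section
variable {n : ℕ}

/-- the reduced action of the segments -/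
noncomputable def dmV (k : ℕ) (ω : Fin n → ℝ) (T : ℕ → ℝ) (Um Up : (Fin n → ℝ) → ℝ)
    (U : ℕ → (Fin n → ℝ) → ℝ → ℝ) (j : ℕ) (A : Fin n → ℝ) (x y : ℝ) : ℝ :=
  if j = 0 then Um (A + (T 1 + y) • ω) else
    if j = k + 1 then Up (A + (T (k + 1) + x) • ω) else
      U j (A + (T j + x) • ω) (1 + (y - x) / (T (j + 1) - T j))

lemma dm_crit (ω : Fin n → ℝ) (f : (Fin n → ℝ) → ℝ) (M μ ν σ e0 e1 : ℝ) (k : ℕ) (T e : ℕ → ℝ)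
    (Um Up pm pp : (Fin n → ℝ) → ℝ) (Dm Dp : (Fin n → ℝ) → (Fin n → ℝ) → ℝ)
    (U pa pb : ℕ → (Fin n → ℝ) → ℝ → ℝ) (D : ℕ → (Fin n → ℝ) → ℝ → (Fin n → ℝ) → ℝ)
    (hμ : 0 < μ) (hμ1 : μ ≤ 1)
    (Hm : Half f (fderiv ℝ f) M μ (-ω) e0 Um pm Dm) (Hp : Half f (fderiv ℝ f) M μ ω e1 Up pp Dp)
    (Hj : ∀ j, Mid f (fderiv ℝ f) M μ ν (T (j + 1) - T j) ω (e j) (U j) (pa j) (pb j) (D j))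
    (hT : ∀ j, 0 < T (j + 1) - T j) (hν : ν < 1)
    (hσ : ∀ j x y, |x| ≤ σ → |y| ≤ σ → |(y - x) / (T (j + 1) - T j)| < ν)
    (A : Fin n → ℝ) (S : ℕ → ℝ) (hS : ∀ j, |S j| ≤ σ)
    (hloc : ∀ j ≤ k, IsLocalMax (fun h : ℝ => dmV k ω T Um Up U j A (S j) (S (j + 1) + h) +
        dmV k ω T Um Up U (j + 1) A (S (j + 1) + h) (S (j + 2))) 0)
    (I0 I0' : Fin n → ℝ)
    (hvar : ∀ v : Fin n → ℝ, ∑ i, ω i * v i = 0 →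
      IsLocalMax (fun h : ℝ => dmF (dmV k ω T Um Up U) k (I0' - I0) (A + h • v) S) 0)
    (hω : ∑ i, ω i * I0 i = ∑ i, ω i * I0' i) (hω0 : 0 < ∑ i, ω i * ω i) :
    (∃ (φ I : ℝ → Fin n → ℝ) (qq pp : ℝ → ℝ),
          IsSolution n ω f μ φ I qq pp ∧
          Tendsto (fun t => Metric.infDist (φ t, I t, qq t, pp t) (TorusSet n I0))
            atBot (nhds 0) ∧
          Tendsto (fun t => Metric.infDist (φ t, I t, qq t, pp t) (TorusSet n I0'))
            atTop (nhds 0)) ∧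
        ∃ η0 > (0:ℝ), ∀ η : ℝ, 0 < η → η < η0 →
          ∃ (φ I : ℝ → Fin n → ℝ) (qq pp : ℝ → ℝ) (t0 t1 : ℝ),
            IsSolution n ω f μ φ I qq pp ∧ t0 ≤ t1 ∧
            Metric.infDist (φ t0, I t0, qq t0, pp t0) (TorusSet n I0) < η ∧
            Metric.infDist (φ t1, I t1, qq t1, pp t1) (TorusSet n I0') < η ∧
            t1 - t0 ≤ 5 * (1 / μ) * Real.log (1 / μ) + 5 * |Real.log η| := by
  set θ : ℕ → ℝ := fun j => T j + S j with hθ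
  set m : ℕ → ℝ := fun j => 1 + (S (j + 1) - S j) / (T (j + 1) - T j) with hm
  set a : ℕ → Fin n → ℝ := fun j => A + θ j • ω with ha
  have hmν : ∀ j, |m j - 1| < ν := fun j => by
    simp only [hm, add_sub_cancel_left]; exact hσ j _ _ (hS j) (hS (j + 1))
  have hmL : ∀ j, m j * (T (j + 1) - T j) = θ (j + 1) - θ j := fun j => by
    have := (hT j).ne'
    simp only [hm, hθ]; field_simp; ring
  have haL : ∀ j, a j + (m j * (T (j + 1) - T j)) • ω = a (j + 1) := fun j => by
    rw [hmL]; simp only [ha]; module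
  have hθlt : ∀ j, θ j < θ (j + 1) := fun j => by
    have h1 := abs_lt.1 (hmν j)
    have h2 : 0 < m j := by linarith
    have := mul_pos h2 (hT j)
    rw [hmL] at this; linarith
  set pin : ℕ → ℝ := fun j => if j = k + 1 then pp (a j) else pa j (a j) (m j) with hpin
  set pout : ℕ → ℝ := fun j => if j = 0 then pm (a 1) else pb j (a j) (m j) with hpout
  set Ein : ℕ → ℝ := fun j => pin j ^ 2 / 2 - 2 * (1 - μ * f (a j)) with hEin
  set Eout : ℕ → ℝ := fun j => pout j ^ 2 / 2 - 2 * (1 - μ * f (a (j + 1))) with hEout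
  set Dv : ℕ → (Fin n → ℝ) → ℝ := fun j v => if j = 0 then Dm (a 1) v else
    if j = k + 1 then Dp (a (k + 1)) v else D j (a j) (m j) v with hDv
  have hlin : ∀ j (x y : ℝ) u v, Dv j (x • u + y • v) = x * Dv j u + y * Dv j v := by
    intro j x y u v
    simp only [hDv]
    split_ifs
    · exact Hm.lin _ _ _ _ _
    · exact Hp.lin _ _ _ _ _
    · exact (Hj j).lin _ _ (hmν j).le _ _ _ _
  have hDm : Dm (a 1) ω = -Eout 0 := by
    have h1 := Hm.lin (a 1) (-1) 0 ω ω
    have h2 := Hm.Dw (a 1)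
    have e : (-1:ℝ) • ω + (0:ℝ) • ω = -ω := by module
    rw [e, h2] at h1
    simp only [hEout, hpout, if_true, zero_add]; linarith
  have c1 : ∀ j ≤ k, HasDerivAt (fun h : ℝ => dmV k ω T Um Up U j A (S j) (S (j + 1) + h))
      (-Eout j) 0 := by
    intro j hj
    unfold dmV
    by_cases h0 : j = 0
    · subst h0
      simp only [if_true, zero_add]
      have h := Hm.der (a 1) ω
      rw [hDm] at h
      have e : (fun h : ℝ => Um (a 1 + h • ω)) = fun h : ℝ => Um (A + (T 1 + (S 1 + h)) • ω) := by
        ext h; congr 1; simp only [ha, hθ]; module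
      rw [e] at h; exact h
    · simp only [if_neg h0, if_neg (show j ≠ k + 1 by omega)]
      have h := (Hj j).derb (a j) (m j) (hmν j)
      rw [haL] at h
      have e : (fun h : ℝ => U j (a j) (m j + h / (T (j + 1) - T j))) =
          fun h : ℝ => U j (A + (T j + S j) • ω) (1 + (S (j + 1) + h - S j) / (T (j + 1) - T j)) := by
        ext h; congr 1; simp only [hm]; ring
      rw [e] at h
      refine h.congr_deriv ?_
      simp only [hEout, hpout, if_neg h0]
  have c2 : ∀ j ≤ k, HasDerivAt (fun h : ℝ => dmV k ω T Um Up U (j + 1) A (S (j + 1) + h) (S (j + 2)))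
      (Ein (j + 1)) 0 := by
    intro j hj
    unfold dmV
    by_cases h0 : j = k
    · subst h0
      simp only [if_true, if_neg (Nat.succ_ne_zero j)]
      have h := Hp.der (a (j + 1)) ω
      rw [Hp.Dw] at h
      have e : (fun h : ℝ => Up (a (j + 1) + h • ω)) =
          fun h : ℝ => Up (A + (T (j + 1) + (S (j + 1) + h)) • ω) := by
        ext h; congr 1; simp only [ha, hθ]; module
      rw [e] at h
      refine h.congr_deriv ?_
      simp only [hEin, hpin, if_true]
    · simp only [if_neg (Nat.succ_ne_zero j), if_neg (show j + 1 ≠ k + 1 by omega)]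
      have h := (Hj (j + 1)).dera (a (j + 1)) (m (j + 1)) (hmν (j + 1))
      have e : (fun h : ℝ => U (j + 1) (a (j + 1) + h • ω) (m (j + 1) - h / (T (j + 1 + 1) - T (j + 1)))) =
          fun h : ℝ => U (j + 1) (A + (T (j + 1) + (S (j + 1) + h)) • ω)
            (1 + (S (j + 2) - (S (j + 1) + h)) / (T (j + 1 + 1) - T (j + 1))) := by
        ext h; congr 1
        · simp only [ha, hθ]; module
        · simp only [hm]; ring
      rw [e] at h
      refine h.congr_deriv ?_
      simp only [hEin, hpin, if_neg (show j + 1 ≠ k + 1 by omega)]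
  have hE : ∀ j ≤ k, Eout j = Ein (j + 1) := fun j hj => by
    have := (hloc j hj).hasDerivAt_eq_zero ((c1 j hj).add (c2 j hj))
    linarith
  have hpo : ∀ j, 0 < pout j := fun j => by
    simp only [hpout]; split_ifs
    · exact Hm.pos _
    · exact ((Hj j).pos _ _ (hmν j).le).2
  have hpi : ∀ j, 0 < pin j := fun j => by
    simp only [hpin]; split_ifs
    · exact Hp.pos _
    · exact ((Hj j).pos _ _ (hmν j).le).1
  have hmatch : ∀ j ≤ k, pout j = pin (j + 1) := fun j hj => by
    have h := hE j hj
    simp only [hEin, hEout] at h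
    have h2 : pout j ^ 2 = pin (j + 1) ^ 2 := by linarith
    exact (pow_left_inj₀ (hpo j).le (hpi (j + 1)).le (by norm_num)).1 h2
  have c3 : ∀ j v, HasDerivAt (fun h : ℝ => dmV k ω T Um Up U j (A + h • v) (S j) (S (j + 1)))
      (Dv j v) 0 := by
    intro j v
    unfold dmV
    simp only [hDv]
    split_ifs with h0 h1
    · have h := Hm.der (a 1) v
      have e : (fun h : ℝ => Um (a 1 + h • v)) = fun h : ℝ => Um (A + h • v + (T 1 + S (j + 1)) • ω) := by
        subst h0
        ext h; congr 1; simp only [ha, hθ, zero_add]; module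
      rw [e] at h; exact h
    · have h := Hp.der (a (k + 1)) v
      have e : (fun h : ℝ => Up (a (k + 1) + h • v)) =
          fun h : ℝ => Up (A + h • v + (T (k + 1) + S j) • ω) := by
        subst h1
        ext h; congr 1; simp only [ha, hθ]; module
      rw [e] at h; exact h
    · have h := (Hj j).der (a j) (m j) v (hmν j).le
      have e : (fun h : ℝ => U j (a j + h • v) (m j)) =
          fun h : ℝ => U j (A + h • v + (T j + S j) • ω) (1 + (S (j + 1) - S j) / (T (j + 1) - T j)) := by
        ext h; congr 1; simp only [ha, hθ]; module
      rw [e] at h; exact h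
  have c4 : ∑ j ∈ Finset.range (k + 2), Dv j ω = 0 := by
    set g : ℕ → ℝ := fun j => if j = 0 ∨ j = k + 2 then 0 else Ein j with hg
    have : ∀ j ∈ Finset.range (k + 2), Dv j ω = g j - g (j + 1) := by
      intro j hj
      rw [Finset.mem_range] at hj
      by_cases h0 : j = 0
      · subst h0
        simp only [hDv, hg, if_true, true_or, zero_add]
        rw [if_neg (by omega), hDm, hE 0 (by omega)]; ring
      · by_cases h1 : j = k + 1
        · subst h1
          simp only [hDv, hg, if_true, if_neg h0]
          rw [if_neg (by omega), if_pos (Or.inr trivial), Hp.Dw]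
          simp only [hEin, hpin, if_true, sub_zero]
        · have := (Hj j).Dw (a j) (m j) (hmν j).le
          rw [haL] at this
          simp only [hDv, hg, if_neg h0, if_neg h1]
          rw [if_neg (by omega), if_neg (by omega), ← hE j (by omega), this]
          simp only [hEin, hpin, hEout, hpout, if_neg h0, if_neg h1]
    rw [Finset.sum_congr rfl this, Finset.sum_range_sub']
    simp [hg]
  have c6 : ∀ v : Fin n → ℝ, ∑ i, ω i * v i = 0 →
      ∑ j ∈ Finset.range (k + 2), Dv j v = ∑ i, (I0' - I0) i * v i := by
    intro v hv
    have h1 : HasDerivAt (fun h : ℝ => ∑ j ∈ Finset.range (k + 2),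
        dmV k ω T Um Up U j (A + h • v) (S j) (S (j + 1))) (∑ j ∈ Finset.range (k + 2), Dv j v) 0 :=
      HasDerivAt.fun_sum (fun j _ => c3 j v)
    have h2 : HasDerivAt (fun h : ℝ => ∑ i, (I0' - I0) i * (A + h • v) i)
        (∑ i, (I0' - I0) i * v i) 0 := by
      refine HasDerivAt.fun_sum (fun i _ => ?_)
      have := (((hasDerivAt_id (0:ℝ)).mul_const (v i)).const_add (A i)).const_mul ((I0' - I0) i)
      exact this.congr_deriv (by simp)
    have := (hvar v hv).hasDerivAt_eq_zero (h1.sub h2)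
    linarith
  have c7 : ∀ i, ∑ j ∈ Finset.range (k + 2), Dv j (Pi.single i 1) = (I0' - I0) i := by
    intro i
    set s := ω i / ∑ i, ω i * ω i with hs
    have hv : ∑ l, ω l * ((1:ℝ) • (Pi.single i 1 : Fin n → ℝ) + (-s) • ω) l = 0 := by
      have : ∀ l, ω l * ((1:ℝ) • (Pi.single i 1 : Fin n → ℝ) + (-s) • ω) l =
          ω l * (Pi.single i 1 : Fin n → ℝ) l - s * (ω l * ω l) := fun l => by
        simp only [Pi.add_apply, Pi.smul_apply, smul_eq_mul]; ring
      rw [Finset.sum_congr rfl (fun l _ => this l), Finset.sum_sub_distrib, ← Finset.mul_sum, hs,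
        div_mul_cancel₀ _ hω0.ne']
      simp [Pi.single_apply]
    have h := c6 _ hv
    have h1 : ∑ j ∈ Finset.range (k + 2), Dv j ((1:ℝ) • (Pi.single i 1 : Fin n → ℝ) + (-s) • ω) =
        ∑ j ∈ Finset.range (k + 2), Dv j (Pi.single i 1) := by
      rw [Finset.sum_congr rfl (fun j _ => hlin j 1 (-s) _ _), Finset.sum_add_distrib, ← Finset.mul_sum,
        ← Finset.mul_sum, c4]; ring
    have h2 : ∑ l, (I0' - I0) l * ((1:ℝ) • (Pi.single i 1 : Fin n → ℝ) + (-s) • ω) l = (I0' - I0) i := by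
      have : ∀ l, (I0' - I0) l * ((1:ℝ) • (Pi.single i 1 : Fin n → ℝ) + (-s) • ω) l =
          (I0' - I0) l * (Pi.single i 1 : Fin n → ℝ) l - s * (ω l * I0' l - ω l * I0 l) := fun l => by
        simp only [Pi.add_apply, Pi.smul_apply, smul_eq_mul, Pi.sub_apply]; ring
      rw [Finset.sum_congr rfl (fun l _ => this l), Finset.sum_sub_distrib, ← Finset.mul_sum,
        Finset.sum_sub_distrib, hω]
      simp [Pi.single_apply]
    rw [h1, h2] at h; exact h
  obtain ⟨q0, p0, J0, B0, l0, l1, l2, l3⟩ := Hm.traj (a 1)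
  obtain ⟨qr, pr, Jr, B1, r0, r1, r2, r3⟩ := Hp.traj (a (k + 1))
  choose q p J t1 t2 t3 t4 t5 t6 t7 using fun j => (Hj j).traj (a j) (m j) (hmν j).le
  refine dm_sol ω A f μ k θ (fun j i => Dv j (Pi.single i 1)) pin pout I0 I0'
    (fun j => if j = k + 1 then qr else q j) (fun j => if j = k + 1 then pr else p j)
    (fun j => if j = k + 1 then Jr else J j) q0 p0 J0 B0 B1 (fun j _ => hθlt (j + 1)) hμ hμ1 l0
    (by simp only [hpout, if_true]; exact l1) l2 (fun t ht => ?_) (fun j hj => ?_) (fun j hj => ?_)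
    (fun j hj t ht ht2 => ?_) (fun t ht => ?_) hmatch ?_
  · simp only [hDv, if_true]; exact l3 t ht
  · simp only [hpin]
    split_ifs with h
    · rw [h]; exact ⟨r0, r1, r2⟩
    · exact ⟨t1 _, t2 _, t3 _⟩
  · simp only [if_neg (show j + 1 ≠ k + 1 by omega), hpout, if_neg (Nat.succ_ne_zero j), hDv]
    have h4 := t4 (j + 1)
    have h5 := t5 (j + 1)
    have h6 := t6 (j + 1)
    rw [hmL] at h4 h5 h6
    exact ⟨h4, h5, h6⟩
  · by_cases h : j = k
    · subst h
      simp only [if_true]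
      obtain ⟨x1, x2, x3, -⟩ := r3 t ht
      exact ⟨x1, x2, x3⟩
    · simp only [if_neg (show j + 1 ≠ k + 1 by omega)]
      have := t7 (j + 1) t (by rw [hmL]; exact ⟨ht, ht2 (by omega)⟩)
      exact this
  · simp only [if_true, hDv, if_neg (Nat.succ_ne_zero k)]
    exact (r3 t ht).2.2.2
  · ext i
    rw [Finset.sum_apply]; exact c7 i
end
end DmPart18

section DmPart19
open Set Topology

section
variable {n : ℕ} {f : (Fin n → ℝ) → ℝ} {f1 : (Fin n → ℝ) → (Fin n → ℝ) →L[ℝ] ℝ} {M μ : ℝ}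

lemma dm_consts (F : FB f f1 M) (hn : 0 < n) (ω As : Fin n → ℝ) (hω : 0 < ‖ω‖) (c0 r : ℝ) (hc0 : 0 < c0)
    (hr : 0 < r) (hq : ∀ v : Fin n → ℝ, ‖v‖ ≤ r → (gm f ω As + gm f (-ω) As) + c0 * ‖v‖^2 ≤
      gm f ω (As + v) + gm f (-ω) (As + v)) :
    ∃ σ > (0:ℝ), ∃ ρ > (0:ℝ), ∃ κ > (0:ℝ), ∃ c > (0:ℝ), 4 * κ ≤ c ∧
    (∀ A x, ‖A - As‖ ≤ ρ → ∑ i, ω i * (A - As) i = 0 → |x| = σ →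
      gm f ω A + gm f (-ω) A + 4 * κ < gm f ω (A + x • ω) + gm f (-ω) (A + x • ω)) ∧
    (∀ A x, ‖A - As‖ = ρ → ∑ i, ω i * (A - As) i = 0 → |x| ≤ σ →
      gm f ω As + gm f (-ω) As + c ≤ gm f ω (A + x • ω) + gm f (-ω) (A + x • ω)) := by
  have hM := F.M1
  have hn' : (0:ℝ) < n := by exact_mod_cast hn
  set ρ := min (r/4) (c0 * r^2 / (1024 * M)) with hρ
  have hρ0 : 0 < ρ := by positivity
  have hρ1 : ρ ≤ r/4 := min_le_left _ _
  have hρ2 : 32 * M * ρ ≤ c0 * r^2 / 32 := by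
    have : ρ ≤ c0 * r^2 / (1024 * M) := min_le_right _ _
    rw [le_div_iff₀ (by positivity)] at this; linarith
  set c := c0 * ρ^2 / n with hc
  have hcp : 0 < c := by positivity
  have hσN : r / (2 * ‖ω‖) * ‖ω‖ = r/2 := by field_simp
  have e : ∀ (A : Fin n → ℝ) (x : ℝ), As + (A - As + x • ω) = A + x • ω := fun A x => by module
  refine ⟨r/(2 * ‖ω‖), by positivity, ρ, hρ0, min (c0 * r^2/256) (c/4), by positivity, c, hcp, ?_, ?_, ?_⟩
  · have := min_le_right (c0 * r^2/256) (c/4); linarith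
  · intro A x hA _ hx
    have h1 : ‖x • ω‖ = r/2 := by rw [norm_smul, Real.norm_eq_abs, hx, hσN]
    have h2 : r/4 ≤ ‖A - As + x • ω‖ := by
      have := norm_sub_norm_le (x • ω) (-(A - As))
      rw [norm_neg, sub_neg_eq_add, add_comm (x • ω)] at this
      linarith
    have h3 : ‖A - As + x • ω‖ ≤ r := by
      have := norm_add_le (A - As) (x • ω); linarith
    have h4 := hq _ h3
    rw [e] at h4
    have h5 : (r/4)^2 ≤ ‖A - As + x • ω‖^2 := pow_le_pow_left₀ (by positivity) h2 2
    have h6 := mul_le_mul_of_nonneg_left h5 hc0.le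
    have l1 := (abs_le.1 (gm_lip F ω A As)).2
    have l2 := (abs_le.1 (gm_lip F (-ω) A As)).2
    have l3 := mul_le_mul_of_nonneg_left hA (show 0 ≤ 16 * M by positivity)
    have k1 := min_le_left (c0 * r^2/256) (c/4)
    have : 0 < c0 * r^2 := by positivity
    linarith
  · intro A x hA hp hx
    have h1 : ‖x • ω‖ ≤ r/2 := by
      rw [norm_smul, Real.norm_eq_abs, ← hσN]; exact mul_le_mul_of_nonneg_right hx hω.le
    have h3 : ‖A - As + x • ω‖ ≤ r := by
      have := norm_add_le (A - As) (x • ω); linarith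
    have h4 := hq _ h3
    rw [e] at h4
    have h5 := dm_perp ω (A - As) x hp
    rw [hA] at h5
    have h6 : c ≤ c0 * ‖A - As + x • ω‖^2 := by
      rw [hc, div_le_iff₀ hn']
      nlinarith
    linarith

lemma gm_shift (F : FB f f1 M)
    (hper : ∀ (k : Fin n → ℤ) (x : Fin n → ℝ), f (x + fun i => 2 * Real.pi * (k i : ℝ)) = f x)
    (w ω A : Fin n → ℝ) (t x ε : ℝ)
    (h : ∃ k : Fin n → ℤ, ‖t • ω - fun i => 2 * Real.pi * (k i : ℝ)‖ ≤ ε) :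
    |gm f w (A + (t + x) • ω) - gm f w (A + x • ω)| ≤ 16 * M * ε := by
  obtain ⟨k, hk⟩ := h
  have hM := F.M1
  rw [← gm_per hper w (A + x • ω) k]
  refine (gm_lip F w _ _).trans (mul_le_mul_of_nonneg_left ?_ (by positivity))
  have : A + (t + x) • ω - (A + x • ω + fun i => 2 * Real.pi * (k i : ℝ)) =
    t • ω - fun i => 2 * Real.pi * (k i : ℝ) := by module
  rw [this]; exact hk

set_option maxHeartbeats 2000000 in
lemma dm_main (F : FB f (fderiv ℝ f) M)
    (hper : ∀ (k : Fin n → ℤ) (x : Fin n → ℝ), f (x + fun i => 2 * Real.pi * (k i : ℝ)) = f x)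
    (ω As : Fin n → ℝ) (hω0 : 0 < ∑ i, ω i * ω i) (σ ρ κ c : ℝ) (hσ : 0 < σ) (hρ : 0 < ρ)
    (hκ : 0 < κ) (hc : 0 < c) (hκc : 4 * κ ≤ c)
    (hs : ∀ A x, ‖A - As‖ ≤ ρ → ∑ i, ω i * (A - As) i = 0 → |x| = σ →
      gm f ω A + gm f (-ω) A + 4 * κ < gm f ω (A + x • ω) + gm f (-ω) (A + x • ω))
    (hA : ∀ A x, ‖A - As‖ = ρ → ∑ i, ω i * (A - As) i = 0 → |x| ≤ σ →
      gm f ω As + gm f (-ω) As + c ≤ gm f ω (A + x • ω) + gm f (-ω) (A + x • ω))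
    (hμ : 0 < μ) (hμ1 : M * μ ≤ 1/10^9) (hμ2 : 10^18 * M^2 * (1 + ‖ω‖) * μ ≤ κ/4)
    (I0 I0' : Fin n → ℝ) (hω : ∑ i, ω i * I0 i = ∑ i, ω i * I0' i) :
    (∃ (φ I : ℝ → Fin n → ℝ) (qq pp : ℝ → ℝ),
          IsSolution n ω f μ φ I qq pp ∧
          Tendsto (fun t => Metric.infDist (φ t, I t, qq t, pp t) (TorusSet n I0))
            atBot (nhds 0) ∧
          Tendsto (fun t => Metric.infDist (φ t, I t, qq t, pp t) (TorusSet n I0'))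
            atTop (nhds 0)) ∧
        ∃ η0 > (0:ℝ), ∀ η : ℝ, 0 < η → η < η0 →
          ∃ (φ I : ℝ → Fin n → ℝ) (qq pp : ℝ → ℝ) (t0 t1 : ℝ),
            IsSolution n ω f μ φ I qq pp ∧ t0 ≤ t1 ∧
            Metric.infDist (φ t0, I t0, qq t0, pp t0) (TorusSet n I0) < η ∧
            Metric.infDist (φ t1, I t1, qq t1, pp t1) (TorusSet n I0') < η ∧
            t1 - t0 ≤ 5 * (1 / μ) * Real.log (1 / μ) + 5 * |Real.log η| := by
  have hM := F.M1
  have hN := norm_nonneg ω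
  have hμs : μ ≤ 1/10^9 := by nlinarith
  set K := 10^18 * M^2 * (1 + ‖ω‖) with hK
  have hKp : 0 < K := by positivity
  set ν := min μ (κ * μ / (4 * K)) with hν
  have hν0 : 0 < ν := by positivity
  have hνμ : ν ≤ μ := min_le_left _ _
  have hν2 : K * ν ≤ κ * μ / 4 := by
    have : ν ≤ κ * μ / (4 * K) := min_le_right _ _
    rw [le_div_iff₀ (by positivity)] at this; linarith
  set ε := κ / (64 * M) with hε
  have hε0 : 0 < ε := by positivity
  have hεM : 32 * M * ε = κ / 2 := by rw [hε]; field_simp; norm_num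
  set L := 2 + 2 * σ / ν + |2 * Real.log (ν / 200)| with hL
  have hL1 : 0 < 2 * σ / ν := by positivity
  have hL2 : 2 ≤ L := by have := abs_nonneg (2 * Real.log (ν / 200)); linarith
  have hL3 : 2 * σ / ν < L := by have := abs_nonneg (2 * Real.log (ν / 200)); linarith
  have hL4 : 200 * Real.exp (-L/2) ≤ ν := by
    have h1 : Real.exp (-L/2) ≤ Real.exp (Real.log (ν / 200)) := Real.exp_le_exp.2 (by
      have := neg_abs_le (2 * Real.log (ν / 200)); linarith)
    rw [Real.exp_log (by positivity)] at h1; linarith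
  obtain ⟨T, hT, hTk⟩ := dm_rec ω ε L hε0
  obtain ⟨k, hk⟩ := exists_nat_gt (2 * (n * ‖I0' - I0‖ * ρ) / (μ * c))
  obtain ⟨Um, pm, Dm, Hm⟩ := dm_half F hμ.le hμ1 (-ω)
  obtain ⟨Up, pp, Dp, Hp⟩ := dm_half F hμ.le hμ1 ω
  have hLj : ∀ j, 200 * Real.exp (-(T (j + 1) - T j)/2) ≤ ν := fun j => by
    have h1 : Real.exp (-(T (j + 1) - T j)/2) ≤ Real.exp (-L/2) := Real.exp_le_exp.2 (by linarith [hT j])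
    linarith
  choose U pa pb D Hj using fun j => dm_mid F hμ.le hμ1 (T (j + 1) - T j) (hL2.trans (hT j)) ν
    (by have := hLj j; linarith) hνμ (hLj j) ω
  set e0 := dmJ (Ici 0) (fun _ => 1) (fun t => -dmA t) (fun t => -dmA1 t) with he0
  have hTpos : ∀ j, 0 < T (j + 1) - T j := fun j => by linarith [hT j]
  have hσν : ∀ j x y, |x| ≤ σ → |y| ≤ σ → |(y - x) / (T (j + 1) - T j)| < ν := by
    intro j x y hx hy
    rw [abs_div, abs_of_pos (hTpos j), div_lt_iff₀ (hTpos j)]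
    rw [div_lt_iff₀ hν0] at hL3
    have h1 := abs_sub y x
    have h2 := mul_le_mul_of_nonneg_left (hT j) hν0.le
    have h3 : |y - x| ≤ |y| + |x| := by
      rw [sub_eq_add_neg]; have := abs_add_le y (-x); rwa [abs_neg] at this
    linarith
  have hhalf : 10^18 * M^2 * μ^2 + μ * (16 * M * ε) ≤ κ * μ := by
    have h1 : 10^18 * M^2 ≤ K := by
      rw [hK]; exact le_mul_of_one_le_right (by positivity) (by linarith)
    have h2 := mul_le_mul_of_nonneg_right h1 hμ.le
    have h3 := mul_le_mul_of_nonneg_right (h2.trans hμ2) hμ.le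
    have h4 : μ * (16 * M * ε) = κ * μ / 4 := by
      rw [show 16 * M * ε = κ / 4 by linarith]; ring
    have : 0 < κ * μ := by positivity
    rw [h4]
    nlinarith
  obtain ⟨A, S, hS, -, hloc, hvar⟩ := dm_max k ω As (gm f ω) (gm f (-ω)) (dmV k ω T Um Up U)
    (fun j => if j = 0 then e0 else if j = k + 1 then e0 else
      dmJ (Icc 0 (T (j + 1) - T j)) (fun _ => 1) (dmQ (T (j + 1) - T j)) (dmQ1 (T (j + 1) - T j)))
    σ ρ κ μ c (I0' - I0) hσ hρ hμ (fun j hj => by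
      unfold dmV
      split_ifs
      · exact (Hm.cont.comp (by fun_prop)).continuousOn
      · exact (Hp.cont.comp (by fun_prop)).continuousOn
      · refine (Hj j).cont.comp (f := fun x : (Fin n → ℝ) × ℝ × ℝ =>
          (x.1 + (T j + x.2.1) • ω, 1 + (x.2.2 - x.2.1) / (T (j + 1) - T j))) ?_ (fun x hx => ?_)
        · exact Continuous.continuousOn (by fun_prop)
        · have := hσν j _ _ hx.1 hx.2
          show |1 + (x.2.2 - x.2.1) / (T (j + 1) - T j) - 1| ≤ ν
          rw [add_sub_cancel_left]; exact this.le)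
    (fun j hj A x y hx hy => by
      unfold dmV
      by_cases h0 : j = 0
      · simp only [if_pos h0, if_neg (show j ≠ k + 1 by omega), mul_zero, sub_zero]
        have h1 := Hm.val (A + (T 1 + y) • ω)
        have h2 := gm_shift F hper (-ω) ω A (T 1) y ε (hTk 1)
        have h3 : |μ * (gm f (-ω) (A + (T 1 + y) • ω) - gm f (-ω) (A + y • ω))| ≤ μ * (16 * M * ε) := by
          rw [abs_mul, abs_of_pos hμ]; exact mul_le_mul_of_nonneg_left h2 hμ.le
        rw [abs_le] at *
        constructor <;> linarith [h1.1, h1.2, h3.1, h3.2]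
      · by_cases h1 : j = k + 1
        · simp only [if_neg h0, if_pos h1, mul_zero, sub_zero]
          have h1 := Hp.val (A + (T (k + 1) + x) • ω)
          have h2 := gm_shift F hper ω ω A (T (k + 1)) x ε (hTk (k + 1))
          have h3 : |μ * (gm f ω (A + (T (k + 1) + x) • ω) - gm f ω (A + x • ω))| ≤ μ * (16 * M * ε) := by
            rw [abs_mul, abs_of_pos hμ]; exact mul_le_mul_of_nonneg_left h2 hμ.le
          rw [abs_le] at *
          constructor <;> linarith [h1.1, h1.2, h3.1, h3.2]
        · simp only [if_neg h0, if_neg h1]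
          have hm : |1 + (y - x) / (T (j + 1) - T j) - 1| ≤ ν := by
            rw [add_sub_cancel_left]; exact (hσν j x y hx hy).le
          have h1 := (Hj j).val (A + (T j + x) • ω) _ hm
          have e : A + (T j + x) • ω + ((1 + (y - x) / (T (j + 1) - T j)) * (T (j + 1) - T j)) • ω =
              A + (T (j + 1) + y) • ω := by
            have := (hTpos j).ne'
            rw [show (1 + (y - x) / (T (j + 1) - T j)) * (T (j + 1) - T j) =
              T (j + 1) - T j + (y - x) by field_simp]
            module
          rw [e] at h1
          have h2 := gm_shift F hper ω ω A (T j) x ε (hTk j)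
          have h3 : |μ * (gm f ω (A + (T j + x) • ω) - gm f ω (A + x • ω))| ≤ μ * (16 * M * ε) := by
            rw [abs_mul, abs_of_pos hμ]; exact mul_le_mul_of_nonneg_left h2 hμ.le
          have h4 := gm_shift F hper (-ω) ω A (T (j + 1)) y ε (hTk (j + 1))
          have h5 : |μ * (gm f (-ω) (A + (T (j + 1) + y) • ω) - gm f (-ω) (A + y • ω))| ≤
              μ * (16 * M * ε) := by
            rw [abs_mul, abs_of_pos hμ]; exact mul_le_mul_of_nonneg_left h4 hμ.le
          have h6 : K * (μ^2 + ν) + μ * (16 * M * ε) + μ * (16 * M * ε) ≤ κ * μ := by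
            have g3 := mul_le_mul_of_nonneg_right hμ2 hμ.le
            have g4 : μ * (16 * M * ε) = κ * μ / 4 := by
              rw [show 16 * M * ε = κ / 4 by linarith]; ring
            rw [g4]
            nlinarith
          rw [abs_le] at *
          constructor <;> linarith [h1.1, h1.2, h3.1, h3.2, h5.1, h5.2])
    hs hA (by
      rw [div_lt_iff₀ (by positivity)] at hk
      have h1 : 2 * ((k:ℝ) + 2) * (κ * μ) ≤ ((k:ℝ) + 2) * (μ * c) / 2 := by
        have h0 : (0:ℝ) ≤ ((k:ℝ) + 2) * μ := by positivity
        have h2 := mul_le_mul_of_nonneg_left hκc h0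
        linarith
      have h3 : ((k:ℝ) + 1) * (μ * c) = k * (μ * c) / 2 + ((k:ℝ) + 2) * (μ * c) / 2 := by ring
      rw [h3]
      linarith)
  exact dm_crit ω f M μ ν σ _ _ k T _ Um Up pm pp Dm Dp U pa pb D hμ (by linarith) Hm Hp Hj hTpos
    (by linarith) hσν A S hS hloc I0 I0' hvar hω hω0
end
end DmPart19

section DmPart20
open Set Topology

section
lemma dm_gcont {n : ℕ} {f : (Fin n → ℝ) → ℝ} {f1 : (Fin n → ℝ) → (Fin n → ℝ) →L[ℝ] ℝ} {M : ℝ}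
    (F : FB f f1 M) (w : Fin n → ℝ) : Continuous (gm f w) := by
  have hM := F.M1
  refine (LipschitzWith.of_dist_le_mul (K := ⟨16 * M, by positivity⟩) (fun x y => ?_)).continuous
  rw [Real.dist_eq, dist_eq_norm]
  exact gm_lip F w x y

lemma dm_thm (n : ℕ) (ω : Fin n → ℝ) (γ τ : ℝ) (hγ : 0 < γ)
    (hH1 : ∀ k : Fin n → ℤ, k ≠ 0 →
      γ / ‖(fun i => (k i : ℝ))‖ ^ τ ≤ |∑ i, (k i : ℝ) * ω i|)
    (f : (Fin n → ℝ) → ℝ) (hf : ContDiff ℝ (⊤ : ℕ∞) f)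
    (hper : ∀ (k : Fin n → ℤ) (x : Fin n → ℝ),
      f (x + fun i => 2 * Real.pi * (k i : ℝ)) = f x)
    (Astar : Fin n → ℝ)
    (hcrit : fderiv ℝ (Melnikov n ω f) Astar = 0)
    (hnondeg : ∀ v : Fin n → ℝ, v ≠ 0 →
      0 < iteratedFDeriv ℝ 2 (Melnikov n ω f) Astar ![v, v]) :
    ∃ μ0 > (0:ℝ), ∃ C > (0:ℝ), ∀ μ : ℝ, 0 < μ → μ < μ0 →
      ∀ I0 I0' : Fin n → ℝ, ∑ i, ω i * I0 i = ∑ i, ω i * I0' i →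
        (∃ (φ I : ℝ → Fin n → ℝ) (qq pp : ℝ → ℝ),
          IsSolution n ω f μ φ I qq pp ∧
          Tendsto (fun t => Metric.infDist (φ t, I t, qq t, pp t) (TorusSet n I0))
            atBot (nhds 0) ∧
          Tendsto (fun t => Metric.infDist (φ t, I t, qq t, pp t) (TorusSet n I0'))
            atTop (nhds 0)) ∧
        ∃ η0 > (0:ℝ), ∀ η : ℝ, 0 < η → η < η0 →
          ∃ (φ I : ℝ → Fin n → ℝ) (qq pp : ℝ → ℝ) (t0 t1 : ℝ),
            IsSolution n ω f μ φ I qq pp ∧ t0 ≤ t1 ∧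
            Metric.infDist (φ t0, I t0, qq t0, pp t0) (TorusSet n I0) < η ∧
            Metric.infDist (φ t1, I t1, qq t1, pp t1) (TorusSet n I0') < η ∧
            t1 - t0 ≤ C * (1 / μ) * Real.log (1 / μ) + C * |Real.log η| := by
  rcases Nat.eq_zero_or_pos n with hn | hn
  · subst hn
    refine ⟨1, one_pos, 5, by norm_num, fun μ hμ hμ1 I0 I0' _ => ?_⟩
    have e : I0' = I0 := Subsingleton.elim _ _
    subst e
    refine dm_final ω 0 f μ (fun _ => I0') (fun _ => 0) (fun _ => 0) (fun t => ?_) I0' I0' 0 0 1 0 le_rfl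
      le_rfl hμ hμ1.le (fun t _ => ?_) (fun t _ => ?_)
    · refine ⟨?_, ?_, hasDerivAt_const _ _, ?_⟩
      · have := ((hasDerivAt_id t).smul_const ω).const_add (0 : Fin 0 → ℝ)
        exact this.congr_deriv (by simp)
      · exact (hasDerivAt_const t I0').congr_deriv (Subsingleton.elim _ _)
      · exact (hasDerivAt_const t (0:ℝ)).congr_deriv (by simp)
    · rw [sub_self, norm_zero]; simp [Real.exp_nonneg]
    · rw [sub_self, norm_zero]; simp [Real.exp_nonneg]
  obtain ⟨M, F⟩ := dm_FB hf hper
  have hM := F.M1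
  have hmel : Melnikov n ω f = fun A => gm f ω A + gm f (-ω) A := funext (dm_mel F ω)
  have hcont : Continuous (Melnikov n ω f) := by
    rw [hmel]; exact (dm_gcont F ω).add (dm_gcont F (-ω))
  obtain ⟨c0, hc0, r, hr, hq⟩ := dm_quad (Melnikov n ω f) hcont hn Astar hcrit hnondeg
  simp only [hmel] at hq
  have hωi : ω ⟨0, hn⟩ ≠ 0 := by
    have hk : (Pi.single (⟨0, hn⟩ : Fin n) (1:ℤ) : Fin n → ℤ) ≠ 0 := by
      intro h; have := congrFun h ⟨0, hn⟩; simp at this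
    have h := hH1 _ hk
    have hnorm : 0 < ‖(fun i => (((Pi.single (⟨0, hn⟩ : Fin n) (1:ℤ) : Fin n → ℤ) i : ℤ) : ℝ))‖ := by
      rw [norm_pos_iff]
      intro h; have := congrFun h ⟨0, hn⟩; simp at this
    have h2 := lt_of_lt_of_le (div_pos hγ (Real.rpow_pos_of_pos hnorm τ)) h
    intro h0
    have : ∑ i, (((Pi.single (⟨0, hn⟩ : Fin n) (1:ℤ) : Fin n → ℤ) i : ℤ) : ℝ) * ω i = 0 := by
      refine Finset.sum_eq_zero (fun i _ => ?_)
      by_cases hi : i = ⟨0, hn⟩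
      · rw [hi, h0, mul_zero]
      · rw [Pi.single_eq_of_ne hi]; simp
    rw [this, abs_zero] at h2
    exact lt_irrefl _ h2
  have hω0 : 0 < ∑ i, ω i * ω i :=
    Finset.sum_pos' (fun i _ => mul_self_nonneg _) ⟨_, Finset.mem_univ _, mul_self_pos.2 hωi⟩
  have hωn : 0 < ‖ω‖ := norm_pos_iff.2 (fun h => hωi (by rw [h]; rfl))
  obtain ⟨σ, hσ, ρ, hρ, κ, hκ, c, hc, hκc, hs, hA⟩ := dm_consts F hn ω Astar hωn c0 r hc0 hr hq
  refine ⟨min (1/10^9/M) (κ/4/(10^18 * M^2 * (1 + ‖ω‖))), by positivity, 5, by norm_num,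
    fun μ hμ hμ1 I0 I0' hI => ?_⟩
  refine dm_main F hper ω Astar hω0 σ ρ κ c hσ hρ hκ hc hκc hs hA hμ ?_ ?_ I0 I0' hI
  · have h := (hμ1.trans_le (min_le_left _ _)).le
    rw [le_div_iff₀ (by positivity)] at h; linarith
  · have h := (hμ1.trans_le (min_le_right _ _)).le
    rw [le_div_iff₀ (by positivity)] at h; linarith
end
end DmPart20

/-- Assume (H1) and that the Poincaré–Melnikov primitive `Γ` has a non-degenerate
minimum. Then for `μ` small there are heteroclinic orbits connecting any two tori
`T_{I₀}`, `T_{I₀'}` with `ω·I₀ = ω·I₀'`, and the diffusion time satisfies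
`T_d ≤ C (1/μ) log(1/μ) + C |ln η|`. -/
theorem diffusion_from_melnikov_minimum
    (n : ℕ) (ω : Fin n → ℝ) (γ τ : ℝ) (hγ : 0 < γ) (hτ : (n : ℝ) < τ)
    (hH1 : ∀ k : Fin n → ℤ, k ≠ 0 →
      γ / ‖(fun i => (k i : ℝ))‖ ^ τ ≤ |∑ i, (k i : ℝ) * ω i|)
    (f : (Fin n → ℝ) → ℝ) (hf : ContDiff ℝ (⊤ : ℕ∞) f)
    (hper : ∀ (k : Fin n → ℤ) (x : Fin n → ℝ),
      f (x + fun i => 2 * Real.pi * (k i : ℝ)) = f x)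
    (Astar : Fin n → ℝ)
    (hmin : IsLocalMin (Melnikov n ω f) Astar)
    (hcrit : fderiv ℝ (Melnikov n ω f) Astar = 0)
    (hnondeg : ∀ v : Fin n → ℝ, v ≠ 0 →
      0 < iteratedFDeriv ℝ 2 (Melnikov n ω f) Astar ![v, v]) :
    ∃ μ0 > (0:ℝ), ∃ C > (0:ℝ), ∀ μ : ℝ, 0 < μ → μ < μ0 →
      ∀ I0 I0' : Fin n → ℝ, ∑ i, ω i * I0 i = ∑ i, ω i * I0' i →
        (∃ (φ I : ℝ → Fin n → ℝ) (qq pp : ℝ → ℝ),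
          IsSolution n ω f μ φ I qq pp ∧
          Tendsto (fun t => Metric.infDist (φ t, I t, qq t, pp t) (TorusSet n I0))
            atBot (nhds 0) ∧
          Tendsto (fun t => Metric.infDist (φ t, I t, qq t, pp t) (TorusSet n I0'))
            atTop (nhds 0)) ∧
        ∃ η0 > (0:ℝ), ∀ η : ℝ, 0 < η → η < η0 →
          ∃ (φ I : ℝ → Fin n → ℝ) (qq pp : ℝ → ℝ) (t0 t1 : ℝ),
            IsSolution n ω f μ φ I qq pp ∧ t0 ≤ t1 ∧
            Metric.infDist (φ t0, I t0, qq t0, pp t0) (TorusSet n I0) < η ∧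
            Metric.infDist (φ t1, I t1, qq t1, pp t1) (TorusSet n I0') < η ∧
            t1 - t0 ≤ C * (1 / μ) * Real.log (1 / μ) + C * |Real.log η| := by
  exact dm_thm n ω γ τ hγ hH1 f hf hper Astar hcrit hnondeg
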